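/- Let d > 1 be a cube-free integer that is divisible by at least one prime ≡ 1 (mod 3), and let k = ℚ(∛d, ζ₃). Then rank(C_{k,3}^{(σ)}) = 1 if and only if d can be written in one of the following forms, where p is a prime ≡ 1 (mod 3), q is a prime ≡ −1 (mod 3), and e, e₁, f₁ ∈ {1, 2}: (i) d = p^{e₁} with p ≡ 1 (mod 9); (ii) d = p^{e₁} with p ≡ 4 or 7 (mod 9); (iii) d = 3^{e} p^{e₁} with p ≡ 4 or 7 (mod 9); (iv) d = p^{e₁} q^{f₁} ≡ ±1 (mod 9) with p ≡ −q ≡ 4 or 7 (mod 9). Moreover, in each of these cases the ambiguous 3-class group C_{k,3}^{(σ)} is cyclic of order 3. -/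

import Mathlib

open IntermediateField NumberField
open scoped nonZeroDivisors

set_option synthInstance.maxHeartbeats 1000000
set_option maxHeartbeats 2000000

noncomputable section

instance : Fact (Nat.Prime 3) := ⟨by norm_num⟩

/-- A positive integer is cube-free if no prime cube divides it. -/
def IsCubeFree (d : ℕ) : Prop := ∀ p : ℕ, p.Prime → ¬ (p ^ 3 ∣ d)

/-- The primitive cube root of unity `ζ₃ = e^{2πi/3}`. -/
def zeta3 : ℂ := Complex.exp (2 * Real.pi * Complex.I / 3)

lemma zeta3_isPrimitiveRoot : IsPrimitiveRoot zeta3 3 := by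
  simpa [zeta3] using Complex.isPrimitiveRoot_exp 3 (by norm_num)

lemma isIntegral_zeta3 : IsIntegral ℚ zeta3 :=
  (zeta3_isPrimitiveRoot.isIntegral (by norm_num)).tower_top

/-- The real cube root of `d`, as a complex number. -/
def cbrt (d : ℕ) : ℂ := ((d : ℝ) ^ ((3 : ℝ)⁻¹) : ℝ)

lemma cbrt_pow_three (d : ℕ) : (cbrt d) ^ 3 = (d : ℂ) := by
  have h : ((d : ℝ) ^ ((3 : ℝ)⁻¹)) ^ (3 : ℕ) = (d : ℝ) := by
    rw [← Real.rpow_natCast ((d : ℝ) ^ ((3 : ℝ)⁻¹)) 3, ← Real.rpow_mul (by positivity)]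
    norm_num
  calc (cbrt d) ^ 3 = (((((d : ℝ) ^ ((3 : ℝ)⁻¹)) ^ (3:ℕ) : ℝ)) : ℂ) := by
        push_cast [cbrt]; ring
    _ = ((d : ℝ) : ℂ) := by rw [h]
    _ = (d : ℂ) := by norm_num

lemma isIntegral_cbrt (d : ℕ) : IsIntegral ℚ (cbrt d) := by
  have h : IsIntegral ℤ (cbrt d) := by
    refine ⟨Polynomial.X ^ 3 - Polynomial.C (d : ℤ), ?_, ?_⟩
    · exact Polynomial.monic_X_pow_sub_C _ (by norm_num)
    · simp [Polynomial.eval₂, cbrt_pow_three d]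
  exact h.tower_top

/-- `k = ℚ(∛d, ζ₃)`, the normal closure of the pure cubic field `ℚ(∛d)`,
realized as a subfield of `ℂ`. -/
def Kc (d : ℕ) : IntermediateField ℚ ℂ := ℚ⟮cbrt d, zeta3⟯

instance (d : ℕ) : NumberField (Kc d) where
  to_finiteDimensional := by
    apply IntermediateField.finiteDimensional_adjoin
    rintro x (rfl | rfl)
    · exact isIntegral_cbrt d
    · exact isIntegral_zeta3

lemma zeta3_mem (d : ℕ) : zeta3 ∈ Kc d :=
  IntermediateField.subset_adjoin _ _ (by simp)

lemma cbrt_mem (d : ℕ) : cbrt d ∈ Kc d :=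
  IntermediateField.subset_adjoin _ _ (by simp)

/-- `ζ₃` as an element of `k`. -/
def zetaK (d : ℕ) : Kc d := ⟨zeta3, zeta3_mem d⟩

/-- `∛d` as an element of `k`. -/
def cbrtK (d : ℕ) : Kc d := ⟨cbrt d, cbrt_mem d⟩

/-- `k₀ = ℚ(ζ₃)` realized as a subfield of `k`. -/
def k0S (d : ℕ) : IntermediateField ℚ (Kc d) := ℚ⟮zetaK d⟯

/-- `L = ℚ(∛d)` realized as a subfield of `k`. -/
def LS (d : ℕ) : IntermediateField ℚ (Kc d) := ℚ⟮cbrtK d⟯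

instance (d : ℕ) : NumberField ↥(k0S d) where
instance (d : ℕ) : NumberField ↥(LS d) where

/-- `ζ₃` as an element of `k₀ ⊆ k`. -/
def zetaK0 (d : ℕ) : ↥(k0S d) := ⟨zetaK d, IntermediateField.mem_adjoin_simple_self ℚ (zetaK d)⟩

/-- `∛d` as an element of `L ⊆ k`. -/
def cbrtL (d : ℕ) : ↥(LS d) := ⟨cbrtK d, IntermediateField.mem_adjoin_simple_self ℚ (cbrtK d)⟩

/-- The set of ideal classes of `k` fixed by the action of `σ` (ambiguous classes):
a class `c` is ambiguous if, whenever a nonzero ideal `I` represents `c`, the ideal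
`σ(I)` also represents `c`. -/
def ambiguousSet (d : ℕ) (σ : ↥(Kc d) ≃ₐ[ℚ] ↥(Kc d)) : Set (ClassGroup (𝓞 ↥(Kc d))) :=
  {c | ∀ I : (Ideal (𝓞 ↥(Kc d)))⁰, ClassGroup.mk0 I = c →
    ∀ J : (Ideal (𝓞 ↥(Kc d)))⁰,
      (J : Ideal (𝓞 ↥(Kc d))) = Ideal.map (RingOfIntegers.mapRingHom σ) (I : Ideal (𝓞 ↥(Kc d))) →
      ClassGroup.mk0 J = c}

/-- `C_{k,3}^{(σ)}`: the 3-group of ambiguous ideal classes of `k/k₀`, i.e. the subgroup of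
the 3-Sylow subgroup of the ideal class group of `k` consisting of the classes fixed by `σ`. -/
def ambiguousClassGroup (d : ℕ) (σ : ↥(Kc d) ≃ₐ[ℚ] ↥(Kc d)) :
    Subgroup (ClassGroup (𝓞 ↥(Kc d))) :=
  CommGroup.primaryComponent (ClassGroup (𝓞 ↥(Kc d))) 3 ⊓ Subgroup.closure (ambiguousSet d σ)

section Development

set_option maxSynthPendingDepth 3
set_option linter.unusedSectionVars false

/-- The norm form `x³ + t y³ + t² z³ - 3 t x y z` of a pure cubic extension by a cube root of `t`. -/
def cubicNorm {A : Type*} [CommRing A] (t x y z : A) : A :=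
  x ^ 3 + t * y ^ 3 + t ^ 2 * z ^ 3 - 3 * t * x * y * z

/-- The norm form of the ring of integers of the cubic field of conductor nine. -/
def nonicForm {A : Type*} [CommRing A] (a b c : A) : A :=
  a ^ 3 - b ^ 3 - c ^ 3 + 6 * b ^ 2 * c - 3 * b * c ^ 2 - 3 * a * b ^ 2 - 3 * a * c ^ 2
    + 3 * a * b * c

/-- `x` is a value of the norm form attached to `t`. -/
def IsCubicNorm {A : Type*} [CommRing A] (t x : A) : Prop :=
  ∃ a b c : A, cubicNorm t a b c = x

section CubicForms

variable {F : Type*} [Field F]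

lemma IsCubicNorm.mul {t x y : F} (hx : IsCubicNorm t x) (hy : IsCubicNorm t y) :
    IsCubicNorm t (x * y) := by
  obtain ⟨a0, a1, a2, rfl⟩ := hx
  obtain ⟨b0, b1, b2, rfl⟩ := hy
  refine ⟨a0 * b0 + t * (a1 * b2 + a2 * b1), a0 * b1 + a1 * b0 + t * a2 * b2,
    a0 * b2 + a1 * b1 + a2 * b0, ?_⟩
  simp only [cubicNorm]
  ring

lemma IsCubicNorm.cube (t x : F) : IsCubicNorm t (x ^ 3) :=
  ⟨x, 0, 0, by simp [cubicNorm]⟩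

lemma IsCubicNorm.one (t : F) : IsCubicNorm t 1 := by
  simpa using IsCubicNorm.cube t (1 : F)

lemma IsCubicNorm.pow {t x : F} (hx : IsCubicNorm t x) (n : ℕ) : IsCubicNorm t (x ^ n) := by
  induction n with
  | zero => simpa using IsCubicNorm.one t
  | succ n ih => simpa [pow_succ] using ih.mul hx

lemma IsCubicNorm.neg {t x : F} (hx : IsCubicNorm t x) : IsCubicNorm t (-x) := by
  have := hx.mul (IsCubicNorm.cube t (-1 : F))
  simpa [Odd.neg_one_pow (by decide : Odd 3)] using this

lemma IsCubicNorm.div {t x y : F} (hx : IsCubicNorm t x) (hy : IsCubicNorm t y) :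
    IsCubicNorm t (x / y) := by
  by_cases h : y = 0
  · simpa [h] using IsCubicNorm.cube t (0 : F)
  have := (hx.mul (hy.pow 2)).mul (IsCubicNorm.cube t (y⁻¹))
  convert this using 1
  field_simp

lemma isCubicNorm_nonicForm {ω : F} (hω : ω ^ 2 + ω + 1 = 0) (a b c : F) :
    IsCubicNorm ω (nonicForm a b c) := by
  refine ⟨a, b + ω ^ 2 * c, ω ^ 2 * b + c, ?_⟩
  have h3 : ω ^ 3 = 1 := by linear_combination (ω - 1) * hω
  simp only [cubicNorm, nonicForm]
  linear_combination (-3 * a * b * c) * (hω + ω ^ 2 * h3) - (3 * a * b ^ 2 + 3 * a * c ^ 2) * h3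
    + b ^ 3 * (hω + ω ^ 2 * (ω ^ 3 + 1) * h3) + c ^ 3 * (hω + ω * (ω ^ 3 + 1) * h3)
    + b ^ 2 * c * (3 * h3 + 3 * (ω ^ 3 + 1) * h3) + b * c ^ 2 * (3 * (ω + ω ^ 2) * h3 + 3 * hω)

/-- Symmetry of norm forms: if a non-cube `d` is a norm from `F(∛t)` with `t` then `t` is a norm
from `F(∛d)`. -/
lemma IsCubicNorm.symm {ω d : F} (hω : ω ^ 2 + ω + 1 = 0) (hd : ∀ x : F, x ^ 3 ≠ d)
    (h : IsCubicNorm ω d) : IsCubicNorm d ω := by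
  obtain ⟨a0, a1, a2, h⟩ := h
  have h3 : ω ^ 3 = 1 := by linear_combination (ω - 1) * hω
  simp only [cubicNorm] at h
  have hω0 : ω ≠ 0 := by rintro rfl; simp at h3
  set b0 := a0 ^ 2 - ω * a1 * a2 with hb0
  set b1 := -ω ^ 2 * a0 * a1 + a2 ^ 2 with hb1
  set b2 := -ω * a0 * a2 + ω * a1 ^ 2 with hb2
  set Δ := a1 * b2 - a2 * b1 with hΔ
  have hΔ' : Δ = ω * a1 ^ 3 - a2 ^ 3 + (ω ^ 2 - ω) * a0 * a1 * a2 := by rw [hΔ, hb2, hb1]; ring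
  by_cases h0 : Δ = 0
  · exfalso
    by_cases ha1 : a1 = 0
    · have : a2 = 0 := by
        rw [hΔ', ha1] at h0
        simpa using h0
      exact hd a0 (by rw [← h, ha1, this]; ring)
    · refine hd (-b1 / a1) ?_
      rw [div_pow, div_eq_iff (pow_ne_zero _ ha1), ← h]
      rw [hΔ'] at h0
      rw [hb1]
      linear_combination (-(- a2 ^ 3 + 2 * ω ^ 2 * a0 * a1 * a2 + ω * a0 * a1 * a2 - ω ^ 2 * a1 ^ 3 - ω * a1 ^ 3)) * h0
        + (ω ^ 4 * a0 ^ 3 * a1 ^ 3 - ω ^ 3 * a0 ^ 3 * a1 ^ 3 - ω ^ 2 * a0 ^ 2 * a1 ^ 2 * a2 ^ 2 - ω ^ 2 * a0 * a1 ^ 4 * a2 + 3 * ω * a0 * a1 ^ 4 * a2 - ω * a1 ^ 6 + ω * a0 ^ 3 * a1 ^ 3 - a0 ^ 3 * a1 ^ 3) * hω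
  · refine ⟨(-b2 * a0 + a2 * b0) / Δ, b2 / Δ, -a2 / Δ, ?_⟩
    simp only [cubicNorm]
    have key : (-b2 * a0 + a2 * b0) ^ 3 + d * b2 ^ 3 + d ^ 2 * (-a2) ^ 3
      - 3 * d * (-b2 * a0 + a2 * b0) * b2 * (-a2) = ω * Δ ^ 3 := by
      rw [hΔ', hb2, hb0, ← h]
      clear h hb0 hb1 hb2 hΔ hΔ'
      linear_combination (- ω ^ 5 * a0 ^ 3 * a1 ^ 3 * a2 ^ 3 - 3 * ω ^ 4 * a0 ^ 2 * a1 ^ 5 * a2 ^ 2 + 4 * ω ^ 4 * a0 ^ 3 * a1 ^ 3 * a2 ^ 3 - ω ^ 3 * a0 ^ 3 * a2 ^ 6 + 6 * ω ^ 3 * a0 ^ 2 * a1 ^ 2 * a2 ^ 5 - 3 * ω ^ 3 * a0 * a1 ^ 4 * a2 ^ 4 + ω ^ 3 * a1 ^ 6 * a2 ^ 3 - 3 * ω ^ 3 * a0 * a1 ^ 7 * a2 + 9 * ω ^ 3 * a0 ^ 2 * a1 ^ 5 * a2 ^ 2 - 6 * ω ^ 3 * a0 ^ 3 * a1 ^ 3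 * a2 ^ 3 - 7 * ω ^ 2 * a0 ^ 3 * a1 ^ 3 * a2 ^ 3 + 3 * ω ^ 2 * a0 ^ 2 * a1 ^ 5 * a2 ^ 2 + 3 * ω ^ 2 * a0 ^ 4 * a1 * a2 ^ 4 - ω ^ 2 * a2 ^ 9 - 2 * ω ^ 2 * a0 ^ 3 * a2 ^ 6 + 6 * ω ^ 2 * a0 * a1 ^ 4 * a2 ^ 4 + 3 * ω ^ 2 * a0 * a1 * a2 ^ 7 - 3 * ω ^ 2 * a1 ^ 3 * a2 ^ 6 - 6 * ω ^ 2 * a0 ^ 2 * a1 ^ 2 * a2 ^ 5 - ω ^ 2 * a1 ^ 6 * a2 ^ 3 + 3 * ω * a0 ^ 4 * a1 * a2 ^ 4 - 2 * ω * a0 ^ 3 * a1 ^ 3 * a2 ^ 3 + ω * a2 ^ 9) * hω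
    field_simp
    linear_combination key

end CubicForms

section PrimesModNine

lemma exists_root_nonic {p : ℕ} [Fact p.Prime] (hp : p % 9 = 1 ∨ p % 9 = 8) :
    ∃ r : ZMod p, r ^ 3 - 3 * r + 1 = 0 := by
  have hpp : p.Prime := Fact.out
  let E := GaloisField p 2
  have : Fintype E := Fintype.ofFinite E
  have hcard : Nat.card E = p ^ 2 := GaloisField.card p 2 (by norm_num)
  obtain ⟨g, hg⟩ := IsCyclic.exists_ofOrder_eq_natCard (α := Eˣ)
  have hcu : Nat.card Eˣ = p ^ 2 - 1 := by rw [Nat.card_units, hcard]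
  have h9 : 9 ∣ p ^ 2 - 1 := by
    have h1 : 1 ≤ p ^ 2 := Nat.one_le_pow _ _ hpp.pos
    rw [← Nat.modEq_iff_dvd' h1]
    rcases hp with h | h <;> simp [Nat.ModEq, Nat.pow_mod, h]
  obtain ⟨n, hn⟩ := h9
  have hn0 : 0 < n := by
    rcases Nat.eq_zero_or_pos n with rfl | h
    · have := hpp.two_le
      have : 2 ^ 2 ≤ p ^ 2 := Nat.pow_le_pow_left this 2
      omega
    · exact h
  set z : Eˣ := g ^ n with hz
  have hz9 : z ^ 9 = 1 := by
    rw [hz, ← pow_mul, mul_comm, ← hn, ← hcu, ← hg, pow_orderOf_eq_one]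
  have hz3 : z ^ 3 ≠ 1 := by
    rw [hz, ← pow_mul]
    intro h
    have := orderOf_dvd_of_pow_eq_one h
    rw [hg, hcu, hn] at this
    have := Nat.le_of_dvd (by positivity) this
    omega
  have h6 : ((z : E) ^ 3) ^ 2 + (z : E) ^ 3 + 1 = 0 := by
    have h1 : (z : E) ^ 3 - 1 ≠ 0 := by
      intro h
      apply hz3
      ext
      push_cast
      linear_combination h
    have h2 : (z : E) ^ 9 = 1 := by
      rw [← Units.val_pow_eq_pow_val, hz9, Units.val_one]
    apply mul_left_cancel₀ h1
    linear_combination h2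
  set r : E := z + (z⁻¹ : Eˣ) with hr
  have hzi : (z : E) * ((z⁻¹ : Eˣ) : E) = 1 := by simp
  have hr3 : r ^ 3 - 3 * r + 1 = 0 := by
    have : (z : E) ^ 3 ≠ 0 := pow_ne_zero _ z.ne_zero
    apply mul_left_cancel₀ this
    set y := ((z⁻¹ : Eˣ) : E)
    rw [hr]
    have hy3 : (z : E) ^ 3 * y ^ 3 = 1 := by rw [← mul_pow, hzi, one_pow]
    linear_combination h6 + hy3 + 3 * (z : E) ^ 3 * (z + y) * hzi
  have hrp : r ^ p = r := by
    rw [hr, add_pow_char]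
    have hmod : ∀ m : ℕ, (z ^ m : Eˣ) = z ^ (m % 9) := fun m => by
      conv_lhs => rw [← Nat.div_add_mod m 9, pow_add, pow_mul, hz9, one_pow, one_mul]
    rcases hp with h | h
    · have e1 : z ^ p = z := by rw [hmod, h, pow_one]
      have e2 : z⁻¹ ^ p = z⁻¹ := by rw [inv_pow, e1]
      rw [← Units.val_pow_eq_pow_val, ← Units.val_pow_eq_pow_val, e1, e2]
    · have e1 : z ^ p = z⁻¹ := by
        rw [hmod, h, eq_inv_iff_mul_eq_one, ← pow_succ, hz9]
      have e2 : z⁻¹ ^ p = z := by rw [inv_pow, e1, inv_inv]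
      rw [← Units.val_pow_eq_pow_val, ← Units.val_pow_eq_pow_val, e1, e2, add_comm]
  have hmem : r ∈ (⊥ : Subfield E) := (Subfield.mem_bot_iff_pow_eq_self E p).2 hrp
  have hbot : (⊥ : Subfield E) ≤ (algebraMap (ZMod p) E).fieldRange := bot_le
  obtain ⟨s, hs⟩ := hbot hmem
  refine ⟨s, (algebraMap (ZMod p) E).injective ?_⟩
  rw [← hs] at hr3
  simp only [map_add, map_sub, map_mul, map_pow, map_one, map_zero, map_ofNat]
  exact hr3

lemma nonicForm_eq_mul {A : Type*} [CommRing A] {r : A} (hr : r ^ 3 - 3 * r + 1 = 0) (a b c : A) :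
    ∃ y, nonicForm a b c = (a + b * r + c * (r ^ 2 - 2)) * y := by
  refine ⟨(a + b * (r ^ 2 - 2) + c * (-r - (r ^ 2 - 2))) *
    (a + b * (-r - (r ^ 2 - 2)) + c * r), ?_⟩
  simp only [nonicForm]
  linear_combination (r ^ 3 * b ^ 2 * c - r ^ 3 * b * c ^ 2 + r ^ 2 * b ^ 3 - 3 * r ^ 2 * b * c ^ 2 + r ^ 2 * c ^ 3 + r * a * b ^ 2 - r * a * b * c + r * b ^ 3 - 6 * r * b ^ 2 * c + 3 * r * b * c ^ 2 + r * c ^ 3 + r * a * c ^ 2 + a * b ^ 2 - a * b * c + a * c ^ 2 - b ^ 3 - 2 * b ^ 2 * c + 5 * b * c ^ 2 - c ^ 3) * hr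

/-- Thue's lemma for the ideal of the cubic field of conductor nine given by a root. -/
lemma exists_nonicForm_multiple {p : ℕ} [Fact p.Prime] (hp : p % 9 = 1 ∨ p % 9 = 8) :
    ∃ a b c k : ℤ, nonicForm a b c = p * k ∧ (a, b, c) ≠ (0, 0, 0) ∧ |k| ≤ 21 := by
  obtain ⟨r, hr⟩ := exists_root_nonic hp
  have hpp : p.Prime := Fact.out
  obtain ⟨m, hm1, hm2⟩ : ∃ m : ℕ, m ^ 3 ≤ p ∧ p < (m + 1) ^ 3 := by
    refine ⟨Nat.findGreatest (fun m => m ^ 3 ≤ p) p, ?_, ?_⟩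
    · exact Nat.findGreatest_spec (P := fun m => m ^ 3 ≤ p) (Nat.zero_le p) (by simp)
    · by_contra! h
      have hle : Nat.findGreatest (fun m => m ^ 3 ≤ p) p + 1 ≤ p :=
        le_trans (Nat.le_self_pow (by norm_num) _) h
      exact Nat.findGreatest_is_greatest (P := fun m => m ^ 3 ≤ p) (Nat.lt_succ_self _) hle h
  let φ : Fin (m + 1) × Fin (m + 1) × Fin (m + 1) → ZMod p := fun x =>
    (x.1 : ℕ) + (x.2.1 : ℕ) * r + (x.2.2 : ℕ) * (r ^ 2 - 2)
  obtain ⟨x, y, hxy, he⟩ := Fintype.exists_ne_map_eq_of_card_lt φ (by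
    simp only [Fintype.card_prod, Fintype.card_fin, ZMod.card]
    calc p < (m + 1) ^ 3 := hm2
      _ = _ := by ring)
  set a : ℤ := (x.1 : ℕ) - (y.1 : ℕ) with ha
  set b : ℤ := (x.2.1 : ℕ) - (y.2.1 : ℕ) with hb
  set c : ℤ := (x.2.2 : ℕ) - (y.2.2 : ℕ) with hc
  have ha' : |a| ≤ m := by rw [abs_le]; omega
  have hb' : |b| ≤ m := by rw [abs_le]; omega
  have hc' : |c| ≤ m := by rw [abs_le]; omega
  have hdvd : (p : ℤ) ∣ nonicForm a b c := by
    rw [← ZMod.intCast_zmod_eq_zero_iff_dvd]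
    obtain ⟨w, hw⟩ := nonicForm_eq_mul hr (a : ZMod p) b c
    have : ((nonicForm a b c : ℤ) : ZMod p) = nonicForm (a : ZMod p) b c := by
      simp [nonicForm]
    rw [this, hw]
    have h0 : (a : ZMod p) + b * r + c * (r ^ 2 - 2) = 0 := by
      simp only [φ] at he
      rw [ha, hb, hc]
      push_cast
      linear_combination he
    rw [h0, zero_mul]
  obtain ⟨k, hk⟩ := hdvd
  refine ⟨a, b, c, k, hk, ?_, ?_⟩
  · intro h
    apply hxy
    simp only [Prod.mk.injEq] at h
    ext <;> omega
  · have hbound : |nonicForm a b c| ≤ 21 * (m : ℤ) ^ 3 := by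
      have key : ∀ u v w : ℤ, |u| ≤ m → |v| ≤ m → |w| ≤ m → |u * v * w| ≤ (m : ℤ) ^ 3 := by
        intro u v w hu hv hw
        rw [abs_mul, abs_mul]
        calc |u| * |v| * |w| ≤ m * m * m := by gcongr
          _ = (m : ℤ) ^ 3 := by ring
      have h1 := abs_le.1 (key a a a ha' ha' ha')
      have h2 := abs_le.1 (key b b b hb' hb' hb')
      have h3 := abs_le.1 (key c c c hc' hc' hc')
      have h4 := abs_le.1 (key b b c hb' hb' hc')
      have h5 := abs_le.1 (key b c c hb' hc' hc')
      have h6 := abs_le.1 (key a b b ha' hb' hb')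
      have h7 := abs_le.1 (key a c c ha' hc' hc')
      have h8 := abs_le.1 (key a b c ha' hb' hc')
      have : nonicForm a b c = a * a * a - b * b * b - c * c * c + 6 * (b * b * c)
        - 3 * (b * c * c) - 3 * (a * b * b) - 3 * (a * c * c) + 3 * (a * b * c) := by
        simp only [nonicForm]; ring
      rw [this, abs_le]
      constructor <;> linarith
    have hm1' : (m : ℤ) ^ 3 ≤ p := by exact_mod_cast hm1
    have hp0 : (0 : ℤ) < p := by exact_mod_cast hpp.pos
    rw [hk, abs_mul, abs_of_pos hp0] at hbound
    by_contra! h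
    nlinarith

lemma nonicForm_even {a b c : ℤ} (h : 2 ∣ nonicForm a b c) : 2 ∣ a ∧ 2 ∣ b ∧ 2 ∣ c := by
  have key : ∀ x y z : ZMod 2, nonicForm x y z = 0 → x = 0 ∧ y = 0 ∧ z = 0 := by
    unfold nonicForm; decide
  have := key a b c (by
    have h' := (ZMod.intCast_zmod_eq_zero_iff_dvd _ 2).2 h
    simpa [nonicForm] using h')
  exact_mod_cast (by simpa only [ZMod.intCast_zmod_eq_zero_iff_dvd] using this :
    ((2 : ℕ) : ℤ) ∣ a ∧ ((2 : ℕ) : ℤ) ∣ b ∧ ((2 : ℕ) : ℤ) ∣ c)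

lemma nonicForm_three {a b c n : ℤ} (h : nonicForm a b c = 3 * n) :
    ∃ a' b' c' : ℤ, nonicForm a' b' c' = n ∧ ((a', b', c') = (0, 0, 0) → (a, b, c) = (0, 0, 0)) := by
  have key : ∀ x y z : ZMod 3, nonicForm x y z = 0 → x - y - z = 0 := by
    unfold nonicForm; decide
  have := key a b c (by
    have h' := (ZMod.intCast_zmod_eq_zero_iff_dvd (nonicForm a b c) 3).2 ⟨n, h⟩
    simpa [nonicForm] using h')
  obtain ⟨t, ht⟩ : (3 : ℤ) ∣ a - b - c := by
    refine (ZMod.intCast_zmod_eq_zero_iff_dvd (a - b - c) 3).1 ?_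
    push_cast
    exact this
  obtain rfl : a = b + c + 3 * t := by linarith
  refine ⟨b, b + c + 2 * t, b + t, ?_, ?_⟩
  · simp only [nonicForm] at h ⊢
    linarith
  · simp only [Prod.mk.injEq]
    omega

lemma nonicForm_mod_nine {a b c : ℤ} (h : ¬ 3 ∣ nonicForm a b c) :
    nonicForm a b c % 9 = 1 ∨ nonicForm a b c % 9 = 8 := by
  have key : ∀ x y z : ZMod 9, nonicForm x y z = 1 ∨ nonicForm x y z = 8 ∨
      3 * nonicForm x y z = 0 := by
    unfold nonicForm; decide +kernel
  have hcast : ((nonicForm a b c : ℤ) : ZMod 9) = nonicForm (a : ZMod 9) b c := by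
    simp [nonicForm]
  generalize nonicForm a b c = n at h hcast
  rcases key a b c with h1 | h1 | h1
  · rw [← hcast] at h1
    have := (ZMod.intCast_eq_intCast_iff n 1 9).1 (by simpa using h1)
    left; simpa [Int.ModEq] using this
  · rw [← hcast] at h1
    have := (ZMod.intCast_eq_intCast_iff n 8 9).1 (by simpa using h1)
    right; simpa [Int.ModEq] using this
  · rw [← hcast] at h1
    have := (ZMod.intCast_zmod_eq_zero_iff_dvd (3 * n) 9).1 (by simpa using h1)
    omega

lemma isCubicNorm_intCast_nonicForm {F : Type*} [Field F] {ω : F}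
    (hω : ω ^ 2 + ω + 1 = 0) (a b c : ℤ) : IsCubicNorm ω ((nonicForm a b c : ℤ) : F) := by
  have := isCubicNorm_nonicForm hω (a : F) b c
  simpa [nonicForm] using this

lemma isCubicNorm_of_nonicForm_eq {F : Type*} [Field F] [CharZero F] {ω : F}
    (hω : ω ^ 2 + ω + 1 = 0) {p : ℕ} (hp : p % 9 = 1 ∨ p % 9 = 8) (hodd : p % 2 = 1)
    (n : ℕ) : ∀ a b c k : ℤ, k.natAbs = n → n ≤ 21 → k ≠ 0 → nonicForm a b c = p * k →
      IsCubicNorm ω (p : F) := by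
  induction n using Nat.strong_induction_on with
  | _ n ih =>
  intro a b c k hkn hn hk0 hf
  by_cases h2 : 2 ∣ k
  · obtain ⟨⟨a', rfl⟩, ⟨b', rfl⟩, ⟨c', rfl⟩⟩ := nonicForm_even (hf ▸ h2.mul_left _)
    have h8 : nonicForm (2 * a') (2 * b') (2 * c') = 8 * nonicForm a' b' c' := by
      simp only [nonicForm]; ring
    rw [h8] at hf
    have hco : IsCoprime (8 : ℤ) p := by
      rw [Int.isCoprime_iff_gcd_eq_one]
      have : Nat.Coprime (2 ^ 3) p := Nat.Coprime.pow_left 3 (by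
        exact Nat.coprime_two_left.2 (Nat.odd_iff.2 hodd))
      exact_mod_cast this
    obtain ⟨k', rfl⟩ := hco.dvd_of_dvd_mul_left (Dvd.intro _ hf)
    refine ih k'.natAbs (by omega) a' b' c' k' rfl (by omega) (by omega) ?_
    linarith
  by_cases h3 : 3 ∣ k
  · obtain ⟨k', rfl⟩ := h3
    obtain ⟨a', b', c', h, -⟩ := nonicForm_three (n := p * k') (by rw [hf]; ring)
    exact ih k'.natAbs (by omega) a' b' c' k' rfl (by omega) (by omega) h
  have hp3 : ¬ (3 : ℤ) ∣ p := by omega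
  have h9 := nonicForm_mod_nine (a := a) (b := b) (c := c) (by
    rw [hf]
    intro h
    rcases Int.prime_three.dvd_or_dvd h with h | h
    · exact hp3 h
    · exact h3 h)
  have hk9 : k % 9 = 1 ∨ k % 9 = 8 := by
    rw [hf, Int.mul_emod] at h9
    have hk' : 0 ≤ k % 9 ∧ k % 9 < 9 := by omega
    have hp' : (p : ℤ) % 9 = 1 ∨ (p : ℤ) % 9 = 8 := by omega
    rcases hp' with h | h <;> rw [h] at h9 <;> omega
  have hcases : k = 1 ∨ k = -1 ∨ k = 17 ∨ k = -17 ∨ k = 19 ∨ k = -19 := by omega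
  have hkn : IsCubicNorm ω ((k : ℤ) : F) := by
    rcases hcases with rfl | rfl | rfl | rfl | rfl | rfl
    · simpa using IsCubicNorm.one ω
    · simpa using (IsCubicNorm.one ω).neg
    · exact isCubicNorm_intCast_nonicForm hω 0 (-2) (-3)
    · exact isCubicNorm_intCast_nonicForm hω 0 (-3) (-1)
    · exact isCubicNorm_intCast_nonicForm hω 0 (-3) (-4)
    · exact isCubicNorm_intCast_nonicForm hω 0 (-4) (-1)
  have hfn := isCubicNorm_intCast_nonicForm hω a b c
  rw [hf] at hfn
  have hk0' : (k : F) ≠ 0 := by exact_mod_cast hk0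
  convert hfn.div hkn using 1
  push_cast
  field_simp

/-- A nonzero vector cannot be a zero of the norm form of the nonic cubic field. -/
lemma nonicForm_ne_zero (n : ℕ) : ∀ a b c : ℤ, a.natAbs + b.natAbs + c.natAbs = n →
    nonicForm a b c = 0 → (a, b, c) = (0, 0, 0) := by
  induction n using Nat.strong_induction_on with
  | _ n ih =>
  intro a b c hn hf
  obtain ⟨⟨a', rfl⟩, ⟨b', rfl⟩, ⟨c', rfl⟩⟩ := nonicForm_even (hf ▸ dvd_zero 2)
  have h8 : nonicForm (2 * a') (2 * b') (2 * c') = 8 * nonicForm a' b' c' := by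
    simp only [nonicForm]; ring
  by_cases h0 : n = 0
  · simp only [Prod.mk.injEq]; omega
  have := ih (a'.natAbs + b'.natAbs + c'.natAbs) (by omega) a' b' c' rfl (by omega)
  simp only [Prod.mk.injEq] at this ⊢
  omega

/-- A prime that is `±1` modulo `9` is a norm from `F(∛ω)`. -/
lemma isCubicNorm_prime {F : Type*} [Field F] [CharZero F] {ω : F}
    (hω : ω ^ 2 + ω + 1 = 0) {p : ℕ} (hpp : p.Prime) (hp : p % 9 = 1 ∨ p % 9 = 8) :
    IsCubicNorm ω (p : F) := by
  have := Fact.mk hpp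
  obtain ⟨a, b, c, k, hf, h0, hk⟩ := exists_nonicForm_multiple hp
  have hodd : p % 2 = 1 := by
    rcases hpp.eq_two_or_odd with rfl | h
    · omega
    · exact h
  refine isCubicNorm_of_nonicForm_eq hω hp hodd _ a b c k rfl (by rw [abs_le] at hk; omega) ?_ hf
  rintro rfl
  exact h0 (nonicForm_ne_zero _ a b c rfl (by simpa using hf))

lemma isCubicNorm_three {F : Type*} [Field F] {ω : F} (hω : ω ^ 2 + ω + 1 = 0) :
    IsCubicNorm ω (3 : F) := by
  have := isCubicNorm_intCast_nonicForm hω (-1) 1 1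
  norm_num [nonicForm] at this
  exact this

/-- If all primes other than `3` dividing `d` are `±1` modulo `9`, then `ω` is a norm
from `F(∛d)`. -/
lemma isCubicNorm_of_primes {F : Type*} [Field F] [CharZero F] {ω : F}
    (hω : ω ^ 2 + ω + 1 = 0) {d : ℕ} (hd0 : d ≠ 0) (hd : ∀ x : F, x ^ 3 ≠ d)
    (h : ∀ p : ℕ, p.Prime → p ∣ d → p = 3 ∨ p % 9 = 1 ∨ p % 9 = 8) :
    IsCubicNorm (d : F) ω := by
  refine IsCubicNorm.symm hω hd ?_
  clear hd
  induction d using Nat.recOnMul with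
  | zero => exact absurd rfl hd0
  | one => simpa using IsCubicNorm.one ω
  | prime p hp =>
    rcases h p hp dvd_rfl with rfl | h | h
    · simpa using isCubicNorm_three hω
    · exact isCubicNorm_prime hω hp (Or.inl h)
    · exact isCubicNorm_prime hω hp (Or.inr h)
  | mul a b iha ihb =>
    push_cast
    exact (iha (left_ne_zero_of_mul hd0) fun p hp hpa => h p hp (hpa.mul_right b)).mul
      (ihb (right_ne_zero_of_mul hd0) fun p hp hpb => h p hp (hpb.mul_left a))

end PrimesModNine

section Descent

lemma IsCubicNorm.scale {F : Type*} [Field F] {t p x : F}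
    (h : IsCubicNorm (p ^ 3 * t) x) : IsCubicNorm t x := by
  obtain ⟨a, b, c, h⟩ := h
  refine ⟨a, p * b, p ^ 2 * c, ?_⟩
  rw [← h]
  simp only [cubicNorm]
  ring

lemma IsCubicNorm.sq {F : Type*} [Field F] {t x : F} (_ht : t ≠ 0)
    (h : IsCubicNorm t x) : IsCubicNorm (t ^ 2) x := by
  obtain ⟨a, b, c, h⟩ := h
  refine ⟨a, c, b / t, ?_⟩
  rw [← h]
  simp only [cubicNorm]
  field_simp
  ring

/-- Descent: a solution of `w³ u = N(x, y, z)` may be divided by a prime `ϖ` exactly dividing `e`. -/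
lemma cubicNorm_descent {R : Type*} [CommRing R] [IsDomain R] {ϖ e u : R} (hϖ : Prime ϖ)
    (h1 : ϖ ∣ e) (h2 : ¬ ϖ ^ 2 ∣ e) (n : ℕ) : ∀ w x y z : R, ¬ ϖ ∣ w →
      cubicNorm e x y z = (ϖ ^ n * w) ^ 3 * u → ∃ a b : R, ¬ ϖ ∣ b ∧ ϖ ∣ a ^ 3 - b ^ 3 * u := by
  obtain ⟨e', rfl⟩ := h1
  have he' : ¬ ϖ ∣ e' := fun ⟨s, hs⟩ => h2 ⟨s, by rw [hs]; ring⟩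
  have hϖ0 := hϖ.ne_zero
  induction n with
  | zero =>
    intro w x y z hw h
    refine ⟨x, w, hw, ?_⟩
    simp only [cubicNorm, pow_zero, one_mul] at h
    exact ⟨-(e' * y ^ 3 + ϖ * e' ^ 2 * z ^ 3 - 3 * e' * x * y * z), by rw [← h]; ring⟩
  | succ n ih =>
    intro w x y z hw h
    simp only [cubicNorm] at h
    obtain ⟨x, rfl⟩ : ϖ ∣ x := hϖ.dvd_of_dvd_pow (n := 3)
      ⟨ϖ ^ 2 * (ϖ ^ n * w) ^ 3 * u - e' * y ^ 3 - ϖ * e' ^ 2 * z ^ 3 + 3 * e' * x * y * z, by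
        linear_combination h⟩
    obtain ⟨y, rfl⟩ : ϖ ∣ y := by
      have : ϖ ∣ e' * y ^ 3 := ⟨ϖ * (ϖ ^ n * w) ^ 3 * u - ϖ * x ^ 3 - e' ^ 2 * z ^ 3
        + 3 * e' * x * y * z, by
          apply mul_left_cancel₀ hϖ0
          linear_combination h⟩
      exact hϖ.dvd_of_dvd_pow ((hϖ.dvd_or_dvd this).resolve_left he')
    obtain ⟨z, rfl⟩ : ϖ ∣ z := by
      have : ϖ ∣ e' ^ 2 * z ^ 3 := ⟨(ϖ ^ n * w) ^ 3 * u - x ^ 3 - ϖ * e' * y ^ 3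
        + 3 * e' * x * y * z, by
          apply mul_left_cancel₀ (pow_ne_zero 2 hϖ0)
          linear_combination h⟩
      exact hϖ.dvd_of_dvd_pow ((hϖ.dvd_or_dvd this).resolve_left
        fun h => he' (hϖ.dvd_of_dvd_pow h))
    refine ih w x y z hw ?_
    simp only [cubicNorm]
    apply mul_left_cancel₀ (pow_ne_zero 3 hϖ0)
    linear_combination h

variable {F : Type*} [Field F] [NumberField F] [IsCyclotomicExtension {3} ℚ F]

omit [NumberField F] [IsCyclotomicExtension {3} ℚ F] in
lemma eta_rel {ω : F} (hω : IsPrimitiveRoot ω 3) : hω.toInteger ^ 2 + hω.toInteger + 1 = 0 :=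
  IsCyclotomicExtension.Rat.Three.eta_sq_add_eta_add_one hω

lemma adjoin_eta {ω : F} (hω : IsPrimitiveRoot ω 3) :
    Algebra.adjoin ℤ {hω.toInteger} = ⊤ := by
  rw [← hω.integralPowerBasis.adjoin_gen_eq_top, hω.integralPowerBasis_gen]

/-- Frobenius in quotients of `ℤ[ω]`. -/
lemma dvd_pow_sq_sub_self {ω : F} (hω : IsPrimitiveRoot ω 3) {p : ℕ} (hp : p.Prime) (hp3 : p ≠ 3)
    (x : 𝓞 F) : (p : 𝓞 F) ∣ x ^ (p ^ 2) - x := by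
  have := Fact.mk hp
  set η := hω.toInteger
  let Q := 𝓞 F ⧸ Ideal.span {(p : 𝓞 F)}
  have hpQ : (p : Q) = 0 := by
    have : Ideal.Quotient.mk (Ideal.span {(p : 𝓞 F)}) (p : 𝓞 F) = 0 :=
      Ideal.Quotient.eq_zero_iff_mem.2 (Ideal.mem_span_singleton_self _)
    simpa using this
  have hadd : ∀ a b : Q, (a + b) ^ (p ^ 2) = a ^ (p ^ 2) + b ^ (p ^ 2) := by
    have h1 : ∀ a b : Q, (a + b) ^ p = a ^ p + b ^ p := by
      intro a b
      obtain ⟨r, hr⟩ := exists_add_pow_prime_eq hp a b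
      rw [hr, hpQ]; ring
    intro a b
    rw [pow_two, pow_mul, h1, h1, ← pow_mul, ← pow_mul]
  have h3 : η ^ 3 = 1 := hω.toInteger_cube_eq_one
  have hη : η ^ (p ^ 2) = η := by
    have : p ^ 2 % 3 = 1 := by
      have h0 : p % 3 ≠ 0 := fun h => hp3 ((Nat.prime_dvd_prime_iff_eq Nat.prime_three hp).1
        (Nat.dvd_of_mod_eq_zero h)).symm
      have : p % 3 = 1 ∨ p % 3 = 2 := by omega
      rcases this with h | h <;> simp [Nat.pow_mod, h]
    rw [← Nat.div_add_mod (p ^ 2) 3, this, pow_add, pow_mul, h3, one_pow, one_mul, pow_one]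
  have key : ∀ y : 𝓞 F, (Ideal.Quotient.mk (Ideal.span {(p : 𝓞 F)}) y) ^ (p ^ 2) =
      Ideal.Quotient.mk (Ideal.span {(p : 𝓞 F)}) y := by
    intro y
    have hy : y ∈ Algebra.adjoin ℤ {η} := by rw [adjoin_eta hω]; trivial
    induction hy using Algebra.adjoin_induction with
    | mem y hy =>
      rw [Set.mem_singleton_iff] at hy
      rw [hy, ← map_pow, hη]
    | algebraMap n =>
      have : (((n : ZMod p) ^ (p ^ 2) - n : ZMod p)) = 0 := by
        rw [pow_two, pow_mul, ZMod.pow_card, ZMod.pow_card, sub_self]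
      have h2 : (p : ℤ) ∣ n ^ (p ^ 2) - n := by
        rw [← ZMod.intCast_zmod_eq_zero_iff_dvd]
        simp
      rw [← map_pow, Ideal.Quotient.eq, Ideal.mem_span_singleton]
      obtain ⟨k, hk⟩ := h2
      refine ⟨(k : 𝓞 F), ?_⟩
      have := congrArg (Int.cast : ℤ → 𝓞 F) hk
      simpa using this
    | add a b _ _ ha hb => rw [map_add, hadd, ha, hb]
    | mul a b _ _ ha hb => rw [map_mul, mul_pow, ha, hb]
  rw [← Ideal.mem_span_singleton, ← Ideal.Quotient.eq, map_pow, key]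

/-- If `ω` is a norm from `F(∛e)` and the prime `p ≠ 3` exactly divides `e`, then `p ≡ ±1`
modulo `9`. -/
lemma mod_nine_of_isCubicNorm {ω : F} (hω : IsPrimitiveRoot ω 3) {p e : ℕ} (hp : p.Prime)
    (hp3 : p ≠ 3) (h1 : p ∣ e) (h2 : ¬ p ^ 2 ∣ e) (h : IsCubicNorm (e : F) ω) :
    p % 9 = 1 ∨ p % 9 = 8 := by
  set η := hω.toInteger with hη
  have hηω : (algebraMap (𝓞 F) F) η = ω := rfl
  -- a prime above `p`
  have hpu : ¬ IsUnit (p : 𝓞 F) := by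
    have : (p : 𝓞 F) = algebraMap ℤ (𝓞 F) p := by simp
    rw [this]
    intro h
    exact (Nat.prime_iff_prime_int.1 hp).not_isUnit (isUnit_of_map_unit (algebraMap ℤ (𝓞 F)) _ h)
  have hp0 : (p : 𝓞 F) ≠ 0 := by exact_mod_cast hp.ne_zero
  have := IsCyclotomicExtension.Rat.three_pid F
  obtain ⟨ϖ, hϖi, hϖp⟩ := WfDvdMonoid.exists_irreducible_factor hpu hp0
  have hϖ : Prime ϖ := hϖi.prime
  have hcop : ∀ n : ℤ, ϖ ∣ (n : 𝓞 F) → (p : ℤ) ∣ n := by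
    intro n hn
    by_contra hpn
    have : IsCoprime (p : ℤ) n := (Nat.prime_iff_prime_int.1 hp).coprime_iff_not_dvd.2 hpn
    obtain ⟨a, b, hab⟩ := this
    apply hϖ.not_isUnit
    apply isUnit_of_dvd_one
    have hab' := congrArg (Int.cast : ℤ → 𝓞 F) hab
    push_cast at hab'
    rw [← hab']
    exact dvd_add (hϖp.mul_left _) (hn.mul_left _)
  have hϖ2 : ¬ ϖ ^ 2 ∣ (e : 𝓞 F) := by
    obtain ⟨e', rfl⟩ := h1
    rintro h
    have he' : ¬ ϖ ∣ (e' : 𝓞 F) := fun hh => h2 (by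
      have := hcop e' (by exact_mod_cast hh)
      rw [pow_two]
      exact mul_dvd_mul_left p (by exact_mod_cast this))
    obtain ⟨s, hs⟩ : ϖ ^ 2 ∣ (p : 𝓞 F) := by
      obtain ⟨v, hv⟩ := hϖp
      rw [hv]
      push_cast at h
      rw [hv, mul_assoc, pow_two] at h
      rw [pow_two]
      exact mul_dvd_mul_left _ ((hϖ.dvd_or_dvd ((mul_dvd_mul_iff_left hϖ.ne_zero).1 h)).resolve_right
        he')
    have hs0 : s ≠ 0 := by rintro rfl; exact hp0 (by simpa using hs)
    have hfrob := dvd_pow_sq_sub_self hω hp hp3 (ϖ * s)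
    have hsq : (p : 𝓞 F) ∣ (ϖ * s) ^ (p ^ 2) := by
      have : 2 ≤ p ^ 2 := hp.two_le.trans (Nat.le_self_pow (by norm_num) _)
      refine dvd_trans ?_ (pow_dvd_pow _ this)
      exact ⟨s, by rw [hs]; ring⟩
    obtain ⟨v, hv⟩ := (dvd_sub_right hsq).1 hfrob
    apply hϖ.not_isUnit
    apply isUnit_of_dvd_one
    refine ⟨v, ?_⟩
    apply mul_left_cancel₀ (mul_ne_zero hϖ.ne_zero hs0)
    linear_combination hv + v * hs
  obtain ⟨a, b, hb, hab⟩ : ∃ a b : 𝓞 F, ¬ ϖ ∣ b ∧ ϖ ∣ a ^ 3 - b ^ 3 * η := by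
    obtain ⟨x, y, z, hxyz⟩ := h
    classical
    obtain ⟨w, hw⟩ := IsLocalization.exist_integer_multiples_of_finset (nonZeroDivisors (𝓞 F))
      ({x, y, z} : Finset F)
    obtain ⟨X, hX⟩ := hw x (by simp)
    obtain ⟨Y, hY⟩ := hw y (by simp)
    obtain ⟨Z, hZ⟩ := hw z (by simp)
    have hw0 : (w : 𝓞 F) ≠ 0 := nonZeroDivisors.ne_zero w.2
    obtain ⟨n, w', hw', hww⟩ := WfDvdMonoid.max_power_factor hw0 hϖi
    refine cubicNorm_descent hϖ (hϖp.trans ?_) hϖ2 n w' X Y Z hw' ?_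
    · exact_mod_cast Nat.cast_dvd_cast h1
    · rw [← hww]
      apply FaithfulSMul.algebraMap_injective (𝓞 F) F
      simp only [cubicNorm, Algebra.smul_def] at hxyz hX hY hZ ⊢
      simp only [map_sub, map_add, map_mul, map_pow, hX, hY, hZ, hηω, ← hxyz, map_natCast,
        map_ofNat]
      ring
  have h3 : η ^ 3 = 1 := hω.toInteger_cube_eq_one
  have hrel : η ^ 2 + η + 1 = 0 := eta_rel hω
  have hηu : ¬ ϖ ∣ η - 1 := by
    intro h
    have : ϖ ∣ ((3 : ℤ) : 𝓞 F) := h.trans ⟨-(η + 2), by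
      push_cast
      linear_combination hrel⟩
    have := hcop 3 this
    have := (Nat.prime_dvd_prime_iff_eq hp Nat.prime_three).1 (by exact_mod_cast this)
    exact hp3 this
  have ha : ¬ ϖ ∣ a := by
    intro h
    have : ϖ ∣ b ^ 3 * η := by
      have := dvd_sub (dvd_pow h three_ne_zero) hab
      simpa using this
    rcases hϖ.dvd_or_dvd this with h | h
    · exact hb (hϖ.dvd_of_dvd_pow h)
    · exact hϖ.not_isUnit (isUnit_of_dvd_one (h.trans ⟨η ^ 2, by rw [← h3]; ring⟩))
  -- compute in the residue ring
  set f := Ideal.Quotient.mk (Ideal.span {ϖ}) with hf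
  have hker : ∀ x, f x = 0 ↔ ϖ ∣ x := fun x => by
    rw [hf, Ideal.Quotient.eq_zero_iff_mem, Ideal.mem_span_singleton]
  have hprime : (Ideal.span {ϖ}).IsPrime := (Ideal.span_singleton_prime hϖ.ne_zero).2 hϖ
  have hQ : IsDomain (𝓞 F ⧸ Ideal.span {ϖ}) := Ideal.Quotient.isDomain _
  have hpow : ∀ x, ¬ ϖ ∣ x → f x ^ (p ^ 2 - 1) = 1 := by
    intro x hx
    have hx0 : f x ≠ 0 := fun h => hx ((hker x).1 h)
    apply mul_left_cancel₀ hx0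
    have := (hker _).2 (hϖp.trans (dvd_pow_sq_sub_self hω hp hp3 x))
    rw [map_sub, map_pow, sub_eq_zero] at this
    rw [← pow_succ', Nat.sub_add_cancel (Nat.one_le_pow _ _ hp.pos), this, mul_one]
  have hrel3 : f a ^ 3 = f b ^ 3 * f η := by
    have := (hker _).2 hab
    simpa [sub_eq_zero] using this
  have hpmod : p % 3 = 1 ∨ p % 3 = 2 := by
    have h0 : p % 3 ≠ 0 := fun h => hp3 ((Nat.prime_dvd_prime_iff_eq Nat.prime_three hp).1
      (Nat.dvd_of_mod_eq_zero h)).symm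
    omega
  obtain ⟨m, hm⟩ : 3 ∣ p ^ 2 - 1 := by
    rw [← Nat.modEq_iff_dvd' (Nat.one_le_pow _ _ hp.pos)]
    rcases hpmod with h | h <;> simp [Nat.ModEq, Nat.pow_mod, h]
  have hηm : f η ^ m = 1 := by
    have e1 := hpow a ha
    have e2 := hpow b hb
    rw [hm, pow_mul] at e1 e2
    rw [hrel3, mul_pow, e2, one_mul] at e1
    exact e1
  have hη1 : f η ≠ 1 := by
    intro h
    apply hηu
    rw [← hker, map_sub, h, map_one, sub_self]
  have hη3 : f η ^ 3 = 1 := by rw [← map_pow, h3, map_one]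
  have h3m : 3 ∣ m := by
    have := Fact.mk Nat.prime_three
    rw [← orderOf_eq_prime hη3 hη1]
    exact orderOf_dvd_of_pow_eq_one hηm
  obtain ⟨l, rfl⟩ := h3m
  have h9 : p ^ 2 % 9 = 1 := by
    have := Nat.one_le_pow 2 p hp.pos
    omega
  have hlt : p % 9 < 9 := Nat.mod_lt _ (by norm_num)
  rw [Nat.pow_mod] at h9
  generalize p % 9 = r at h9 hlt
  interval_cases r <;> simp_all

/-- If `ω` is a norm from `F(∛d)` with `d` cube-free, then all primes dividing `d` other than `3`
are `±1` modulo `9`. -/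
lemma primes_of_isCubicNorm {ω : F} (hω : IsPrimitiveRoot ω 3) {d : ℕ} (hd0 : d ≠ 0)
    (hcf : ∀ p : ℕ, p.Prime → ¬ (p ^ 3 ∣ d)) (h : IsCubicNorm (d : F) ω)
    {p : ℕ} (hp : p.Prime) (hpd : p ∣ d) : p = 3 ∨ p % 9 = 1 ∨ p % 9 = 8 := by
  by_cases hp3 : p = 3
  · exact Or.inl hp3
  right
  by_cases h2 : p ^ 2 ∣ d
  · obtain ⟨t, rfl⟩ := h2
    have ht : ¬ p ∣ t := by
      rintro ⟨s, rfl⟩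
      exact hcf p hp ⟨s, by ring⟩
    refine mod_nine_of_isCubicNorm hω hp hp3 (e := p * t ^ 2) (dvd_mul_right _ _) ?_ ?_
    · intro hh
      rw [pow_two, Nat.mul_dvd_mul_iff_left hp.pos] at hh
      exact ht (hp.dvd_of_dvd_pow hh)
    · have hd0' : ((p ^ 2 * t : ℕ) : F) ≠ 0 := by exact_mod_cast hd0
      apply IsCubicNorm.scale (p := (p : F))
      convert h.sq hd0' using 1
      push_cast
      ring
  · exact mod_nine_of_isCubicNorm hω hp hp3 hpd h2 h

end Descent

section GroupCalculus

open Subgroup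

lemma relIndex_map_of_ker_le {G H : Type*} [CommGroup G] [Group H] (f : G →* H)
    {A B : Subgroup G} (hB : f.ker ≤ B) :
    (A.map f).relIndex (B.map f) = (A ⊔ f.ker).relIndex B := by
  rw [Subgroup.relIndex_map_map, sup_eq_left.2 hB]

lemma relIndex_map_eq_sup_inf {G H : Type*} [CommGroup G] [Group H] (f : G →* H)
    {A B : Subgroup G} (hAB : A ≤ B) :
    (A.map f).relIndex (B.map f) = (A ⊔ f.ker ⊓ B).relIndex B := by
  rw [Subgroup.relIndex_map_map, ← sup_inf_assoc_of_le _ hAB, Subgroup.inf_relIndex_right,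
    ← Subgroup.relIndex_sup_left (B ⊔ f.ker) (A ⊔ f.ker),
    ← Subgroup.relIndex_sup_left B (A ⊔ f.ker)]
  congr 1
  exact le_antisymm (sup_le le_sup_left (sup_le le_sup_right (le_sup_right.trans le_sup_left)))
    (sup_le_sup le_rfl le_sup_left)

/-- Abstract form of the ambiguous class number formula. -/
lemma ambiguous_index_formula {M J : Type*} [CommGroup M] [CommGroup J] (pr : M →* J)
    (D N : M →* M) (DJ : J →* J) (hpr : ∀ x, pr (D x) = DJ (pr x)) (hker : D.range = N.ker)
    (hJ : ∀ a, pr (N a) = 1 ↔ ∃ I, DJ I = pr a)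
    (h9 : ((pr.ker ⊓ N.ker).map D).relIndex (pr.ker ⊓ N.ker) = 9) :
    9 * pr.range.relIndex (pr.range.comap DJ) =
      ((D.ker ⊓ pr.ker).map N).relIndex (N.range ⊓ pr.ker) *
        (D.ker.map pr).relIndex DJ.ker := by
  set E := pr.ker with hE
  set P := pr.range with hP
  set JA := P.comap DJ with hJA
  set U := E.comap N with hU
  have hNU : U.map N = N.range ⊓ E := Subgroup.map_comap_eq _ _
  have hkerJA : DJ.ker ≤ JA := fun x hx => by
    rw [hJA, Subgroup.mem_comap, hx]; exact one_mem _
  have hEU : E ≤ U := fun x hx => by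
    rw [hU, Subgroup.mem_comap]
    exact (hJ x).2 ⟨1, by rw [map_one, MonoidHom.mem_ker.1 hx]⟩
  have hPJA : P ≤ JA := by
    rintro _ ⟨x, rfl⟩
    exact ⟨D x, hpr x⟩
  have hDP : P.map DJ = (D.range).map pr := by
    rw [hP, MonoidHom.map_range, MonoidHom.map_range]
    congr 1
    ext x
    exact (hpr x).symm
  have hDJA : JA.map DJ = U.map pr := by
    ext x
    constructor
    · rintro ⟨I, ⟨a, ha⟩, rfl⟩
      exact ⟨a, (hJ a).2 ⟨I, ha.symm⟩, ha⟩
    · rintro ⟨a, ha, rfl⟩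
      obtain ⟨I, hI⟩ := (hJ a).1 ha
      exact ⟨I, ⟨a, hI.symm⟩, hI⟩
  have hkerU : N.ker ≤ U := fun x hx => by
    rw [hU, Subgroup.mem_comap, hx]; exact one_mem _
  -- the index of principal classes
  have e1 : P.relIndex JA = (P ⊓ DJ.ker).relIndex DJ.ker * (E.map N).relIndex (N.range ⊓ E) := by
    rw [← Subgroup.relIndex_mul_relIndex P (P ⊔ DJ.ker) JA le_sup_left (sup_le hPJA hkerJA)]
    congr 1
    · rw [Subgroup.inf_relIndex_right, sup_comm, Subgroup.relIndex_sup_right]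
    · rw [← relIndex_map_of_ker_le DJ hkerJA, hDP, hDJA, relIndex_map_of_ker_le pr hEU, hker,
        ← hNU, relIndex_map_of_ker_le N hkerU, sup_comm]
  set Q := E.comap D with hQ
  have hkerQ : D.ker ≤ Q := fun x hx => by
    rw [hQ, Subgroup.mem_comap, hx]; exact one_mem _
  have hEQ : E ≤ Q := fun x hx => by
    rw [hQ, Subgroup.mem_comap, hE, MonoidHom.mem_ker, hpr, MonoidHom.mem_ker.1 hx, map_one]
  have hQP : Q.map pr = P ⊓ DJ.ker := by
    have : Q = (DJ.ker).comap pr := by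
      ext x
      simp only [hQ, hE, Subgroup.mem_comap, MonoidHom.mem_ker, hpr]
    rw [this, Subgroup.map_comap_eq]
  have hQD : Q.map D = E ⊓ N.ker := by
    rw [hQ, Subgroup.map_comap_eq, hker, inf_comm]
  have hFQ : D.ker.map pr ≤ P ⊓ DJ.ker := by
    rw [← hQP]; exact Subgroup.map_mono hkerQ
  have e2 : (D.ker.map pr).relIndex DJ.ker =
      (E.map D).relIndex (E ⊓ N.ker) * (P ⊓ DJ.ker).relIndex DJ.ker := by
    rw [← Subgroup.relIndex_mul_relIndex _ _ _ hFQ inf_le_right]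
    congr 1
    rw [← hQP, relIndex_map_of_ker_le pr hEQ, ← hQD, relIndex_map_of_ker_le D hkerQ, sup_comm]
  set W := (D.ker ⊓ E).map N with hW
  have hDE : E.map D ≤ E ⊓ N.ker := by rw [← hQD]; exact Subgroup.map_mono hEQ
  have e3 : W.relIndex (E.map N) * (E.map D).relIndex (E ⊓ N.ker) = 9 := by
    rw [← h9, ← Subgroup.relIndex_mul_relIndex _ _ _ (Subgroup.map_mono inf_le_left) hDE]
    congr 1
    rw [hW, relIndex_map_eq_sup_inf N inf_le_right, relIndex_map_eq_sup_inf D inf_le_left]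
    congr 1
    rw [sup_comm, inf_comm N.ker]
  have hWE : W ≤ E.map N := Subgroup.map_mono inf_le_right
  have hNE : E.map N ≤ N.range ⊓ E := by rw [← hNU]; exact Subgroup.map_mono hEU
  rw [e1, e2, ← Subgroup.relIndex_mul_relIndex _ _ _ hWE hNE]
  rw [← e3]
  ring

end GroupCalculus

section UnitCubes

open NumberField.Units NumberField.InfinitePlace

variable {K : Type*} [Field K] [NumberField K]

lemma unit_rank_eq_two {ζ : K} (hζ : IsPrimitiveRoot ζ 3) (h6 : Module.finrank ℚ K = 6) :
    rank K = 2 := by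
  have h1 := card_add_two_mul_card_eq_rank K
  have h2 : nrRealPlaces K = 0 := hζ.nrRealPlaces_eq_zero_of_two_lt (by norm_num)
  rw [rank, card_eq_nrRealPlaces_add_nrComplexPlaces]
  omega

lemma torsion_cubes_index {ζ : K} (hζ : IsPrimitiveRoot ζ 3) :
    (powMonoidHom 3 : torsion K →* torsion K).range.index = 3 := by
  rw [IsCyclic.index_powMonoidHom_range, Nat.gcd_eq_right_iff_dvd]
  set z : (𝓞 K)ˣ := (hζ.toInteger_isPrimitiveRoot.isUnit (by norm_num)).unit with hz
  have hz3 : z ^ 3 = 1 := Units.ext hζ.toInteger_cube_eq_one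
  have hz1 : z ≠ 1 := by
    intro h
    have := congrArg Units.val h
    have h2 := congrArg (algebraMap (𝓞 K) K) this
    exact hζ.ne_one (by norm_num) h2
  have hmem : z ∈ torsion K :=
    (CommGroup.mem_torsion _).2 (isOfFinOrder_iff_pow_eq_one.2 ⟨3, by norm_num, hz3⟩)
  have := Fact.mk Nat.prime_three
  have ho : orderOf (⟨z, hmem⟩ : torsion K) = 3 := by
    rw [← Subgroup.orderOf_coe]
    exact orderOf_eq_prime hz3 hz1
  rw [← ho]
  exact orderOf_dvd_natCard _

/-- Coordinates modulo three of a unit with respect to a system of fundamental units. -/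
def unitCoords (K : Type*) [Field K] [NumberField K] :
    (𝓞 K)ˣ →* Multiplicative (Fin (rank K) → ZMod 3) where
  toFun u := Multiplicative.ofAdd fun i =>
    (((basisModTorsion K).repr (Additive.ofMul (QuotientGroup.mk u)) i : ℤ) : ZMod 3)
  map_one' := by
    simp
    rfl
  map_mul' u v := by
    rw [← ofAdd_add]
    congr 1
    ext i
    simp

lemma unitCoords_surjective : Function.Surjective (unitCoords K) := by
  intro f
  choose g hg using fun i => ZMod.intCast_surjective (n := 3) (Multiplicative.toAdd f i)
  obtain ⟨u, hu⟩ := QuotientGroup.mk_surjective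
    (Additive.toMul ((basisModTorsion K).equivFun.symm g))
  refine ⟨u, ?_⟩
  apply Multiplicative.toAdd.injective
  ext i
  simp only [unitCoords, MonoidHom.coe_mk, OneHom.coe_mk, toAdd_ofAdd]
  rw [hu, ofMul_toMul, ← hg i]
  congr 1
  rw [← Module.Basis.equivFun_apply, LinearEquiv.apply_symm_apply]

lemma ker_unitCoords :
    (unitCoords K).ker = (powMonoidHom 3 : (𝓞 K)ˣ →* _).range ⊔ torsion K := by
  apply le_antisymm
  · intro u hu
    have h : ∀ i, ∃ n : ℤ, (basisModTorsion K).repr (Additive.ofMul (QuotientGroup.mk u)) i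
        = 3 * n := by
      intro i
      have := congrFun (congrArg Multiplicative.toAdd (MonoidHom.mem_ker.1 hu)) i
      exact (ZMod.intCast_zmod_eq_zero_iff_dvd _ 3).1 this
    choose n hn using h
    obtain ⟨v, hv⟩ := QuotientGroup.mk_surjective
      (Additive.toMul ((basisModTorsion K).equivFun.symm n))
    have : (QuotientGroup.mk (v ^ 3) : (𝓞 K)ˣ ⧸ torsion K) = QuotientGroup.mk u := by
      apply Additive.ofMul.injective
      apply (basisModTorsion K).repr.injective
      ext i
      rw [hn i, QuotientGroup.mk_pow, ofMul_pow, hv, ofMul_toMul, map_nsmul,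
        Finsupp.smul_apply, ← Module.Basis.equivFun_apply, LinearEquiv.apply_symm_apply]
      simp
    rw [QuotientGroup.eq] at this
    rw [show u = v ^ 3 * ((v ^ 3)⁻¹ * u) by group]
    exact Subgroup.mul_mem_sup ⟨v, rfl⟩ this
  · rw [sup_le_iff]
    constructor
    · rintro _ ⟨v, rfl⟩
      rw [MonoidHom.mem_ker, powMonoidHom_apply, map_pow]
      apply Multiplicative.toAdd.injective
      ext i
      simp only [toAdd_pow, Pi.smul_apply, nsmul_eq_mul, toAdd_one, Pi.zero_apply]
      rw [show ((3 : ℕ) : ZMod 3) = 0 from rfl, zero_mul]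
    · intro t ht
      rw [MonoidHom.mem_ker]
      have : (QuotientGroup.mk t : (𝓞 K)ˣ ⧸ torsion K) = 1 := (QuotientGroup.eq_one_iff t).2 ht
      apply Multiplicative.toAdd.injective
      ext i
      simp [unitCoords, this]

/-- In a number field of degree six containing `ζ₃`, the cubes of units have index `27`. -/
lemma unit_cubes_index {ζ : K} (hζ : IsPrimitiveRoot ζ 3) (h6 : Module.finrank ℚ K = 6) :
    (powMonoidHom 3 : (𝓞 K)ˣ →* (𝓞 K)ˣ).range.index = 27 := by
  set C := (powMonoidHom 3 : (𝓞 K)ˣ →* (𝓞 K)ˣ).range with hC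
  rw [← Subgroup.relIndex_mul_index (le_sup_left : C ≤ C ⊔ torsion K), ← ker_unitCoords,
    Subgroup.index_ker, MonoidHom.range_eq_top.2 unitCoords_surjective, ker_unitCoords,
    Subgroup.relIndex_sup_left]
  have h9 : Nat.card (⊤ : Subgroup (Multiplicative (Fin (rank K) → ZMod 3))) = 9 := by
    rw [Subgroup.card_top, Nat.card_congr Multiplicative.toAdd, Nat.card_fun, unit_rank_eq_two hζ h6]
    simp
  have h3 : C.relIndex (torsion K) = 3 := by
    rw [← torsion_cubes_index hζ, Subgroup.relIndex]
    congr 1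
    ext ⟨t, ht⟩
    rw [Subgroup.mem_subgroupOf]
    constructor
    · rintro ⟨v, hv⟩
      have hvt : v ∈ torsion K := by
        change v ^ 3 = t at hv
        rw [← hv] at ht
        exact (CommGroup.mem_torsion _).2 (((CommGroup.mem_torsion _).1 ht).of_pow (by norm_num))
      exact ⟨⟨v, hvt⟩, Subtype.ext hv⟩
    · rintro ⟨⟨v, hvt⟩, hv⟩
      exact ⟨v, congrArg Subtype.val hv⟩
  rw [h3, h9]

end UnitCubes

section UnitIndex

/-- If `D` has kernel of order three on `E` and `D ∘ D` has image of index `27`, then `D` has image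
of index `9`. -/
lemma relIndex_map_eq_nine {M : Type*} [CommGroup M] (D : M →* M) {E : Subgroup M}
    (hD : E.map D ≤ E) (h27 : ((E.map D).map D).relIndex E = 27)
    (hk : Nat.card (D.ker ⊓ E : Subgroup M) = 3) : (E.map D).relIndex E = 9 := by
  set R := E.map D with hR
  have h1 := Subgroup.relIndex_mul_relIndex (R.map D) R E (Subgroup.map_mono hD) hD
  have h2 : (R.map D).relIndex R = (R ⊔ D.ker ⊓ E).relIndex E := by
    rw [← relIndex_map_eq_sup_inf D hD]
  have h3 := Subgroup.relIndex_mul_relIndex R (R ⊔ D.ker ⊓ E) E le_sup_left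
    (sup_le hD inf_le_right)
  rw [Subgroup.relIndex_sup_left] at h3
  have h4 : R.relIndex (D.ker ⊓ E) ∣ 3 := by
    rw [← hk]; exact Subgroup.relIndex_dvd_card _ _
  rw [h27, h2] at h1
  rcases (Nat.dvd_prime Nat.prime_three).1 h4 with h | h
  · rw [h, one_mul] at h3
    rw [h3] at h1
    generalize R.relIndex E = n at h1
    have : n ≤ 27 := Nat.le_of_dvd (by norm_num) ⟨n, h1.symm⟩
    interval_cases n <;> omega
  · rw [h] at h3
    rw [← h3] at h1 ⊢
    generalize (R ⊔ D.ker ⊓ E).relIndex E = n at h1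
    have : n ≤ 27 := Nat.le_of_dvd (by norm_num) ⟨3 * n, h1.symm⟩
    interval_cases n <;> omega

/-- The index of cubes does not change on passing to a subgroup of finite index containing the
`3`-torsion. -/
lemma relIndex_cubes_eq {M : Type*} [CommGroup M] {A E : Subgroup M} (hAE : A ≤ E)
    (h0 : A.relIndex E ≠ 0) (h3 : (powMonoidHom 3 : M →* M).ker ⊓ E ≤ A) :
    (A.map (powMonoidHom 3)).relIndex A = (E.map (powMonoidHom 3)).relIndex E := by
  have hpow : ∀ B : Subgroup M, B.map (powMonoidHom 3) ≤ B := by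
    rintro B _ ⟨x, hx, rfl⟩
    exact pow_mem hx 3
  have h1 := Subgroup.relIndex_mul_relIndex _ _ _ (hpow A) hAE
  have h2 := Subgroup.relIndex_mul_relIndex _ _ _ (Subgroup.map_mono (f := powMonoidHom 3) hAE)
    (hpow E)
  rw [relIndex_map_eq_sup_inf _ hAE, sup_eq_left.2 h3, ← h1, mul_comm] at h2
  exact (Nat.eq_of_mul_eq_mul_right (Nat.pos_of_ne_zero h0) h2).symm

end UnitIndex

/-- A pure cubic Kummer extension `K = F(∛d)` with a chosen generator `σ` of its Galois group. -/
structure PureCubic (F K : Type*) [Field F] [Field K] [Algebra F K] where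
  /-- the chosen generator of the Galois group -/
  σ : K ≃ₐ[F] K
  /-- a primitive cube root of unity -/
  ω : F
  /-- a cube root of the radicand -/
  α : K
  /-- the radicand -/
  d : ℕ
  hω : IsPrimitiveRoot ω 3
  hα : α ^ 3 = d
  hσ : σ α = algebraMap F K ω * α
  hgen : ∀ x : K, ∃ a b c : F, x = algebraMap F K a + algebraMap F K b * α + algebraMap F K c * α ^ 2
  hd : ∀ x : F, x ^ 3 ≠ d

namespace PureCubic

section Algebra

variable {F K : Type*} [Field F] [Field K] [Algebra F K] (S : PureCubic F K)

/-- The image in `K` of the chosen cube root of unity. -/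
abbrev w : K := algebraMap F K S.ω

lemma omega_rel : S.ω ^ 2 + S.ω + 1 = 0 := by
  have h := S.hω.geom_sum_eq_zero (by norm_num)
  simp only [Finset.sum_range_succ, Finset.range_zero, Finset.sum_empty] at h
  linear_combination h

lemma w_rel : S.w ^ 2 + S.w + 1 = 0 := by
  rw [← map_pow, ← map_add, ← map_one (algebraMap F K), ← map_add, S.omega_rel, map_zero]

lemma w_cube : S.w ^ 3 = 1 := by
  linear_combination (S.w - 1) * S.w_rel

lemma sigma_w : S.σ S.w = S.w := S.σ.commutes _

lemma alpha_ne_zero : S.α ≠ 0 := by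
  intro h
  have h1 := S.hα
  rw [h] at h1
  apply S.hd 0
  apply (algebraMap F K).injective
  simpa using h1

lemma alpha_notMem (x : F) : algebraMap F K x ≠ S.α := by
  intro h
  apply S.hd x
  apply (algebraMap F K).injective
  rw [map_pow, h, S.hα, map_natCast]

lemma sigma_cube (x : K) : S.σ (S.σ (S.σ x)) = x := by
  obtain ⟨a, b, c, rfl⟩ := S.hgen x
  simp only [map_add, map_mul, map_pow, S.σ.commutes, S.hσ]
  linear_combination (algebraMap F K b * S.α + algebraMap F K c * S.α ^ 2 * (S.w ^ 3 + 1)) * S.w_cube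

lemma exists_of_sigma_eq {x : K} (h : S.σ x = x) : ∃ a : F, algebraMap F K a = x := by
  obtain ⟨a, b, c, rfl⟩ := S.hgen x
  simp only [map_add, map_mul, map_pow, S.σ.commutes, S.hσ] at h
  have hw1 : S.w - 1 ≠ 0 := by
    intro h0
    exact S.hω.ne_one (by norm_num) ((algebraMap F K).injective (by rw [map_one]; exact sub_eq_zero.1 h0))
  have h1 : algebraMap F K b + algebraMap F K c * (S.w + 1) * S.α = 0 := by
    apply mul_left_cancel₀ (mul_ne_zero hw1 S.alpha_ne_zero)
    linear_combination h
  have hc : c = 0 := by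
    by_contra hc
    have hw2 : S.ω + 1 ≠ 0 := by
      intro h0
      have := S.omega_rel
      have h3 : S.ω = -1 := by linear_combination h0
      rw [h3] at this
      norm_num at this
    apply S.alpha_notMem (-b / (c * (S.ω + 1)))
    have hc' : algebraMap F K c * (S.w + 1) ≠ 0 := by
      rw [← map_one (algebraMap F K), ← map_add, ← map_mul]
      exact (map_ne_zero _).2 (mul_ne_zero hc hw2)
    rw [map_div₀, map_mul, map_add, map_one, map_neg, div_eq_iff hc']
    linear_combination -h1
  subst hc
  have hb : algebraMap F K b = 0 := by simpa using h1
  exact ⟨a, by simp [hb]⟩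

lemma sigma_eq_iff {x : K} : S.σ x = x ↔ ∃ a : F, algebraMap F K a = x :=
  ⟨S.exists_of_sigma_eq, by rintro ⟨a, rfl⟩; exact S.σ.commutes a⟩

/-- The relative norm. -/
def norm (x : K) : K := x * S.σ x * S.σ (S.σ x)

lemma norm_eq (a b c : F) :
    S.norm (algebraMap F K a + algebraMap F K b * S.α + algebraMap F K c * S.α ^ 2) =
      algebraMap F K (cubicNorm (S.d : F) a b c) := by
  have key : ∀ A B C : K, (A + B + C) * (A + S.w * B + S.w ^ 2 * C) *
      (A + S.w ^ 2 * B + S.w ^ 4 * C) = A ^ 3 + B ^ 3 + C ^ 3 - 3 * A * B * C := by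
    intro A B C
    linear_combination (S.w ^ 4 * A * C ^ 2 + S.w ^ 4 * B * C ^ 2 + S.w ^ 4 * C ^ 3 + S.w ^ 3 * A * B * C + S.w ^ 3 * B ^ 2 * C - S.w ^ 3 * A * C ^ 2 - S.w ^ 3 * C ^ 3 + S.w ^ 2 * A ^ 2 * C + S.w ^ 2 * A * B * C + S.w ^ 2 * A * C ^ 2 + S.w * A * B ^ 2 + S.w * B ^ 3 - 2 * S.w * A * B * C + S.w * C ^ 3 - S.w * A ^ 2 * C + A ^ 2 * B + 3 * A * B * C - B ^ 3 - C ^ 3 + A ^ 2 * C) * S.w_rel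
  simp only [norm, cubicNorm, map_add, map_sub, map_mul, map_pow, S.σ.commutes, S.hσ, map_natCast,
    map_ofNat]
  rw [← S.hα]
  linear_combination key (algebraMap F K a) (algebraMap F K b * S.α) (algebraMap F K c * S.α ^ 2)

lemma exists_norm_eq_iff (x : F) :
    (∃ y, S.norm y = algebraMap F K x) ↔ IsCubicNorm (S.d : F) x := by
  constructor
  · rintro ⟨y, hy⟩
    obtain ⟨a, b, c, rfl⟩ := S.hgen y
    rw [S.norm_eq] at hy
    exact ⟨a, b, c, (algebraMap F K).injective hy⟩
  · rintro ⟨a, b, c, h⟩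
    exact ⟨_, (S.norm_eq a b c).trans (by rw [h])⟩

lemma exists_hilbert90 [CharZero F] {a : K} (ha : S.norm a = 1) : ∃ c, c ≠ 0 ∧ a * S.σ c = c := by
  have key : ∀ θ : K, a * S.σ (θ + a * S.σ θ + a * S.σ a * S.σ (S.σ θ)) =
      θ + a * S.σ θ + a * S.σ a * S.σ (S.σ θ) := by
    intro θ
    simp only [map_add, map_mul, S.sigma_cube]
    have h : a * S.σ a * S.σ (S.σ a) = 1 := ha
    linear_combination θ * h
  by_contra! hne
  have h0 : ∀ θ : K, θ + a * S.σ θ + a * S.σ a * S.σ (S.σ θ) = 0 := by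
    intro θ
    by_contra h
    exact hne _ h (key θ)
  have e0 := h0 1
  have e1 := h0 S.α
  have e2 := h0 (S.α ^ 2)
  simp only [map_one, map_pow, S.hσ, map_mul, S.sigma_w] at e0 e1 e2
  have h3 : (3 : K) * S.α ^ 2 = 0 := by
    linear_combination S.α ^ 2 * e0 + S.α * e1 + e2
      - S.α ^ 2 * (a + a * S.σ a * (S.w ^ 2 - S.w + 1)) * S.w_rel
  have : CharZero K := charZero_of_injective_algebraMap (algebraMap F K).injective
  exact mul_ne_zero (by norm_num) (pow_ne_zero 2 S.alpha_ne_zero) h3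

/-- The generator of the Galois group acting on `Kˣ`. -/
def sU : Kˣ →* Kˣ := Units.map (S.σ : K →* K)

@[simp] lemma coe_sU (x : Kˣ) : (S.sU x : K) = S.σ x := rfl

lemma sU_cube (x : Kˣ) : S.sU (S.sU (S.sU x)) = x := Units.ext (S.sigma_cube x)

/-- The relative norm on `Kˣ`. -/
def NU : Kˣ →* Kˣ := MonoidHom.id _ * S.sU * S.sU.comp S.sU

/-- `x ↦ σ x / x` on `Kˣ`. -/
def DU : Kˣ →* Kˣ := S.sU / MonoidHom.id _

lemma NU_apply (x : Kˣ) : S.NU x = x * S.sU x * S.sU (S.sU x) := rfl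

lemma coe_NU (x : Kˣ) : (S.NU x : K) = S.norm x := rfl

lemma DU_apply (x : Kˣ) : S.DU x = S.sU x / x := rfl

lemma mem_ker_DU {x : Kˣ} : x ∈ S.DU.ker ↔ ∃ a : F, algebraMap F K a = x := by
  rw [MonoidHom.mem_ker, DU_apply, div_eq_one, Units.ext_iff, coe_sU, S.sigma_eq_iff]

lemma range_DU [CharZero F] : S.DU.range = S.NU.ker := by
  ext a
  constructor
  · rintro ⟨x, rfl⟩
    rw [MonoidHom.mem_ker, DU_apply, map_div, NU_apply, NU_apply, S.sU_cube, div_eq_one]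
    rw [mul_comm, mul_assoc]
  · intro ha
    obtain ⟨c, hc, h⟩ := S.exists_hilbert90 (a := a) (by rw [← coe_NU, MonoidHom.mem_ker.1 ha]; rfl)
    refine ⟨(Units.mk0 c hc)⁻¹, ?_⟩
    rw [DU_apply, map_inv, div_eq_mul_inv, inv_inv, inv_mul_eq_iff_eq_mul]
    ext
    rw [Units.val_mul, coe_sU, Units.val_mk0, mul_comm, h]

end Algebra

end PureCubic

namespace PureCubic

section Ideals

open FractionalIdeal

variable {F K : Type*} [Field F] [Field K] [Algebra F K] (S : PureCubic F K)

/-- The action of the generator on the ring of integers. -/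
def sO : 𝓞 K ≃+* 𝓞 K := RingOfIntegers.mapRingEquiv (S.σ : K ≃+* K)

@[simp] lemma coe_sO (x : 𝓞 K) : ((S.sO x : 𝓞 K) : K) = S.σ x := rfl

lemma sO_cube (x : 𝓞 K) : S.sO (S.sO (S.sO x)) = x :=
  RingOfIntegers.ext (S.sigma_cube x)

variable [NumberField K]

/-- The action of the generator on fractional ideals. -/
def phi : FractionalIdeal (𝓞 K)⁰ K ≃+* FractionalIdeal (𝓞 K)⁰ K :=
  FractionalIdeal.ringEquivOfRingEquiv K K S.sO

lemma fracEquiv_sO (x : K) : IsFractionRing.ringEquivOfRingEquiv (K := K) (L := K) S.sO x = S.σ x := by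
  obtain ⟨a, b, hb, rfl⟩ := IsFractionRing.div_surjective (A := 𝓞 K) x
  rw [map_div₀, map_div₀, IsFractionRing.ringEquivOfRingEquiv_algebraMap,
    IsFractionRing.ringEquivOfRingEquiv_algebraMap]
  rfl

lemma mem_phi {I : FractionalIdeal (𝓞 K)⁰ K} {y : K} : y ∈ S.phi I ↔ ∃ x ∈ I, S.σ x = y := by
  rw [← FractionalIdeal.mem_coe]
  change y ∈ Submodule.map _ _ ↔ _
  rw [Submodule.mem_map]
  refine exists_congr fun x => and_congr_right fun _ => ?_
  rw [← S.fracEquiv_sO]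
  rfl

lemma phi_cube (I : FractionalIdeal (𝓞 K)⁰ K) : S.phi (S.phi (S.phi I)) = I := by
  ext y
  simp only [mem_phi]
  constructor
  · rintro ⟨_, ⟨_, ⟨x, hx, rfl⟩, rfl⟩, rfl⟩
    rwa [S.sigma_cube]
  · intro hy
    exact ⟨_, ⟨_, ⟨y, hy, rfl⟩, rfl⟩, S.sigma_cube y⟩

lemma phi_spanSingleton (x : K) :
    S.phi (spanSingleton (𝓞 K)⁰ x) = spanSingleton (𝓞 K)⁰ (S.σ x) := by
  rw [phi, ringEquivOfRingEquiv_spanSingleton, fracEquiv_sO]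

lemma phi_coeIdeal (I : Ideal (𝓞 K)) :
    S.phi (I : FractionalIdeal (𝓞 K)⁰ K) = ((I.map (S.sO : 𝓞 K →+* 𝓞 K) : Ideal (𝓞 K)) :
      FractionalIdeal (𝓞 K)⁰ K) := by
  ext y
  rw [mem_phi, mem_coeIdeal]
  constructor
  · rintro ⟨x, hx, rfl⟩
    obtain ⟨z, hz, rfl⟩ := (mem_coeIdeal _).1 hx
    exact ⟨S.sO z, Ideal.mem_map_of_mem _ hz, rfl⟩
  · rintro ⟨x, hx, rfl⟩
    obtain ⟨z, hz, rfl⟩ := (Ideal.mem_map_iff_of_surjective (S.sO : 𝓞 K →+* 𝓞 K) S.sO.surjective).1 hx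
    exact ⟨z, mem_coeIdeal_of_mem _ hz, rfl⟩

/-- The action of the generator on invertible fractional ideals. -/
def sJ : (FractionalIdeal (𝓞 K)⁰ K)ˣ →* (FractionalIdeal (𝓞 K)⁰ K)ˣ :=
  Units.map (S.phi : FractionalIdeal (𝓞 K)⁰ K →* FractionalIdeal (𝓞 K)⁰ K)

@[simp] lemma coe_sJ (I : (FractionalIdeal (𝓞 K)⁰ K)ˣ) :
    (S.sJ I : FractionalIdeal (𝓞 K)⁰ K) = S.phi I := rfl

lemma sJ_cube (I : (FractionalIdeal (𝓞 K)⁰ K)ˣ) : S.sJ (S.sJ (S.sJ I)) = I :=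
  Units.ext (S.phi_cube I)

/-- `I ↦ σ I / I` on invertible fractional ideals. -/
def DJ : (FractionalIdeal (𝓞 K)⁰ K)ˣ →* (FractionalIdeal (𝓞 K)⁰ K)ˣ := S.sJ / MonoidHom.id _

/-- The relative norm on invertible fractional ideals. -/
def NJ : (FractionalIdeal (𝓞 K)⁰ K)ˣ →* (FractionalIdeal (𝓞 K)⁰ K)ˣ :=
  MonoidHom.id _ * S.sJ * S.sJ.comp S.sJ

lemma DJ_apply (I : (FractionalIdeal (𝓞 K)⁰ K)ˣ) : S.DJ I = S.sJ I / I := rfl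

lemma NJ_apply (I : (FractionalIdeal (𝓞 K)⁰ K)ˣ) : S.NJ I = I * S.sJ I * S.sJ (S.sJ I) := rfl

lemma sJ_principal (x : Kˣ) :
    S.sJ (toPrincipalIdeal (𝓞 K) K x) = toPrincipalIdeal (𝓞 K) K (S.sU x) := by
  ext1
  rw [coe_sJ, coe_toPrincipalIdeal, coe_toPrincipalIdeal, S.phi_spanSingleton, S.coe_sU]

lemma DJ_principal (x : Kˣ) :
    toPrincipalIdeal (𝓞 K) K (S.DU x) = S.DJ (toPrincipalIdeal (𝓞 K) K x) := by
  rw [DJ_apply, DU_apply, sJ_principal, map_div]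

lemma NJ_principal (x : Kˣ) :
    toPrincipalIdeal (𝓞 K) K (S.NU x) = S.NJ (toPrincipalIdeal (𝓞 K) K x) := by
  rw [NJ_apply, NU_apply, sJ_principal, sJ_principal, map_mul, map_mul]

lemma NJ_DJ (I : (FractionalIdeal (𝓞 K)⁰ K)ˣ) : S.NJ (S.DJ I) = 1 := by
  rw [DJ_apply, map_div, NJ_apply, NJ_apply, S.sJ_cube, div_eq_one, mul_comm, mul_assoc]

lemma ideal_hilbert90 (a : Kˣ) : toPrincipalIdeal (𝓞 K) K (S.NU a) = 1 ↔
    ∃ I, S.DJ I = toPrincipalIdeal (𝓞 K) K a := by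
  constructor
  · intro h
    set A := spanSingleton (𝓞 K)⁰ (a : K) with hA
    set I : FractionalIdeal (𝓞 K)⁰ K := 1 + A + A * S.phi A with hI
    have hN : A * S.phi A * S.phi (S.phi A) = 1 := by
      have := congrArg Units.val h
      rw [NJ_principal, NJ_apply] at this
      simpa using this
    have h1 : A * S.phi I = I := by
      rw [hI, map_add, map_add, map_mul, map_one, mul_add, mul_add, ← mul_assoc, hN, mul_one]
      rw [add_comm, add_assoc]
    have hI0 : I ≠ 0 := by
      intro h0
      have : (1 : FractionalIdeal (𝓞 K)⁰ K) ≤ I := by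
        rw [hI, add_assoc, ← sup_eq_add]; exact le_sup_left
      rw [h0] at this
      exact one_ne_zero (le_antisymm this (FractionalIdeal.zero_le _))
    refine ⟨(Units.mk0 I hI0)⁻¹, ?_⟩
    rw [DJ_apply, map_inv, div_inv_eq_mul, inv_mul_eq_iff_eq_mul]
    ext1
    rw [Units.val_mul, coe_sJ, Units.val_mk0, coe_toPrincipalIdeal, mul_comm, h1]
  · rintro ⟨I, hI⟩
    rw [NJ_principal, ← hI, NJ_DJ]

end Ideals

end PureCubic

namespace PureCubic

section Units

open FractionalIdeal

lemma mem_ker_toPrincipalIdeal {K : Type*} [Field K] [NumberField K] {x : Kˣ} :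
    x ∈ (toPrincipalIdeal (𝓞 K) K).ker ↔
      ∃ u : (𝓞 K)ˣ, Units.map (algebraMap (𝓞 K) K : 𝓞 K →* K) u = x := by
  rw [MonoidHom.mem_ker]
  constructor
  · intro h
    have h1 : spanSingleton (𝓞 K)⁰ (x : K) = 1 := by simpa using congrArg Units.val h
    have h2 : spanSingleton (𝓞 K)⁰ ((x⁻¹ : Kˣ) : K) = 1 := by
      have h3 := coe_toPrincipalIdeal (R := 𝓞 K) x⁻¹
      rw [map_inv, h, inv_one, Units.val_one] at h3
      exact h3.symm
    obtain ⟨a, ha⟩ : ∃ a : 𝓞 K, algebraMap (𝓞 K) K a = x :=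
      (mem_one_iff _).1 (h1 ▸ mem_spanSingleton_self _ _)
    obtain ⟨b, hb⟩ : ∃ b : 𝓞 K, algebraMap (𝓞 K) K b = (x⁻¹ : Kˣ) :=
      (mem_one_iff _).1 (h2 ▸ mem_spanSingleton_self _ _)
    have hab : a * b = 1 := by
      apply FaithfulSMul.algebraMap_injective (𝓞 K) K
      rw [map_mul, ha, hb, map_one, Units.mul_inv]
    exact ⟨⟨a, b, hab, by rw [mul_comm, hab]⟩, Units.ext ha⟩
  · rintro ⟨u, rfl⟩
    ext1
    rw [coe_toPrincipalIdeal, Units.val_one]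
    apply le_antisymm
    · rw [spanSingleton_le_iff_mem, mem_one_iff]
      exact ⟨u, rfl⟩
    · rw [← spanSingleton_one, spanSingleton_le_iff_mem, mem_spanSingleton]
      exact ⟨((u⁻¹ : (𝓞 K)ˣ) : 𝓞 K), by
        rw [Algebra.smul_def]
        change algebraMap (𝓞 K) K _ * algebraMap (𝓞 K) K _ = 1
        rw [← map_mul, Units.inv_mul, map_one]⟩

variable {F K : Type*} [Field F] [Field K] [NumberField K] [Algebra F K] (S : PureCubic F K)

/-- The cube root of unity in `Kˣ`. -/
def wU : Kˣ := Units.mk0 S.w (by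
  intro h
  have := S.w_cube
  rw [h] at this
  norm_num at this)

@[simp] lemma coe_wU : (S.wU : K) = S.w := rfl

lemma isPrimitiveRoot_w : IsPrimitiveRoot S.w 3 := S.hω.map_of_injective (algebraMap F K).injective

lemma isPrimitiveRoot_wU : IsPrimitiveRoot S.wU 3 :=
  IsPrimitiveRoot.coe_units_iff.1 S.isPrimitiveRoot_w

lemma wU_cube : S.wU ^ 3 = 1 := S.isPrimitiveRoot_wU.pow_eq_one

lemma mem_ker_of_pow {x : Kˣ} {n : ℕ} (hn : 0 < n) (h : x ^ n = 1) :
    x ∈ (toPrincipalIdeal (𝓞 K) K).ker := by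
  rw [mem_ker_toPrincipalIdeal]
  have h1 : (x : K) ^ n = 1 := by rw [← Units.val_pow_eq_pow_val, h, Units.val_one]
  have hi : IsIntegral ℤ (x : K) := IsIntegral.of_pow hn (h1 ▸ isIntegral_one)
  set a : 𝓞 K := ⟨x, hi⟩
  have ha : a ^ n = 1 := RingOfIntegers.ext h1
  exact ⟨Units.ofPowEqOne a n ha hn.ne', Units.ext rfl⟩

lemma wU_mem_ker : S.wU ∈ (toPrincipalIdeal (𝓞 K) K).ker := mem_ker_of_pow (by norm_num) S.wU_cube

lemma DU_wU : S.wU ∈ S.DU.ker := S.mem_ker_DU.2 ⟨_, rfl⟩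

lemma NU_of_mem_ker {x : Kˣ} (hx : x ∈ S.DU.ker) : S.NU x = x ^ 3 := by
  have h : S.sU x = x := by
    rw [MonoidHom.mem_ker, DU_apply, div_eq_one] at hx
    exact hx
  rw [NU_apply, h, h, pow_succ, pow_two]

lemma NU_mem_ker_DU (x : Kˣ) : S.NU x ∈ S.DU.ker := by
  rw [MonoidHom.mem_ker, DU_apply, div_eq_one, NU_apply, map_mul, map_mul, S.sU_cube]
  rw [mul_comm, mul_assoc]

lemma sU_mem_ker {x : Kˣ} (hx : x ∈ (toPrincipalIdeal (𝓞 K) K).ker) :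
    S.sU x ∈ (toPrincipalIdeal (𝓞 K) K).ker := by
  rw [MonoidHom.mem_ker] at hx ⊢
  rw [← sJ_principal, hx, map_one]

lemma NU_mem_ker {x : Kˣ} (hx : x ∈ (toPrincipalIdeal (𝓞 K) K).ker) :
    S.NU x ∈ (toPrincipalIdeal (𝓞 K) K).ker :=
  mul_mem (mul_mem hx (S.sU_mem_ker hx)) (S.sU_mem_ker (S.sU_mem_ker hx))

lemma finrank_eq_three (S : PureCubic F K) : Module.finrank F K = 3 := by
  have hirr : Irreducible (Polynomial.X ^ 3 - Polynomial.C (S.d : F)) :=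
    X_pow_sub_C_irreducible_of_prime Nat.prime_three S.hd
  have hα : IsIntegral F S.α :=
    ⟨_, Polynomial.monic_X_pow_sub_C (S.d : F) three_ne_zero, by simp [S.hα]⟩
  have hmin : minpoly F S.α = Polynomial.X ^ 3 - Polynomial.C (S.d : F) :=
    (minpoly.eq_of_irreducible_of_monic hirr (by simp [S.hα])
      (Polynomial.monic_X_pow_sub_C (S.d : F) (by norm_num))).symm
  have htop : F⟮S.α⟯ = ⊤ := by
    rw [eq_top_iff]
    intro x _
    obtain ⟨a, b, c, rfl⟩ := S.hgen x
    have := IntermediateField.mem_adjoin_simple_self F S.α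
    exact add_mem (add_mem (IntermediateField.algebraMap_mem _ a) (mul_mem (IntermediateField.algebraMap_mem _ b) this))
      (mul_mem (IntermediateField.algebraMap_mem _ c) (pow_mem this 2))
  have h := IntermediateField.adjoin.finrank hα
  rw [htop, IntermediateField.finrank_top', hmin, Polynomial.natDegree_X_pow_sub_C] at h
  exact h

variable [NumberField F] [IsCyclotomicExtension {3} ℚ F]

lemma finrank_eq_six (S : PureCubic F K) : Module.finrank ℚ K = 6 := by
  have h2 : Module.finrank ℚ F = 2 := by
    rw [IsCyclotomicExtension.finrank (n := 3) F (Polynomial.cyclotomic.irreducible_rat (by norm_num))]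
    rfl
  rw [← Module.finrank_mul_finrank ℚ F K, h2, S.finrank_eq_three]

lemma exists_eq_pow {x : Kˣ} (hx : x ∈ (toPrincipalIdeal (𝓞 K) K).ker) (hD : x ∈ S.DU.ker) :
    ∃ i : ℕ, x = S.wU ^ i ∨ x = -S.wU ^ i := by
  obtain ⟨a, ha⟩ := S.mem_ker_DU.1 hD
  have h_int : ∀ (y : Kˣ) (b : F), y ∈ (toPrincipalIdeal (𝓞 K) K).ker → algebraMap F K b = y →
      IsIntegral ℤ b := by
    intro y b hy hb
    obtain ⟨u, hu⟩ := mem_ker_toPrincipalIdeal.1 hy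
    rw [← isIntegral_algebraMap_iff (algebraMap F K).injective, hb, ← hu]
    exact RingOfIntegers.isIntegral_coe _
  have ha' : algebraMap F K a⁻¹ = (x⁻¹ : Kˣ) := by rw [map_inv₀, ha, Units.val_inv_eq_inv_val]
  have ha0 : a ≠ 0 := by
    rintro rfl
    rw [map_zero] at ha
    exact x.ne_zero ha.symm
  set b : 𝓞 F := ⟨a, h_int x a hx ha⟩ with hb
  set b' : 𝓞 F := ⟨a⁻¹, h_int x⁻¹ a⁻¹ (inv_mem hx) ha'⟩
  have h1 : b * b' = 1 := RingOfIntegers.ext (mul_inv_cancel₀ ha0)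
  set u : (𝓞 F)ˣ := ⟨b, b', h1, by rw [mul_comm, h1]⟩ with hu
  set f : (𝓞 F)ˣ →* Kˣ := Units.map ((algebraMap F K : F →* K).comp (algebraMap (𝓞 F) F : 𝓞 F →* F))
  have hfu : f u = x := Units.ext ha
  have hfn : ∀ v, f (-v) = - f v := fun v => Units.ext (by simp [f])
  have hfη : f (S.hω.toInteger_isPrimitiveRoot.isUnit (by norm_num)).unit = S.wU :=
    Units.ext rfl
  have hmem := IsCyclotomicExtension.Rat.Three.Units.mem S.hω u
  simp only [List.mem_cons, List.not_mem_nil, or_false] at hmem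
  rw [← hfu]
  rcases hmem with h | h | h | h | h | h <;> rw [h]
  · exact ⟨0, Or.inl (by rw [map_one, pow_zero])⟩
  · exact ⟨0, Or.inr (by rw [hfn, map_one, pow_zero])⟩
  · exact ⟨1, Or.inl (by rw [hfη, pow_one])⟩
  · exact ⟨1, Or.inr (by rw [hfn, hfη, pow_one])⟩
  · exact ⟨2, Or.inl (by rw [map_pow, hfη])⟩
  · exact ⟨2, Or.inr (by rw [hfn, map_pow, hfη])⟩

end Units

end PureCubic

namespace PureCubic

section Index

variable {F K : Type*} [Field F] [Field K] [NumberField K] [Algebra F K] (S : PureCubic F K)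

lemma wU_mem_range_iff : S.wU ∈ S.NU.range ↔ IsCubicNorm (S.d : F) S.ω := by
  rw [← S.exists_norm_eq_iff]
  constructor
  · rintro ⟨y, hy⟩
    exact ⟨y, congrArg Units.val hy⟩
  · rintro ⟨y, hy⟩
    have h0 : y ≠ 0 := by
      rintro rfl
      refine S.wU.ne_zero (hy.symm.trans ?_)
      rw [norm, zero_mul, zero_mul]
    exact ⟨Units.mk0 y h0, Units.ext hy⟩

lemma DU_DU {x : Kˣ} (hx : x ∈ S.NU.ker) : S.DU (S.DU x) = ((S.sU x)⁻¹) ^ 3 := by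
  rw [MonoidHom.mem_ker, NU_apply] at hx
  have h : S.sU (S.sU x) = (x * S.sU x)⁻¹ := (inv_eq_of_mul_eq_one_right hx).symm
  rw [DU_apply, DU_apply, map_div, h]
  generalize S.sU x = y
  ext1
  push_cast
  field_simp

lemma sU_mem_ker_NU {x : Kˣ} : S.sU x ∈ S.NU.ker ↔ x ∈ S.NU.ker := by
  rw [MonoidHom.mem_ker, MonoidHom.mem_ker, NU_apply, NU_apply, S.sU_cube]
  rw [mul_comm, ← mul_assoc]

lemma card_zpowers_wU : Nat.card (Subgroup.zpowers S.wU) = 3 := by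
  rw [Nat.card_zpowers, ← S.isPrimitiveRoot_wU.eq_orderOf]

variable [NumberField F] [IsCyclotomicExtension {3} ℚ F]

lemma mem_zpowers_wU {x : Kˣ} (h : x ^ 3 = 1) : x ∈ Subgroup.zpowers S.wU := by
  have h1 : (x : K) ^ 3 = 1 := by rw [← Units.val_pow_eq_pow_val, h, Units.val_one]
  obtain ⟨i, -, hi⟩ := S.isPrimitiveRoot_w.eq_pow_of_pow_eq_one h1
  exact ⟨i, Units.ext (by simpa using hi)⟩

lemma finite_DU_ker_inf : Set.Finite ((S.DU.ker ⊓ (toPrincipalIdeal (𝓞 K) K).ker : Subgroup Kˣ) : Set Kˣ) := by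
  have : Finite (Subgroup.zpowers S.wU) := Nat.finite_of_card_ne_zero (by
    rw [S.card_zpowers_wU]; norm_num)
  refine ((Set.Finite.image2 (fun (s : Kˣ) (t : Kˣ) => s * t) (Set.toFinite {1, -1})
    (Set.toFinite (Subgroup.zpowers S.wU : Set Kˣ)))).subset ?_
  rintro x ⟨hx1, hx2⟩
  obtain ⟨i, h | h⟩ := S.exists_eq_pow hx2 hx1
  · exact ⟨1, by simp, _, ⟨i, zpow_natCast _ _⟩, (one_mul _).trans h.symm⟩
  · exact ⟨-1, by simp, _, ⟨i, zpow_natCast _ _⟩, (neg_one_mul _).trans h.symm⟩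

lemma index_DU_units : (((toPrincipalIdeal (𝓞 K) K).ker ⊓ S.NU.ker).map S.DU).relIndex ((toPrincipalIdeal (𝓞 K) K).ker ⊓ S.NU.ker) = 9 := by
  apply relIndex_map_eq_nine
  · rintro _ ⟨x, hx, rfl⟩
    obtain ⟨hx1, hx2⟩ := Subgroup.mem_inf.1 hx
    exact Subgroup.mem_inf.2 ⟨div_mem (S.sU_mem_ker hx1) hx1, div_mem (S.sU_mem_ker_NU.2 hx2) hx2⟩
  · have h1 : (((toPrincipalIdeal (𝓞 K) K).ker ⊓ S.NU.ker).map S.DU).map S.DU = ((toPrincipalIdeal (𝓞 K) K).ker ⊓ S.NU.ker).map (powMonoidHom 3) := by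
      ext y
      constructor
      · rintro ⟨_, ⟨x, hx, rfl⟩, rfl⟩
        obtain ⟨hx1, hx2⟩ := Subgroup.mem_inf.1 hx
        exact ⟨(S.sU x)⁻¹, Subgroup.mem_inf.2 ⟨inv_mem (S.sU_mem_ker hx1),
          inv_mem (S.sU_mem_ker_NU.2 hx2)⟩, (S.DU_DU hx2).symm⟩
      · rintro ⟨x, hx, rfl⟩
        obtain ⟨hx1, hx2⟩ := Subgroup.mem_inf.1 hx
        have hx3 : (S.sU (S.sU x))⁻¹ ∈ S.NU.ker :=
          inv_mem (S.sU_mem_ker_NU.2 (S.sU_mem_ker_NU.2 hx2))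
        refine ⟨_, ⟨(S.sU (S.sU x))⁻¹, Subgroup.mem_inf.2
          ⟨inv_mem (S.sU_mem_ker (S.sU_mem_ker hx1)), hx3⟩, rfl⟩, ?_⟩
        rw [S.DU_DU hx3, map_inv, S.sU_cube, inv_inv]
        rfl
    rw [h1, relIndex_cubes_eq inf_le_left]
    · have hι : Function.Injective (Units.map (algebraMap (𝓞 K) K : 𝓞 K →* K)) :=
        Units.map_injective (FaithfulSMul.algebraMap_injective (𝓞 K) K)
      have h2 : (toPrincipalIdeal (𝓞 K) K).ker = (⊤ : Subgroup (𝓞 K)ˣ).map (Units.map (algebraMap (𝓞 K) K : 𝓞 K →* K)) := by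
        ext x
        rw [mem_ker_toPrincipalIdeal, ← MonoidHom.range_eq_map]
        rfl
      have h3 : (toPrincipalIdeal (𝓞 K) K).ker.map (powMonoidHom 3) = (powMonoidHom 3 : (𝓞 K)ˣ →* (𝓞 K)ˣ).range.map
          (Units.map (algebraMap (𝓞 K) K : 𝓞 K →* K)) := by
        rw [h2, Subgroup.map_map, MonoidHom.range_eq_map, Subgroup.map_map]
        have : ((powMonoidHom 3 : Kˣ →* Kˣ).comp (Units.map (algebraMap (𝓞 K) K : 𝓞 K →* K))) =
            (Units.map (algebraMap (𝓞 K) K : 𝓞 K →* K)).comp (powMonoidHom 3) :=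
          MonoidHom.ext fun x => (map_pow _ _ _).symm
        rw [this]
      rw [h3, h2, Subgroup.relIndex_map_map_of_injective _ _ hι, Subgroup.relIndex_top_right]
      exact unit_cubes_index S.isPrimitiveRoot_w S.finrank_eq_six
    · rw [Subgroup.inf_relIndex_left, Subgroup.relIndex_ker]
      have : Finite ((toPrincipalIdeal (𝓞 K) K).ker.map S.NU) := S.finite_DU_ker_inf.subset (by
        rintro _ ⟨x, hx, rfl⟩
        exact ⟨S.NU_mem_ker_DU x, S.NU_mem_ker hx⟩)
      exact Nat.card_pos.ne'
    · intro x hx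
      obtain ⟨hx1, hx2⟩ := Subgroup.mem_inf.1 hx
      refine Subgroup.mem_inf.2 ⟨hx2, ?_⟩
      obtain ⟨i, rfl⟩ := S.mem_zpowers_wU hx1
      refine zpow_mem (?_ : S.wU ∈ S.NU.ker) _
      rw [MonoidHom.mem_ker, S.NU_of_mem_ker S.DU_wU, S.wU_cube]
  · rw [← S.card_zpowers_wU]
    refine congrArg (fun A : Subgroup Kˣ => Nat.card A) (le_antisymm ?_ ?_)
    · intro x hx
      obtain ⟨hx1, hx2⟩ := Subgroup.mem_inf.1 hx
      obtain ⟨hx2, hx3⟩ := Subgroup.mem_inf.1 hx2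
      rw [MonoidHom.mem_ker, S.NU_of_mem_ker hx1] at hx3
      exact S.mem_zpowers_wU hx3
    · rw [Subgroup.zpowers_le]
      refine ⟨S.DU_wU, S.wU_mem_ker, ?_⟩
      change S.NU _ = 1
      rw [S.NU_of_mem_ker S.DU_wU, S.wU_cube]

lemma norm_units_eq :
    (S.DU.ker ⊓ (toPrincipalIdeal (𝓞 K) K).ker).map S.NU = (S.NU.range ⊓ (toPrincipalIdeal (𝓞 K) K).ker) ⊓ (powMonoidHom 2 : Kˣ →* Kˣ).ker := by
  ext y
  constructor
  · rintro ⟨x, ⟨hx1, hx2⟩, rfl⟩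
    refine ⟨⟨⟨x, rfl⟩, S.NU_mem_ker hx2⟩, ?_⟩
    change S.NU x ^ 2 = 1
    rw [S.NU_of_mem_ker hx1]
    obtain ⟨i, rfl | rfl⟩ := S.exists_eq_pow hx2 hx1
    · rw [pow_right_comm _ 3 2, pow_right_comm _ i 2, pow_right_comm _ i 3, pow_right_comm _ 2 3, S.wU_cube, one_pow, one_pow]
    · rw [Odd.neg_pow (by decide), neg_sq, pow_right_comm _ 3 2, pow_right_comm _ i 2, pow_right_comm _ i 3, pow_right_comm _ 2 3, S.wU_cube, one_pow, one_pow]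
  · rintro ⟨⟨-, hx2⟩, hx3⟩
    have h : y = 1 ∨ y = -1 := by
      have h1 : y ^ 2 = 1 := hx3
      have h2 : (y : K) ^ 2 = 1 := by rw [← Units.val_pow_eq_pow_val, h1, Units.val_one]
      rcases (mul_self_eq_one_iff.1 ((sq (y : K)).symm.trans h2)) with h | h
      · exact Or.inl (Units.ext h)
      · exact Or.inr (Units.ext h)
    have hD : y ∈ S.DU.ker := by
      rcases h with rfl | rfl
      · exact one_mem _
      · exact S.mem_ker_DU.2 ⟨-1, by simp⟩
    refine ⟨y, ⟨hD, hx2⟩, ?_⟩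
    rw [S.NU_of_mem_ker hD]
    rcases h with rfl | rfl
    · simp
    · exact Odd.neg_one_pow (by decide)

open Classical in
lemma index_norm_units : ((S.DU.ker ⊓ (toPrincipalIdeal (𝓞 K) K).ker).map S.NU).relIndex (S.NU.range ⊓ (toPrincipalIdeal (𝓞 K) K).ker) =
    if IsCubicNorm (S.d : F) S.ω then 3 else 1 := by
  rw [norm_units_eq, Subgroup.inf_relIndex_left, Subgroup.relIndex_ker, ← S.wU_mem_range_iff]
  have hpm : ∀ x ∈ S.NU.range ⊓ (toPrincipalIdeal (𝓞 K) K).ker, ∃ i : ℕ, x = S.wU ^ i ∨ x = -S.wU ^ i := by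
    rintro x ⟨⟨y, rfl⟩, hx⟩
    exact S.exists_eq_pow hx (S.NU_mem_ker_DU y)
  have hsq : ∀ x ∈ S.NU.range ⊓ (toPrincipalIdeal (𝓞 K) K).ker, ∃ i : ℕ, x ^ 2 = S.wU ^ i := by
    intro x hx
    obtain ⟨i, rfl | rfl⟩ := hpm x hx
    · exact ⟨i * 2, (pow_mul _ _ _).symm⟩
    · exact ⟨i * 2, by rw [neg_sq, pow_mul]⟩
  have hw : ∀ i : ℕ, S.wU ^ i ∈ S.NU.range → S.wU ^ i ≠ 1 → S.wU ∈ S.NU.range := by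
    intro i hi hne
    rw [← Nat.div_add_mod i 3, pow_add, pow_mul, S.wU_cube, one_pow, one_mul] at hi hne
    have := Nat.mod_lt i (show 3 > 0 by norm_num)
    interval_cases i % 3
    · exact absurd (pow_zero _) hne
    · simpa using hi
    · rw [show S.wU = (S.wU ^ 2) ^ 2 by rw [← pow_mul, show 2 * 2 = 3 + 1 by norm_num, pow_succ,
        S.wU_cube, one_mul]]
      exact pow_mem hi 2
  split_ifs with h
  · rw [← S.card_zpowers_wU]
    refine congrArg (fun A : Subgroup Kˣ => Nat.card A) (le_antisymm ?_ ?_)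
    · rintro _ ⟨x, hx, rfl⟩
      obtain ⟨i, hi⟩ := hsq x hx
      exact ⟨i, by simpa using hi.symm⟩
    · rw [Subgroup.zpowers_le]
      refine ⟨S.wU ^ 2, ⟨pow_mem h 2, pow_mem S.wU_mem_ker 2⟩, ?_⟩
      change (S.wU ^ 2) ^ 2 = S.wU
      rw [← pow_mul, show 2 * 2 = 3 + 1 by norm_num, pow_succ, S.wU_cube, one_mul]
  · rw [Subgroup.card_eq_one, eq_bot_iff]
    rintro _ ⟨x, hx, rfl⟩
    obtain ⟨i, hi⟩ := hsq x hx
    rw [Subgroup.mem_bot]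
    by_contra hne
    change x ^ 2 ≠ 1 at hne
    rw [hi] at hne
    exact h (hw i (hi ▸ pow_mem hx.1 2) hne)

open Classical in
/-- The class number formula for ambiguous classes, in terms of invariant ideals. -/
lemma index_formula :
    9 * (toPrincipalIdeal (𝓞 K) K).range.relIndex ((toPrincipalIdeal (𝓞 K) K).range.comap S.DJ) =
      (if IsCubicNorm (S.d : F) S.ω then 3 else 1) *
        (S.DU.ker.map (toPrincipalIdeal (𝓞 K) K)).relIndex S.DJ.ker := by
  have : CharZero F := inferInstance
  rw [ambiguous_index_formula (toPrincipalIdeal (𝓞 K) K) S.DU S.NU S.DJ S.DJ_principal S.range_DU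
    S.ideal_hilbert90 S.index_DU_units, S.index_norm_units]

end Index

end PureCubic

lemma dvd_of_cubic {O : Type*} [CommRing O] [IsDomain O] [IsIntegrallyClosed O] {g u a b c : O}
    (h : u ^ 3 + g * a * u ^ 2 + g ^ 2 * b * u + g ^ 3 * c = 0) : g ∣ u := by
  by_cases hg : g = 0
  · subst hg
    have : u ^ 3 = 0 := by linear_combination h
    rw [pow_eq_zero_iff (by norm_num)] at this
    rw [this]
  set f := algebraMap O (FractionRing O)
  have hg' : f g ≠ 0 := (map_ne_zero_iff _ (FaithfulSMul.algebraMap_injective O (FractionRing O))).2 hg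
  have h' : f u ^ 3 + f g * f a * f u ^ 2 + f g ^ 2 * f b * f u + f g ^ 3 * f c = 0 := by
    simp only [← map_mul, ← map_pow, ← map_add, h, map_zero]
  have hi : IsIntegral O (f u / f g) := by
    refine ⟨Polynomial.X ^ 3 + Polynomial.C a * Polynomial.X ^ 2 + Polynomial.C b * Polynomial.X +
      Polynomial.C c, by monicity!, ?_⟩
    simp only [Polynomial.eval₂_add, Polynomial.eval₂_mul, Polynomial.eval₂_pow, Polynomial.eval₂_X,
      Polynomial.eval₂_C]
    field_simp
    linear_combination h'
  obtain ⟨y, hy⟩ := IsIntegrallyClosed.isIntegral_iff.1 hi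
  refine ⟨y, FaithfulSMul.algebraMap_injective O (FractionRing O) ?_⟩
  rw [map_mul, hy, mul_div_cancel₀ _ hg']

lemma span_pair_mul_mul {O : Type*} [CommRing O] (a b c d e f : O) :
    Ideal.span {a, b} * Ideal.span {c, d} * Ideal.span {e, f} =
      Ideal.span {a * c * e, a * c * f, a * d * e, a * d * f, b * c * e, b * c * f, b * d * e,
        b * d * f} := by
  rw [Ideal.span_mul_span', Ideal.span_mul_span']
  congr 1
  ext z
  simp only [Set.insert_eq, Set.union_mul, Set.mul_union, Set.singleton_mul_singleton,
    Set.mem_union, Set.mem_singleton_iff]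
  tauto

namespace PureCubic

variable {F K : Type*} [Field F] [Field K] [NumberField F] [NumberField K] [Algebra F K]
  (S : PureCubic F K)

lemma exists_of_sO_eq {x : 𝓞 K} (h : S.sO x = x) : ∃ a : 𝓞 F, algebraMap (𝓞 F) (𝓞 K) a = x := by
  obtain ⟨a, ha⟩ := S.exists_of_sigma_eq (x := (x : K)) (by rw [← S.coe_sO, h])
  have : IsIntegral ℤ a := by
    rw [← isIntegral_algebraMap_iff (algebraMap F K).injective, ha]
    exact RingOfIntegers.isIntegral_coe _
  exact ⟨⟨a, this⟩, RingOfIntegers.ext ha⟩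

@[simp] lemma sO_algebraMap (a : 𝓞 F) : S.sO (algebraMap (𝓞 F) (𝓞 K) a) = algebraMap (𝓞 F) (𝓞 K) a :=
  RingOfIntegers.ext (S.σ.commutes (a : F))

lemma span_pair_norm [IsPrincipalIdealRing (𝓞 F)] (x y : 𝓞 K) :
    ∃ g : 𝓞 F, Ideal.span {x, y} * Ideal.span {S.sO x, S.sO y} *
      Ideal.span {S.sO (S.sO x), S.sO (S.sO y)} = Ideal.span {algebraMap (𝓞 F) (𝓞 K) g} := by
  rw [span_pair_mul_mul]
  set x₁ := S.sO x with hx₁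
  set x₂ := S.sO x₁ with hx₂
  set y₁ := S.sO y with hy₁
  set y₂ := S.sO y₁ with hy₂
  have hx3 : S.sO x₂ = x := S.sO_cube x
  have hy3 : S.sO y₂ = y := S.sO_cube y
  obtain ⟨c₀, h₀⟩ := S.exists_of_sO_eq (x := x * x₁ * x₂) (by
    rw [map_mul, map_mul, hx3, ← hx₁, ← hx₂]; ring)
  obtain ⟨c₁, h₁⟩ := S.exists_of_sO_eq (x := x * x₁ * y₂ + x₁ * x₂ * y + x₂ * x * y₁) (by
    simp only [map_add, map_mul, hx3, hy3, ← hx₁, ← hx₂, ← hy₁, ← hy₂]; ring)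
  obtain ⟨c₂, h₂⟩ := S.exists_of_sO_eq (x := x * y₁ * y₂ + x₁ * y₂ * y + x₂ * y * y₁) (by
    simp only [map_add, map_mul, hx3, hy3, ← hx₁, ← hx₂, ← hy₁, ← hy₂]; ring)
  obtain ⟨c₃, h₃⟩ := S.exists_of_sO_eq (x := y * y₁ * y₂) (by
    rw [map_mul, map_mul, hy3, ← hy₁, ← hy₂]; ring)
  obtain ⟨g, hg⟩ := (IsPrincipalIdealRing.principal (Ideal.span {c₀, c₁, c₂, c₃})).principal
  rw [Ideal.submodule_span_eq] at hg
  have hdvd : ∀ c ∈ ({c₀, c₁, c₂, c₃} : Set (𝓞 F)), g ∣ c := by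
    intro c hc
    rw [← Ideal.mem_span_singleton, ← hg]
    exact Ideal.subset_span hc
  obtain ⟨e₀, he₀⟩ := hdvd c₀ (by simp)
  obtain ⟨e₁, he₁⟩ := hdvd c₁ (by simp)
  obtain ⟨e₂, he₂⟩ := hdvd c₂ (by simp)
  obtain ⟨e₃, he₃⟩ := hdvd c₃ (by simp)
  set ι := algebraMap (𝓞 F) (𝓞 K)
  rw [he₀, map_mul] at h₀
  rw [he₁, map_mul] at h₁
  rw [he₂, map_mul] at h₂
  rw [he₃, map_mul] at h₃
  have hu : ∀ u, u ^ 3 - ι g * ι e₁ * u ^ 2 + (ι g * ι e₀) * (ι g * ι e₂) * u -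
      (ι g * ι e₀) ^ 2 * (ι g * ι e₃) = 0 → ι g ∣ u := fun u hu =>
    dvd_of_cubic (a := - ι e₁) (b := ι e₀ * ι e₂) (c := - (ι e₀ ^ 2 * ι e₃)) (by
      linear_combination hu)
  have hw : ∀ u, u ^ 3 - ι g * ι e₂ * u ^ 2 + (ι g * ι e₃) * (ι g * ι e₁) * u -
      (ι g * ι e₃) ^ 2 * (ι g * ι e₀) = 0 → ι g ∣ u := fun u hu =>
    dvd_of_cubic (a := - ι e₂) (b := ι e₃ * ι e₁) (c := - (ι e₃ ^ 2 * ι e₀)) (by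
      linear_combination hu)
  rw [h₀, h₁, h₂, h₃] at hu hw
  refine ⟨g, le_antisymm ?_ ?_⟩
  · rw [Ideal.span_le]
    intro z hz
    rw [SetLike.mem_coe, Ideal.mem_span_singleton]
    simp only [Set.mem_insert_iff, Set.mem_singleton_iff] at hz
    rcases hz with rfl | rfl | rfl | rfl | rfl | rfl | rfl | rfl
    · exact h₀ ▸ dvd_mul_right _ _
    · exact hu _ (by ring)
    · exact hu _ (by ring)
    · exact hw _ (by ring)
    · exact hu _ (by ring)
    · exact hw _ (by ring)
    · exact hw _ (by ring)
    · exact h₃ ▸ dvd_mul_right _ _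
  · rw [Ideal.span_singleton_le_iff_mem]
    have hgm : g ∈ Ideal.span {c₀, c₁, c₂, c₃} := hg ▸ Ideal.mem_span_singleton_self g
    have := Ideal.mem_map_of_mem ι hgm
    rw [Ideal.map_span] at this
    refine (Ideal.span_le.2 ?_) this
    rintro _ ⟨c, hc, rfl⟩
    simp only [Set.mem_insert_iff, Set.mem_singleton_iff] at hc
    rw [SetLike.mem_coe]
    rcases hc with rfl | rfl | rfl | rfl
    · rw [he₀, map_mul, h₀]
      exact Ideal.subset_span (by simp)
    · rw [he₁, map_mul, h₁, show x₁ * x₂ * y = y * x₁ * x₂ by ring, show x₂ * x * y₁ = x * y₁ * x₂ by ring]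
      exact add_mem (add_mem (Ideal.subset_span (by simp)) (Ideal.subset_span (by simp)))
        (Ideal.subset_span (by simp))
    · rw [he₂, map_mul, h₂, show x₁ * y₂ * y = y * x₁ * y₂ by ring, show x₂ * y * y₁ = y * y₁ * x₂ by ring]
      exact add_mem (add_mem (Ideal.subset_span (by simp)) (Ideal.subset_span (by simp)))
        (Ideal.subset_span (by simp))
    · rw [he₃, map_mul, h₃]
      exact Ideal.subset_span (by simp)

end PureCubic

namespace PureCubic

open FractionalIdeal

variable {F K : Type*} [Field F] [Field K] [NumberField F] [NumberField K] [Algebra F K]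
  (S : PureCubic F K)

/-- The fractional ideal of `K` generated by an element of `F`. -/
def fP (_S : PureCubic F K) : Fˣ →* (FractionalIdeal (𝓞 K)⁰ K)ˣ :=
  (toPrincipalIdeal (𝓞 K) K).comp (Units.map (algebraMap F K : F →* K))

lemma coe_fP (c : Fˣ) : (S.fP c : FractionalIdeal (𝓞 K)⁰ K) = spanSingleton (𝓞 K)⁰ (algebraMap F K c) :=
  coe_toPrincipalIdeal _

lemma coe_fP_mk (g : 𝓞 F) (hg : (g : F) ≠ 0) : (S.fP (Units.mk0 (g : F) hg) : FractionalIdeal (𝓞 K)⁰ K) =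
    (Ideal.span {algebraMap (𝓞 F) (𝓞 K) g} : Ideal (𝓞 K)) := by
  rw [coe_fP, coeIdeal_span_singleton]
  rfl

lemma exists_of_mem_ker_DU {x : Kˣ} (hx : x ∈ S.DU.ker) :
    ∃ c : Fˣ, Units.map (algebraMap F K : F →* K) c = x := by
  obtain ⟨a, ha⟩ := S.mem_ker_DU.1 hx
  have h0 : a ≠ 0 := by
    rintro rfl
    rw [map_zero] at ha
    exact x.ne_zero ha.symm
  exact ⟨Units.mk0 a h0, Units.ext ha⟩

lemma range_fP : S.fP.range = S.DU.ker.map (toPrincipalIdeal (𝓞 K) K) := by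
  ext y
  constructor
  · rintro ⟨c, rfl⟩
    exact ⟨_, S.mem_ker_DU.2 ⟨c, rfl⟩, rfl⟩
  · rintro ⟨x, hx, rfl⟩
    obtain ⟨c, rfl⟩ := S.exists_of_mem_ker_DU hx
    exact ⟨c, rfl⟩

lemma sJ_fP (c : Fˣ) : S.sJ (S.fP c) = S.fP c := by
  ext1
  rw [coe_sJ, coe_fP, phi_spanSingleton, S.σ.commutes]

lemma mem_ker_DJ {I : (FractionalIdeal (𝓞 K)⁰ K)ˣ} : I ∈ S.DJ.ker ↔ S.sJ I = I := by
  rw [MonoidHom.mem_ker, DJ_apply, div_eq_one]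

lemma NJ_mem_range [IsPrincipalIdealRing (𝓞 F)] (I : (FractionalIdeal (𝓞 K)⁰ K)ˣ) :
    S.NJ I ∈ S.fP.range := by
  obtain ⟨a, I₀, ha, hI⟩ := exists_eq_spanSingleton_mul (I : FractionalIdeal (𝓞 K)⁰ K)
  have hI0 : I₀ ≠ ⊥ := by
    rintro rfl
    apply I.ne_zero
    rw [hI, coeIdeal_bot, mul_zero]
  obtain ⟨x, hx, hx0⟩ := Submodule.exists_mem_ne_zero_of_ne_bot hI0
  obtain ⟨y, hy⟩ := IsDedekindDomain.exists_eq_span_pair hx hx0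
  obtain ⟨g, hg⟩ := S.span_pair_norm x y
  have hI0' : (I₀ : FractionalIdeal (𝓞 K)⁰ K) ≠ 0 := coeIdeal_ne_zero.2 hI0
  have ha' : (algebraMap (𝓞 K) K a)⁻¹ ≠ 0 := inv_ne_zero
    ((map_ne_zero_iff _ (FaithfulSMul.algebraMap_injective (𝓞 K) K)).2 ha)
  have hI' : I = toPrincipalIdeal (𝓞 K) K (Units.mk0 _ ha') * Units.mk0 _ hI0' := Units.ext (by
    rw [Units.val_mul, coe_toPrincipalIdeal, Units.val_mk0, Units.val_mk0, hI])
  rw [hI', map_mul]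
  apply mul_mem
  · rw [← NJ_principal, range_fP]
    exact ⟨_, S.NU_mem_ker_DU _, rfl⟩
  · have hcoe : (S.NJ (Units.mk0 _ hI0') : FractionalIdeal (𝓞 K)⁰ K) =
        (Ideal.span {algebraMap (𝓞 F) (𝓞 K) g} : Ideal (𝓞 K)) := by
      rw [← hg, NJ_apply, Units.val_mul, Units.val_mul, coe_sJ, coe_sJ, coe_sJ, Units.val_mk0,
        phi_coeIdeal, phi_coeIdeal, hy, Ideal.map_span, Ideal.map_span, Set.image_pair,
        Set.image_pair, coeIdeal_mul, coeIdeal_mul]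
      rfl
    have hg0 : (g : F) ≠ 0 := by
      intro h0
      apply (S.NJ (Units.mk0 _ hI0')).ne_zero
      rw [hcoe, RingOfIntegers.ext (h0.trans (map_zero _).symm : (g : F) = ((0 : 𝓞 F) : F)), map_zero]
      simp
    exact ⟨Units.mk0 _ hg0, Units.ext ((S.coe_fP_mk g hg0).trans hcoe.symm)⟩

lemma NJ_of_mem_ker {I : (FractionalIdeal (𝓞 K)⁰ K)ˣ} (h : I ∈ S.DJ.ker) : S.NJ I = I ^ 3 := by
  rw [mem_ker_DJ] at h
  rw [NJ_apply, h, h, pow_succ, pow_two]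

lemma eq_one_of_cube {I : (FractionalIdeal (𝓞 K)⁰ K)ˣ} (h : I ^ 3 = 1) : I = 1 := by
  have key : ∀ I : (FractionalIdeal (𝓞 K)⁰ K)ˣ, I ^ 3 = 1 → (I : FractionalIdeal (𝓞 K)⁰ K) ≤ 1 := by
    intro I h x hx
    have h3 : x ^ 3 ∈ (I ^ 3 : FractionalIdeal (𝓞 K)⁰ K) := by
      rw [pow_succ, pow_two, pow_succ, pow_two]
      exact mul_mem_mul (mul_mem_mul hx hx) hx
    rw [← Units.val_pow_eq_pow_val, h, Units.val_one] at h3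
    obtain ⟨y, hy⟩ := (mem_one_iff _).1 h3
    have : IsIntegral ℤ x := IsIntegral.of_pow (by norm_num : 0 < 3) (hy ▸ RingOfIntegers.isIntegral_coe y)
    exact (mem_one_iff _).2 ⟨⟨x, this⟩, rfl⟩
  have h1 := key I h
  have h2 := key I⁻¹ (by rw [inv_pow, h, inv_one])
  ext1
  refine le_antisymm h1 ?_
  have := mul_le_mul_right h2 (I : FractionalIdeal (𝓞 K)⁰ K)
  simpa using this

end PureCubic

lemma relIndex_range_eq_card {A J C : Type*} [CommGroup A] [CommGroup J] [CommGroup C]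
    (f : A →* J) (G : Subgroup J) (V : A →* C)
    (hcube : ∀ I ∈ G, ∃ c, f c = I ^ 3)
    (hV : ∀ c b, f c = f b ^ 3 → V c = 1)
    (hker : ∀ I ∈ G, ∀ c, f c = I ^ 3 → V c = 1 → I ∈ f.range)
    (hsurj : ∀ v, ∃ I ∈ G, ∃ c, f c = I ^ 3 ∧ V c = v) :
    f.range.relIndex G = Nat.card C := by
  choose! g hg using hcube
  have hwd : ∀ c c', f c = f c' → V c = V c' := by
    intro c c' h
    rw [← div_eq_one, ← map_div]
    apply hV _ 1
    rw [map_div, h, div_self', map_one, one_pow]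
  let Φ : G →* C :=
    { toFun := fun I => V (g I)
      map_one' := by
        change V (g 1) = 1
        rw [hwd (g 1) 1 (by rw [hg 1 (one_mem _), map_one, one_pow]), map_one]
      map_mul' := by
        rintro ⟨I, hI⟩ ⟨I', hI'⟩
        rw [← map_mul]
        apply hwd
        change f (g (I * I')) = _
        rw [map_mul, hg _ (mul_mem hI hI'), hg _ hI, hg _ hI', mul_pow] }
  have hΦ : Function.Surjective Φ := by
    intro v
    obtain ⟨I, hI, c, hc, rfl⟩ := hsurj v
    exact ⟨⟨I, hI⟩, hwd _ _ (by rw [hg I hI, hc])⟩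
  have hk : Φ.ker = f.range.subgroupOf G := by
    ext ⟨I, hI⟩
    rw [MonoidHom.mem_ker, Subgroup.mem_subgroupOf]
    constructor
    · exact fun h => hker I hI _ (hg I hI) h
    · rintro ⟨b, hb⟩
      exact hV _ b (by rw [hg I hI, hb])
  rw [Subgroup.relIndex, ← hk, Subgroup.index_ker, MonoidHom.range_eq_top.2 hΦ]
  exact Nat.card_congr Subgroup.topEquiv.toEquiv

/-- Over a principal ideal domain, every element of the fraction field is a cube times a cube-free integral element. -/
lemma exists_cube_mul_cubefree {R F : Type*} [CommRing R] [IsDomain R] [IsPrincipalIdealRing R]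
    [Field F] [Algebra R F] [IsFractionRing R F] (c : F) (hc : c ≠ 0) :
    ∃ (b : F) (n : R), b ≠ 0 ∧ n ≠ 0 ∧ c = b ^ 3 * algebraMap R F n ∧
      ∀ ϖ : R, Prime ϖ → ¬ ϖ ^ 3 ∣ n := by
  have key : ∀ n : R, n ≠ 0 → ∃ b m : R, b ≠ 0 ∧ m ≠ 0 ∧ n = b ^ 3 * m ∧ ∀ ϖ : R, Prime ϖ → ¬ ϖ ^ 3 ∣ m := by
    intro n
    induction n using (wellFounded_dvdNotUnit (α := R)).induction with
    | _ n ih =>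
      intro hn
      by_cases h : ∀ ϖ : R, Prime ϖ → ¬ ϖ ^ 3 ∣ n
      · exact ⟨1, n, one_ne_zero, hn, by ring, h⟩
      · push Not at h
        obtain ⟨ϖ, hϖ, m, rfl⟩ := h
        have hm : m ≠ 0 := right_ne_zero_of_mul hn
        obtain ⟨b, m', hb, hm', h1, h2⟩ := ih m ⟨hm, ϖ ^ 3, fun hu => hϖ.not_isUnit
          ((isUnit_pow_iff three_ne_zero).1 hu), mul_comm _ _⟩ hm
        exact ⟨ϖ * b, m', mul_ne_zero hϖ.ne_zero hb, hm', by rw [h1]; ring, h2⟩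
  obtain ⟨a, b, hb, rfl⟩ := IsFractionRing.div_surjective (A := R) c
  have hb0 : b ≠ 0 := nonZeroDivisors.ne_zero hb
  have hi := FaithfulSMul.algebraMap_injective R F
  have ha0 : a ≠ 0 := by
    rintro rfl
    simp at hc
  obtain ⟨e, m, he, hm, h1, h2⟩ := key (a * b ^ 2) (mul_ne_zero ha0 (pow_ne_zero 2 hb0))
  have hb' : algebraMap R F b ≠ 0 := (map_ne_zero_iff _ hi).2 hb0
  have he' : algebraMap R F e ≠ 0 := (map_ne_zero_iff _ hi).2 he
  refine ⟨algebraMap R F e / algebraMap R F b, m, div_ne_zero he' hb', hm, ?_, h2⟩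
  have h3 := congrArg (algebraMap R F) h1
  simp only [map_mul, map_pow] at h3
  field_simp
  linear_combination h3

namespace PureCubic

variable {F K : Type*} [Field F] [Field K] [NumberField F] [NumberField K] [Algebra F K]
  (S : PureCubic F K)

lemma dvd_of_algebraMap_dvd {a b : 𝓞 F} (h : algebraMap (𝓞 F) (𝓞 K) a ∣ algebraMap (𝓞 F) (𝓞 K) b) :
    a ∣ b := by
  obtain ⟨y, hy⟩ := h
  by_cases ha : a = 0
  · subst ha
    rw [map_zero, zero_mul, map_eq_zero_iff _ (FaithfulSMul.algebraMap_injective (𝓞 F) (𝓞 K))] at hy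
    rw [hy]
  have hy' : (algebraMap F K b) = algebraMap F K a * (y : K) :=
    congrArg (algebraMap (𝓞 K) K) hy
  have ha' : (a : F) ≠ 0 := RingOfIntegers.coe_ne_zero_iff.2 ha
  have hi : IsIntegral ℤ ((b : F) / (a : F)) := by
    rw [← isIntegral_algebraMap_iff (algebraMap F K).injective, map_div₀, hy',
      mul_div_cancel_left₀ _ ((map_ne_zero _).2 ha')]
    exact RingOfIntegers.isIntegral_coe y
  exact ⟨⟨_, hi⟩, RingOfIntegers.ext (mul_div_cancel₀ (b : F) ha').symm⟩

/-- An invariant ideal is not ramified at a prime where some element has a different coprime to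
that prime. -/
lemma prime_cube_dvd_of_dvd {I : Ideal (𝓞 K)} (hI : ∀ x ∈ I, S.sO x ∈ I) {n ϖ : 𝓞 F} (hϖ : Prime ϖ)
    (hn : I ^ 3 = Ideal.span {algebraMap (𝓞 F) (𝓞 K) n}) (hdvd : ϖ ∣ n) {θ : 𝓞 K}
    (hθ : IsCoprime (algebraMap (𝓞 F) (𝓞 K) ϖ) ((θ - S.sO θ) * (θ - S.sO (S.sO θ)))) : ϖ ^ 3 ∣ n := by
  set ι := algebraMap (𝓞 F) (𝓞 K) with hι
  have hcube : ∀ x ∈ I, ι n ∣ x ^ 3 := by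
    intro x hx
    rw [← Ideal.mem_span_singleton, ← hn]
    exact Ideal.pow_mem_pow hx 3
  have htr : ∀ x ∈ I, ι ϖ ∣ x + S.sO x + S.sO (S.sO x) := by
    intro x hx
    obtain ⟨a, ha⟩ := S.exists_of_sO_eq (x := x + S.sO x + S.sO (S.sO x)) (by
      rw [map_add, map_add, S.sO_cube]; ring)
    have h1 : ι n ∣ ι (a ^ 3) := by
      rw [map_pow, ha]
      exact hcube _ (add_mem (add_mem hx (hI _ hx)) (hI _ (hI _ hx)))
    have h2 : ϖ ∣ a ^ 3 := hdvd.trans (dvd_of_algebraMap_dvd h1)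
    rw [← ha]
    exact map_dvd ι (hϖ.dvd_of_dvd_pow h2)
  have hmem : ∀ x ∈ I, ι ϖ ∣ x := by
    intro x hx
    refine hθ.dvd_of_dvd_mul_left ?_
    have h0 := htr x hx
    have h1 := htr (θ * x) (I.mul_mem_left _ hx)
    have h2 := htr (θ ^ 2 * x) (I.mul_mem_left _ hx)
    simp only [map_mul, map_pow] at h1 h2
    have : (θ - S.sO θ) * (θ - S.sO (S.sO θ)) * x =
        (θ ^ 2 * x + S.sO θ ^ 2 * S.sO x + S.sO (S.sO θ) ^ 2 * S.sO (S.sO x)) -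
        (S.sO θ + S.sO (S.sO θ)) * (θ * x + S.sO θ * S.sO x + S.sO (S.sO θ) * S.sO (S.sO x)) +
        S.sO θ * S.sO (S.sO θ) * (x + S.sO x + S.sO (S.sO x)) := by ring
    rw [this]
    exact dvd_add (dvd_sub h2 (Dvd.dvd.mul_left h1 _)) (Dvd.dvd.mul_left h0 _)
  have hle : I ≤ Ideal.span {ι ϖ} := fun x hx => Ideal.mem_span_singleton.2 (hmem x hx)
  have h3 := Ideal.pow_right_mono hle 3
  rw [hn, Ideal.span_singleton_pow, Ideal.span_singleton_le_span_singleton, ← map_pow] at h3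
  exact dvd_of_algebraMap_dvd h3

end PureCubic

lemma span_pair_cube {O : Type*} [CommRing O] {ϖ π t : O} (hc : IsCoprime ϖ t)
    (h : π ^ 3 = ϖ * t) : Ideal.span {ϖ, π} ^ 3 = Ideal.span {ϖ} := by
  rw [pow_succ, pow_two, span_pair_mul_mul]
  apply le_antisymm
  · rw [Ideal.span_le]
    intro z hz
    rw [SetLike.mem_coe, Ideal.mem_span_singleton]
    simp only [Set.mem_insert_iff, Set.mem_singleton_iff] at hz
    rcases hz with rfl | rfl | rfl | rfl | rfl | rfl | rfl | rfl
    · exact ⟨ϖ * ϖ, by ring⟩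
    · exact ⟨ϖ * π, by ring⟩
    · exact ⟨π * ϖ, by ring⟩
    · exact ⟨π * π, by ring⟩
    · exact ⟨π * ϖ, by ring⟩
    · exact ⟨π * π, by ring⟩
    · exact ⟨π * π, by ring⟩
    · exact ⟨t, by linear_combination h⟩
  · rw [Ideal.span_singleton_le_iff_mem]
    obtain ⟨a, b, hab⟩ := hc.pow_left (m := 2)
    have : ϖ = a * (ϖ * ϖ * ϖ) + b * (π * π * π) := by
      linear_combination (-ϖ) * hab - b * h
    have hmem : a * (ϖ * ϖ * ϖ) + b * (π * π * π) ∈ Ideal.span {ϖ * ϖ * ϖ, ϖ * ϖ * π, ϖ * π * ϖ,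
        ϖ * π * π, π * ϖ * ϖ, π * ϖ * π, π * π * ϖ, π * π * π} :=
      add_mem (Ideal.mul_mem_left _ _ (Ideal.subset_span (Or.inl rfl)))
        (Ideal.mul_mem_left _ _ (Ideal.subset_span (by
          simp only [Set.mem_insert_iff, Set.mem_singleton_iff, or_true])))
    rwa [← this] at hmem

lemma span_pair_cube_sq {O : Type*} [CommRing O] {ϖ π t : O} (hc : IsCoprime ϖ t)
    (h : π ^ 3 = ϖ ^ 2 * t) (hd : ϖ ∣ π ^ 2) : Ideal.span {ϖ, π} ^ 3 = Ideal.span {ϖ ^ 2} := by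
  rw [pow_succ, pow_two, span_pair_mul_mul]
  obtain ⟨s, hs⟩ := hd
  apply le_antisymm
  · rw [Ideal.span_le]
    intro z hz
    rw [SetLike.mem_coe, Ideal.mem_span_singleton]
    simp only [Set.mem_insert_iff, Set.mem_singleton_iff] at hz
    rcases hz with rfl | rfl | rfl | rfl | rfl | rfl | rfl | rfl
    · exact ⟨ϖ, by ring⟩
    · exact ⟨π, by ring⟩
    · exact ⟨π, by ring⟩
    · exact ⟨s, by linear_combination ϖ * hs⟩
    · exact ⟨π, by ring⟩
    · exact ⟨s, by linear_combination ϖ * hs⟩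
    · exact ⟨s, by linear_combination ϖ * hs⟩
    · exact ⟨t, by linear_combination h⟩
  · rw [Ideal.span_singleton_le_iff_mem]
    obtain ⟨a, b, hab⟩ := hc
    have : ϖ ^ 2 = a * (ϖ * ϖ * ϖ) + b * (π * π * π) := by
      linear_combination (-ϖ ^ 2) * hab - b * h
    rw [this]
    exact add_mem (Ideal.mul_mem_left _ _ (Ideal.subset_span (Or.inl rfl)))
      (Ideal.mul_mem_left _ _ (Ideal.subset_span (by
        simp only [Set.mem_insert_iff, Set.mem_singleton_iff, or_true])))

namespace PureCubic

variable {F K : Type*} [Field F] [Field K] [NumberField F] [NumberField K] [Algebra F K]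
  (S : PureCubic F K)

lemma coe_mem_ker_DJ {I : Ideal (𝓞 K)} {J : (FractionalIdeal (𝓞 K)⁰ K)ˣ}
    (hJ : (J : FractionalIdeal (𝓞 K)⁰ K) = I) (h : I.map (S.sO : 𝓞 K →+* 𝓞 K) ≤ I) :
    J ∈ S.DJ.ker := by
  rw [mem_ker_DJ]
  have h' : S.phi J ≤ J := by
    rw [hJ, phi_coeIdeal]
    exact (FractionalIdeal.coeIdeal_le_coeIdeal K).2 h
  have hm : ∀ A B, A ≤ B → S.phi A ≤ S.phi B := by
    intro A B hAB y hy
    obtain ⟨x, hx, rfl⟩ := S.mem_phi.1 hy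
    exact S.mem_phi.2 ⟨x, hAB hx, rfl⟩
  ext1
  refine le_antisymm h' ?_
  have h2 := hm _ _ (hm _ _ h')
  rw [S.phi_cube] at h2
  exact h2.trans (hm _ _ h')

lemma exists_invariant {ϖ : 𝓞 F} (hϖ : Prime ϖ) {π t : 𝓞 K} {m : ℕ} (hm : m = 1 ∨ m = 2)
    (hc : IsCoprime (algebraMap (𝓞 F) (𝓞 K) ϖ) t) (h : π ^ 3 = algebraMap (𝓞 F) (𝓞 K) ϖ ^ m * t)
    (hσ : S.sO π ∈ Ideal.span {algebraMap (𝓞 F) (𝓞 K) ϖ, π}) :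
    ∃ I ∈ S.DJ.ker, ∃ c : Fˣ, (c : F) = (ϖ : F) ^ m ∧ S.fP c = I ^ 3 := by
  set ι := algebraMap (𝓞 F) (𝓞 K)
  have hi : Function.Injective ι := FaithfulSMul.algebraMap_injective (𝓞 F) (𝓞 K)
  set I₀ := Ideal.span {ι ϖ, π} with hI₀
  have h3 : I₀ ^ 3 = Ideal.span {ι (ϖ ^ m)} := by
    rw [map_pow]
    rcases hm with rfl | rfl
    · rw [pow_one]
      exact span_pair_cube hc (by rw [h, pow_one])
    · refine span_pair_cube_sq hc h (dvd_of_cubic (a := 0) (b := 0) (c := - (ι ϖ * t ^ 2)) ?_)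
      linear_combination (π ^ 3 + ι ϖ ^ 2 * t) * h
  have hI0 : I₀ ≠ ⊥ := by
    intro h0
    have : ι ϖ ∈ I₀ := Ideal.subset_span (by simp)
    rw [h0, Ideal.mem_bot, map_eq_zero_iff _ hi] at this
    exact hϖ.ne_zero this
  have hϖm : ((ϖ ^ m : 𝓞 F) : F) ≠ 0 := RingOfIntegers.coe_ne_zero_iff.2 (pow_ne_zero _ hϖ.ne_zero)
  refine ⟨Units.mk0 _ (FractionalIdeal.coeIdeal_ne_zero.2 hI0), S.coe_mem_ker_DJ (Units.val_mk0 _) ?_,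
    Units.mk0 _ hϖm, by simp, ?_⟩
  · rw [hI₀, Ideal.map_span, Ideal.span_le]
    rintro _ ⟨x, hx, rfl⟩
    rcases hx with rfl | rfl
    · change S.sO _ ∈ _
      rw [S.sO_algebraMap]
      exact Ideal.subset_span (Or.inl rfl)
    · exact hσ
  · ext1
    rw [S.coe_fP_mk, ← h3, Units.val_pow_eq_pow_val, Units.val_mk0, FractionalIdeal.coeIdeal_pow]

/-- The cube root of the radicand as an algebraic integer. -/
def αO : 𝓞 K := ⟨S.α, IsIntegral.of_pow (by norm_num : 0 < 3) (by
  rw [S.hα]; exact isIntegral_algebraMap (R := ℤ) (x := (S.d : ℤ)) |> fun h => by simpa using h)⟩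

lemma αO_cube : S.αO ^ 3 = S.d := RingOfIntegers.ext (S.hα.trans (map_natCast (algebraMap (𝓞 K) K) _).symm)

lemma sO_αO : S.sO S.αO = algebraMap (𝓞 F) (𝓞 K) S.hω.toInteger * S.αO := RingOfIntegers.ext S.hσ

end PureCubic

namespace PureCubic

variable {F K : Type*} [Field F] [Field K] [NumberField F] [NumberField K] [Algebra F K]
  [IsCyclotomicExtension {3} ℚ F] (S : PureCubic F K)

lemma not_dvd_of_coprime {ϖ : 𝓞 F} (hϖ : Prime ϖ) {a b : ℕ} (h : a.Coprime b) (ha : ϖ ∣ (a : 𝓞 F)) :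
    ¬ ϖ ∣ (b : 𝓞 F) := by
  intro hb
  obtain ⟨u, v, huv⟩ := Nat.isCoprime_iff_coprime.2 h
  refine hϖ.not_isUnit (isUnit_of_dvd_one ?_)
  have : (1 : 𝓞 F) = (u : 𝓞 F) * a + v * b := by exact_mod_cast (congrArg (Int.cast (R := 𝓞 F)) huv).symm
  rw [this]
  exact dvd_add (ha.mul_left _) (hb.mul_left _)

lemma isCoprime_of_prime_of_not_dvd {ϖ x : 𝓞 F} (hϖ : Prime ϖ) (h : ¬ ϖ ∣ x) : IsCoprime ϖ x := by
  have : IsPrincipalIdealRing (𝓞 F) := IsCyclotomicExtension.Rat.three_pid F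
  exact (hϖ.irreducible.coprime_iff_not_dvd).2 h

lemma isCoprime_map {ϖ x : 𝓞 F} (h : IsCoprime ϖ x) :
    IsCoprime (algebraMap (𝓞 F) (𝓞 K) ϖ) (algebraMap (𝓞 F) (𝓞 K) x) := h.map _

include S in
lemma eta_cube : S.hω.toInteger ^ 3 = 1 := by
  linear_combination (S.hω.toInteger - 1) * eta_rel S.hω

lemma eta_isUnit : IsUnit S.hω.toInteger := IsUnit.of_pow_eq_one S.eta_cube (by norm_num)

lemma lambda_prime : Prime (S.hω.toInteger - 1) := S.hω.zeta_sub_one_prime'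

lemma three_eq : (3 : 𝓞 F) = (S.hω.toInteger - 1) ^ 2 * (- S.hω.toInteger ^ 2) := by
  have := eta_rel S.hω
  linear_combination (S.hω.toInteger ^ 2 - 3 * S.hω.toInteger + 3) * this

lemma lambda_dvd_natCast {n : ℕ} : S.hω.toInteger - 1 ∣ (n : 𝓞 F) ↔ 3 ∣ n := by
  have := IsCyclotomicExtension.Rat.zeta_sub_one_dvd_intCast_iff' 3 S.hω (n := (n : ℤ))
  rw [Int.cast_natCast] at this
  rw [this]
  exact_mod_cast Int.natCast_dvd_natCast (m := 3) (n := n)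

lemma associated_lambda {ϖ : 𝓞 F} (hϖ : Prime ϖ) (h : ϖ ∣ 3) : Associated ϖ (S.hω.toInteger - 1) := by
  rw [S.three_eq] at h
  rcases hϖ.dvd_or_dvd h with h | h
  · exact hϖ.associated_of_dvd S.lambda_prime (hϖ.dvd_of_dvd_pow h)
  · exact absurd (isUnit_of_dvd_unit h (S.eta_isUnit.pow 2).neg) hϖ.not_isUnit

lemma exists_invariant_of_ne_three (hd0 : S.d ≠ 0) (hcf : ∀ p : ℕ, p.Prime → ¬ p ^ 3 ∣ S.d)
    {ϖ : 𝓞 F} (hϖ : Prime ϖ) {p : ℕ} (hp : p.Prime) (hp3 : p ≠ 3) (hpd : p ∣ S.d) (hϖp : ϖ ∣ (p : 𝓞 F)) :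
    ∃ m, (m = 1 ∨ m = 2) ∧ ∃ I ∈ S.DJ.ker, ∃ c : Fˣ, (c : F) = (ϖ : F) ^ m ∧ S.fP c = I ^ 3 := by
  obtain ⟨e, s, hs, he⟩ := Nat.exists_eq_pow_mul_and_not_dvd hd0 p hp.ne_one
  have hm : e = 1 ∨ e = 2 := by
    have h0 : e ≠ 0 := by
      rintro rfl
      rw [pow_zero, one_mul] at he
      exact hs (he ▸ hpd)
    have h3 : e < 3 := by
      by_contra h
      exact hcf p hp (((pow_dvd_pow p (not_lt.1 h)).mul_right s).trans (he ▸ dvd_rfl))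
    omega
  obtain ⟨r, hr⟩ := hϖp
  have hϖr : ¬ ϖ ∣ r := by
    rintro ⟨r', rfl⟩
    obtain ⟨z, hz⟩ := dvd_pow_sq_sub_self S.hω hp hp3 ϖ
    have hp2 : p ^ 2 = (p ^ 2 - 2) + 2 := by have := hp.two_le; have := Nat.pow_le_pow_left this 2; omega
    rw [hr, hp2, pow_add] at hz
    have : ϖ * (ϖ * (ϖ ^ (p ^ 2 - 2) - r' * z) - 1) = 0 := by linear_combination hz
    have h1 := (mul_eq_zero.1 this).resolve_left hϖ.ne_zero
    exact hϖ.not_isUnit (IsUnit.of_mul_eq_one _ (sub_eq_zero.1 h1))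
  have hϖs : ¬ ϖ ∣ (s : 𝓞 F) :=
    not_dvd_of_coprime hϖ ((Nat.Prime.coprime_iff_not_dvd hp).2 hs) ⟨r, hr⟩
  refine ⟨e, hm, S.exists_invariant hϖ (t := algebraMap (𝓞 F) (𝓞 K) (r ^ e * s)) (π := S.αO) hm
    (isCoprime_map (isCoprime_of_prime_of_not_dvd hϖ ?_)) ?_ ?_⟩
  · intro h
    rcases hϖ.dvd_or_dvd h with h | h
    · exact hϖr (hϖ.dvd_of_dvd_pow h)
    · exact hϖs h
  · rw [S.αO_cube, he, ← map_pow, ← map_mul, ← map_natCast (algebraMap (𝓞 F) (𝓞 K))]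
    rw [Nat.cast_mul, Nat.cast_pow, hr, mul_pow, mul_assoc]
  · rw [S.sO_αO]
    exact Ideal.mul_mem_left _ _ (Ideal.subset_span (by simp))

lemma exists_invariant_of_dvd (hcf : ∀ p : ℕ, p.Prime → ¬ p ^ 3 ∣ S.d) (h3 : 3 ∣ S.d) :
    ∃ I ∈ S.DJ.ker, ∃ c : Fˣ, (c : F) = ((S.hω.toInteger - 1 : 𝓞 F) : F) ^ 2 ∧ S.fP c = I ^ 3 := by
  have h27 := hcf 3 Nat.prime_three
  have hl := S.lambda_prime
  have h3' := S.three_eq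
  have hcop : ∀ s m : ℕ, ¬ 3 ∣ s → IsCoprime (algebraMap (𝓞 F) (𝓞 K) (S.hω.toInteger - 1))
      (algebraMap (𝓞 F) (𝓞 K) (- S.hω.toInteger ^ 2 * s ^ m)) := by
    intro s m hs
    refine isCoprime_map (isCoprime_of_prime_of_not_dvd hl ?_)
    rw [(S.eta_isUnit.pow 2).neg.dvd_mul_left]
    intro h
    exact hs (S.lambda_dvd_natCast.1 (hl.dvd_of_dvd_pow h))
  by_cases h9 : 9 ∣ S.d
  · obtain ⟨s, hs⟩ := h9
    have hs3 : ¬ 3 ∣ s := by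
      rintro ⟨t, rfl⟩
      exact h27 ⟨t, by rw [hs]; ring⟩
    have hα := S.αO_cube
    rw [hs] at hα
    push_cast at hα
    obtain ⟨π, hπ⟩ : (3 : 𝓞 K) ∣ S.αO ^ 2 := by
      refine dvd_of_cubic (a := 0) (b := 0) (c := -(3 * s ^ 2)) ?_
      linear_combination (S.αO ^ 3 + 9 * s) * hα
    have h30 : (3 : 𝓞 K) ≠ 0 := by norm_num
    have hπ3 : π ^ 3 = 3 * (s : 𝓞 K) ^ 2 := by
      apply mul_left_cancel₀ (pow_ne_zero 3 h30)
      linear_combination (S.αO ^ 3 + 9 * s) * hα - (S.αO ^ 4 + S.αO ^ 2 * 3 * π + 9 * π ^ 2) * hπ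
    refine S.exists_invariant hl (t := algebraMap (𝓞 F) (𝓞 K) (- S.hω.toInteger ^ 2 * s ^ 2)) (π := π)
      (Or.inr rfl) (hcop s 2 hs3) ?_ ?_
    · rw [hπ3, ← map_pow, ← map_mul, ← mul_assoc, ← h3']
      simp only [map_mul, map_pow, map_natCast, map_ofNat]
    · have : S.sO π = algebraMap (𝓞 F) (𝓞 K) (S.hω.toInteger) ^ 2 * π := by
        apply mul_left_cancel₀ h30
        have h := congrArg S.sO hπ
        rw [map_mul, map_ofNat, map_pow, S.sO_αO] at h
        linear_combination -h + algebraMap (𝓞 F) (𝓞 K) (S.hω.toInteger) ^ 2 * hπ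
      rw [this]
      exact Ideal.mul_mem_left _ _ (Ideal.subset_span (by simp))
  · obtain ⟨s, hs⟩ := h3
    have hs3 : ¬ 3 ∣ s := by
      rintro ⟨t, rfl⟩
      exact h9 ⟨t, by rw [hs]; ring⟩
    refine S.exists_invariant hl (t := algebraMap (𝓞 F) (𝓞 K) (- S.hω.toInteger ^ 2 * s ^ 1)) (π := S.αO)
      (Or.inr rfl) (hcop s 1 hs3) ?_ ?_
    · rw [S.αO_cube, hs, ← map_pow, ← map_mul, ← mul_assoc, ← h3']
      simp only [map_mul, map_natCast, map_ofNat, Nat.cast_mul, Nat.cast_ofNat, pow_one]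
    · rw [S.sO_αO]
      exact Ideal.mul_mem_left _ _ (Ideal.subset_span (by simp))

lemma exists_invariant_of_not_dvd (h3 : ¬ 3 ∣ S.d) (h9 : S.d ^ 2 % 9 ≠ 1) :
    ∃ I ∈ S.DJ.ker, ∃ c : Fˣ, (c : F) = ((S.hω.toInteger - 1 : 𝓞 F) : F) ^ 2 ∧ S.fP c = I ^ 3 := by
  have hl := S.lambda_prime
  have h3' := S.three_eq
  obtain ⟨s, hs, hs3⟩ : ∃ s, S.d ^ 2 = 3 * s + 1 ∧ ¬ 3 ∣ s := by
    refine ⟨S.d ^ 2 / 3, ?_, ?_⟩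
    · have : S.d % 3 = 1 ∨ S.d % 3 = 2 := by omega
      have : S.d ^ 2 % 3 = 1 := by rcases this with h | h <;> simp [Nat.pow_mod, h]
      omega
    · have : S.d % 3 = 1 ∨ S.d % 3 = 2 := by omega
      have : S.d ^ 2 % 3 = 1 := by rcases this with h | h <;> simp [Nat.pow_mod, h]
      omega
  have hs' : (S.d : 𝓞 K) ^ 2 = 3 * s + 1 := by exact_mod_cast congrArg (Nat.cast (R := 𝓞 K)) hs
  have h3K : (3 : 𝓞 K) = (algebraMap (𝓞 F) (𝓞 K) (S.hω.toInteger - 1)) ^ 2 *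
      algebraMap (𝓞 F) (𝓞 K) (- S.hω.toInteger ^ 2) := by
    rw [← map_pow, ← map_mul, ← h3', map_ofNat]
  set l := algebraMap (𝓞 F) (𝓞 K) (S.hω.toInteger - 1) with hldef
  set u := algebraMap (𝓞 F) (𝓞 K) (- S.hω.toInteger ^ 2) with hu
  have hα := S.αO_cube
  set π := S.αO - S.d with hπ
  have hcs : ∀ n : ℕ, ¬ 3 ∣ n → IsCoprime l (n : 𝓞 K) := by
    intro n hn
    have := isCoprime_map (K := K) (isCoprime_of_prime_of_not_dvd hl (fun h => hn (S.lambda_dvd_natCast.1 h)))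
    rwa [map_natCast] at this
  have hcu : IsCoprime l (-u) := by
    have : IsUnit (-u) := by
      rw [hu]
      exact ((S.eta_isUnit.pow 2).neg.map _).neg
    exact isCoprime_one_right.of_isCoprime_of_dvd_right (isUnit_iff_dvd_one.1 this)
  have hπ3 : π ^ 3 = l ^ 2 * (-u * (S.d * (s + S.αO * π))) := by
    have : π ^ 3 = - 3 * (S.d * (s + S.αO * π)) := by
      rw [hπ]
      linear_combination hα - S.d * hs'
    rw [this, h3K]
    ring
  refine S.exists_invariant hl (π := π) (Or.inr rfl) ?_ hπ3 ?_
  · refine hcu.mul_right (IsCoprime.mul_right (hcs _ h3) ?_)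
    have hx : IsCoprime l ((s : 𝓞 K) ^ 3 + l * (S.d * (l * (-u * (S.d * (s + S.αO * π)))))) :=
      ((hcs s hs3).pow_right).add_mul_left_right _
    have hy : (s : 𝓞 K) ^ 3 + l * (S.d * (l * (-u * (S.d * (s + S.αO * π))))) =
        (s + S.αO * π) * (s ^ 2 - s * (S.αO * π) + (S.αO * π) ^ 2) := by
      linear_combination -(S.d : 𝓞 K) * hπ3 - π ^ 3 * hα
    rw [hy] at hx
    exact hx.of_mul_right_left
  · have : S.sO π = π + S.αO * l := by
      rw [hπ, map_sub, S.sO_αO, map_natCast, hldef, map_sub, map_one]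
      ring
    rw [this]
    exact add_mem (Ideal.subset_span (Or.inr rfl)) (Ideal.mul_mem_left _ _ (Ideal.subset_span (Or.inl rfl)))

lemma exists_coprime_of_not_dvd {ϖ : 𝓞 F} (hϖ : Prime ϖ) (h3 : ¬ ϖ ∣ 3) (hd : ¬ ϖ ∣ (S.d : 𝓞 F)) :
    ∃ θ, IsCoprime (algebraMap (𝓞 F) (𝓞 K) ϖ) ((θ - S.sO θ) * (θ - S.sO (S.sO θ))) := by
  refine ⟨S.αO, ?_⟩
  have h := congrArg (algebraMap (𝓞 F) (𝓞 K)) (eta_rel S.hω)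
  rw [map_add, map_add, map_one, map_zero, map_pow] at h
  have : (S.αO - S.sO S.αO) * (S.αO - S.sO (S.sO S.αO)) = algebraMap (𝓞 F) (𝓞 K) 3 * S.αO ^ 2 := by
    rw [S.sO_αO, map_mul, S.sO_αO, S.sO_algebraMap, map_ofNat]
    linear_combination (algebraMap (𝓞 F) (𝓞 K) S.hω.toInteger - 2) * S.αO ^ 2 * h
  rw [this]
  refine (isCoprime_map (isCoprime_of_prime_of_not_dvd hϖ h3)).mul_right (IsCoprime.pow_right ?_)
  have := isCoprime_map (K := K) (isCoprime_of_prime_of_not_dvd hϖ hd)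
  rw [map_natCast, ← S.αO_cube] at this
  exact (IsCoprime.pow_right_iff (by norm_num)).1 this

lemma exists_coprime_of_mod_nine {ϖ : 𝓞 F} (hϖ : Prime ϖ) (h3 : ϖ ∣ 3) (h9 : S.d ^ 2 % 9 = 1) :
    ∃ θ, IsCoprime (algebraMap (𝓞 F) (𝓞 K) ϖ) ((θ - S.sO θ) * (θ - S.sO (S.sO θ))) := by
  set l := algebraMap (𝓞 F) (𝓞 K) (S.hω.toInteger - 1) with hldef
  obtain ⟨s, hs⟩ : ∃ s, S.d ^ 2 = 9 * s + 1 := ⟨S.d ^ 2 / 9, by omega⟩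
  have hs' : (S.d : 𝓞 K) ^ 2 = 9 * s + 1 := by exact_mod_cast congrArg (Nat.cast (R := 𝓞 K)) hs
  have hd3 : ¬ 3 ∣ S.d := by
    intro h
    have := (h.mul_right S.d)
    rw [← pow_two, hs] at this
    omega
  have h3K : (3 : 𝓞 K) = l ^ 2 * algebraMap (𝓞 F) (𝓞 K) (- S.hω.toInteger ^ 2) := by
    rw [hldef, ← map_pow, ← map_mul, ← S.three_eq, map_ofNat]
  set u := algebraMap (𝓞 F) (𝓞 K) (- S.hω.toInteger ^ 2) with hu
  have hα := S.αO_cube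
  obtain ⟨θ, hθ⟩ : l ∣ S.αO - S.d := by
    refine dvd_of_cubic (a := 0) (b := u * S.d * S.αO) (c := l * u ^ 2 * S.d * s) ?_
    have e1 : l ^ 2 * (u * S.d * S.αO) = 3 * S.d * S.αO := by rw [h3K]; ring
    have e2 : l ^ 3 * (l * u ^ 2 * S.d * s) = 9 * S.d * s := by
      rw [show (9 : 𝓞 K) = 3 * 3 by norm_num, h3K]; ring
    rw [e1, e2]
    linear_combination hα - S.d * hs'
  have hl0 : l ≠ 0 := by
    rw [hldef, map_ne_zero_iff _ (FaithfulSMul.algebraMap_injective (𝓞 F) (𝓞 K))]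
    exact S.lambda_prime.ne_zero
  have hl' : l = algebraMap (𝓞 F) (𝓞 K) S.hω.toInteger - 1 := by rw [hldef, map_sub, map_one]
  have e1 : S.sO θ = θ + S.αO := by
    apply mul_left_cancel₀ hl0
    have h := congrArg S.sO hθ
    rw [map_sub, map_natCast, map_mul, S.sO_αO, hldef, S.sO_algebraMap, ← hldef] at h
    linear_combination -h + hθ - S.αO * hl'
  refine ⟨θ, ?_⟩
  have e2 : (θ - S.sO θ) * (θ - S.sO (S.sO θ)) = algebraMap (𝓞 F) (𝓞 K) (1 + S.hω.toInteger) * S.αO ^ 2 := by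
    rw [e1, map_add, e1, S.sO_αO, map_add, map_one]
    ring
  rw [e2]
  have hun : IsUnit (1 + S.hω.toInteger) := by
    have : 1 + S.hω.toInteger = - S.hω.toInteger ^ 2 := by linear_combination eta_rel S.hω
    rw [this]
    exact (S.eta_isUnit.pow 2).neg
  refine (isCoprime_one_right.of_isCoprime_of_dvd_right (isUnit_iff_dvd_one.1 (hun.map _))).mul_right (IsCoprime.pow_right ?_)
  have hc : ¬ ϖ ∣ (S.d : 𝓞 F) := fun h =>
    hd3 (S.lambda_dvd_natCast.1 ((S.associated_lambda hϖ h3).dvd_iff_dvd_left.1 h))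
  have := isCoprime_map (K := K) (isCoprime_of_prime_of_not_dvd hϖ hc)
  rw [map_natCast, ← S.αO_cube] at this
  exact (IsCoprime.pow_right_iff (by norm_num)).1 this

end PureCubic

section val

open IsDedekindDomain WithZero

variable {F : Type*} [Field F] [NumberField F]

/-- The valuation at a prime, taken modulo `3`. -/
def val3 (v : HeightOneSpectrum (𝓞 F)) : Fˣ →* Multiplicative (ZMod 3) :=
  (AddMonoidHom.toMultiplicative (Int.castAddHom (ZMod 3))).comp v.valuationOfNeZero

lemma val3_of_eq {v : HeightOneSpectrum (𝓞 F)} {c : Fˣ} {n : 𝓞 F} (hc : (c : F) = n) {z : ℤ}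
    (h : v.intValuation n = exp z) : val3 v c = Multiplicative.ofAdd (z : ZMod 3) := by
  have := v.valuationOfNeZero_eq (K := F) c
  rw [hc, v.valuation_of_algebraMap, h] at this
  have hz : v.valuationOfNeZero (K := F) c = Multiplicative.ofAdd z := WithZero.coe_inj.1 this
  change (AddMonoidHom.toMultiplicative (Int.castAddHom (ZMod 3))) (v.valuationOfNeZero c) = _
  rw [hz]
  rfl

lemma val3_of_not_mem {v : HeightOneSpectrum (𝓞 F)} {c : Fˣ} {n : 𝓞 F} (hc : (c : F) = n)
    (h : n ∉ v.asIdeal) : val3 v c = 1 := by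
  rw [val3_of_eq hc (z := 0)]
  · simp
  · rw [exp_zero]
    exact v.intValuation_eq_one_iff.2 h

lemma val3_of_eq_span {v : HeightOneSpectrum (𝓞 F)} {c : Fˣ} {n : 𝓞 F} (hc : (c : F) = n)
    (h : v.asIdeal = Ideal.span {n}) : val3 v c = Multiplicative.ofAdd (-1) := by
  have hn : n ≠ 0 := by
    rintro rfl
    exact c.ne_zero hc
  rw [val3_of_eq hc (v.intValuation_singleton hn h)]
  simp

lemma val3_unit (v : HeightOneSpectrum (𝓞 F)) (u : (𝓞 F)ˣ) {c : Fˣ} (hc : (c : F) = (u : 𝓞 F)) :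
    val3 v c = 1 :=
  val3_of_not_mem hc fun h => v.isPrime.ne_top (Ideal.eq_top_of_isUnit_mem _ h u.isUnit)

lemma not_mem_of_val3 {v : HeightOneSpectrum (𝓞 F)} {c : Fˣ} {n : 𝓞 F} (hc : (c : F) = n)
    (h : val3 v c = 1) (h3 : ¬ v.asIdeal ^ 3 ∣ Ideal.span {n}) : n ∉ v.asIdeal := by
  have hv := v.valuationOfNeZero_eq (K := F) c
  rw [hc, v.valuation_of_algebraMap] at hv
  set z := Multiplicative.toAdd (v.valuationOfNeZero c) with hz
  have hval : v.intValuation n = exp z := hv.symm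
  rw [val3_of_eq hc hval] at h
  have hz3 : (3 : ℤ) ∣ z := by
    have : (z : ZMod 3) = 0 := h
    exact (ZMod.intCast_zmod_eq_zero_iff_dvd z 3).1 this
  have h0 : z ≤ 0 := by
    have := v.intValuation_le_one n
    rw [hval, ← exp_zero, exp_le_exp] at this
    exact this
  have h1 : -3 < z := by
    rw [← v.intValuation_le_pow_iff_dvd, hval, exp_le_exp] at h3
    push_cast at h3
    omega
  have : z = 0 := by omega
  rw [this, exp_zero] at hval
  exact v.intValuation_eq_one_iff.1 hval

/-- The set of primes which ramify when the cube root of `d` is adjoined. -/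
def ramSet (F : Type*) [Field F] [NumberField F] (d : ℕ) : Set (HeightOneSpectrum (𝓞 F)) :=
  {v | (d : 𝓞 F) ∈ v.asIdeal ∨ (3 : 𝓞 F) ∈ v.asIdeal ∧ d ^ 2 % 9 ≠ 1}

end val

lemma exists_eq_pow_of_zmod_three {m : ℕ} (hm : m = 1 ∨ m = 2) (y : Multiplicative (ZMod 3)) :
    ∃ j : ℕ, y = (Multiplicative.ofAdd (-1) ^ m) ^ j := by
  have : ∃ j : Fin 3, y = (Multiplicative.ofAdd (-1) ^ m) ^ (j : ℕ) := by
    rcases hm with rfl | rfl <;> revert y <;> decide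
  exact ⟨_, this.choose_spec⟩

namespace PureCubic

open IsDedekindDomain

variable {F K : Type*} [Field F] [Field K] [NumberField F] [NumberField K] [Algebra F K]
  [IsCyclotomicExtension {3} ℚ F] (S : PureCubic F K)

lemma exists_prime_dvd {d : ℕ} (hd0 : d ≠ 0) {ϖ : 𝓞 F} (hϖ : Prime ϖ) (h : ϖ ∣ (d : 𝓞 F)) :
    ∃ p : ℕ, p.Prime ∧ p ∣ d ∧ ϖ ∣ (p : 𝓞 F) := by
  rw [← Nat.prod_primeFactorsList hd0, Nat.cast_list_prod] at h
  obtain ⟨a, ha, hda⟩ := (Prime.dvd_prod_iff hϖ).1 h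
  obtain ⟨p, hp, rfl⟩ := List.mem_map.1 ha
  exact ⟨p, Nat.prime_of_mem_primeFactorsList hp, Nat.dvd_of_mem_primeFactorsList hp, hda⟩

lemma exists_invariant_of_ram (hd0 : S.d ≠ 0) (hcf : ∀ p : ℕ, p.Prime → ¬ p ^ 3 ∣ S.d)
    {v : HeightOneSpectrum (𝓞 F)} (hv : v ∈ ramSet F S.d) :
    ∃ ϖ : 𝓞 F, v.asIdeal = Ideal.span {ϖ} ∧
      ∃ m, (m = 1 ∨ m = 2) ∧ ∃ I ∈ S.DJ.ker, ∃ c : Fˣ, (c : F) = (ϖ : F) ^ m ∧ S.fP c = I ^ 3 := by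
  have : IsPrincipalIdealRing (𝓞 F) := IsCyclotomicExtension.Rat.three_pid F
  obtain ⟨ϖ, hs⟩ := (IsPrincipalIdealRing.principal v.asIdeal).principal
  rw [Ideal.submodule_span_eq] at hs
  have hϖ : Prime ϖ := by
    have h0 : ϖ ≠ 0 := by
      rintro rfl
      exact v.ne_bot (by rw [hs]; simp)
    rw [← Ideal.span_singleton_prime h0, ← hs]
    exact v.isPrime
  have hl : ϖ ∣ 3 → 3 ∣ S.d ∨ S.d ^ 2 % 9 ≠ 1 → ∃ ϖ : 𝓞 F, v.asIdeal = Ideal.span {ϖ} ∧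
      ∃ m, (m = 1 ∨ m = 2) ∧ ∃ I ∈ S.DJ.ker, ∃ c : Fˣ, (c : F) = (ϖ : F) ^ m ∧ S.fP c = I ^ 3 := by
    intro h3 h
    refine ⟨_, hs.trans (Ideal.span_singleton_eq_span_singleton.2 (S.associated_lambda hϖ h3)),
      2, Or.inr rfl, ?_⟩
    by_cases h3d : 3 ∣ S.d
    · exact S.exists_invariant_of_dvd hcf h3d
    · exact S.exists_invariant_of_not_dvd h3d (h.resolve_left h3d)
  rcases hv with hv | ⟨hv, h9⟩
  · rw [hs, Ideal.mem_span_singleton] at hv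
    obtain ⟨p, hp, hpd, hϖp⟩ := exists_prime_dvd hd0 hϖ hv
    by_cases hp3 : p = 3
    · subst hp3
      exact hl (by exact_mod_cast hϖp) (Or.inl hpd)
    · exact ⟨ϖ, hs, S.exists_invariant_of_ne_three hd0 hcf hϖ hp hp3 hpd hϖp⟩
  · rw [hs, Ideal.mem_span_singleton] at hv
    exact hl hv (Or.inr h9)

lemma exists_coprime_of_not_ram {ϖ : 𝓞 F} (hϖ : Prime ϖ) (hd : ¬ ϖ ∣ (S.d : 𝓞 F))
    (h3 : ϖ ∣ 3 → S.d ^ 2 % 9 = 1) :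
    ∃ θ, IsCoprime (algebraMap (𝓞 F) (𝓞 K) ϖ) ((θ - S.sO θ) * (θ - S.sO (S.sO θ))) := by
  by_cases h : ϖ ∣ 3
  · exact S.exists_coprime_of_mod_nine hϖ h (h3 h)
  · exact S.exists_coprime_of_not_dvd hϖ h hd

/-- The valuations modulo `3` at all ramified primes. -/
def V (d : ℕ) : Fˣ →* (ramSet F d → Multiplicative (ZMod 3)) := MonoidHom.pi fun v => val3 v.1

lemma finite_ramSet {d : ℕ} (hd0 : d ≠ 0) : (ramSet F d).Finite := by
  have h : Ideal.span {(3 * d : 𝓞 F)} ≠ 0 := by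
    simpa using hd0
  refine (Ideal.finite_factors h).subset fun v hv => ?_
  rw [Set.mem_ofPred_eq, Ideal.dvd_span_singleton]
  rcases hv with hv | hv
  · exact Ideal.mul_mem_left _ _ hv
  · exact Ideal.mul_mem_right _ _ hv.1

lemma exists_V_eq (hd0 : S.d ≠ 0) (hcf : ∀ p : ℕ, p.Prime → ¬ p ^ 3 ∣ S.d)
    (x : ramSet F S.d → Multiplicative (ZMod 3)) :
    ∃ I ∈ S.DJ.ker, ∃ c, S.fP c = I ^ 3 ∧ V S.d c = x := by
  classical
  have := (finite_ramSet (F := F) hd0).to_subtype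
  let H : Subgroup (ramSet F S.d → Multiplicative (ZMod 3)) :=
    { carrier := {x | ∃ I ∈ S.DJ.ker, ∃ c, S.fP c = I ^ 3 ∧ V S.d c = x}
      one_mem' := ⟨1, one_mem _, 1, by simp, by simp⟩
      mul_mem' := by
        rintro _ _ ⟨I, hI, c, hc, rfl⟩ ⟨I', hI', c', hc', rfl⟩
        exact ⟨I * I', mul_mem hI hI', c * c', by rw [map_mul, hc, hc', mul_pow], by rw [map_mul]⟩
      inv_mem' := by
        rintro _ ⟨I, hI, c, hc, rfl⟩
        exact ⟨I⁻¹, inv_mem hI, c⁻¹, by rw [map_inv, hc, inv_pow], by rw [map_inv]⟩ }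
  change x ∈ H
  refine Subgroup.pi_mem_of_mulSingle_mem x fun v => ?_
  obtain ⟨ϖ, hs, m, hm, I, hI, c, hc, hf⟩ := S.exists_invariant_of_ram hd0 hcf v.2
  have hϖ : (ϖ : F) ≠ 0 := by
    intro h
    apply c.ne_zero
    rw [hc, h]
    rcases hm with rfl | rfl <;> simp
  have hcm : c = Units.mk0 (ϖ : F) hϖ ^ m := Units.ext hc
  have hV : V S.d c = Pi.mulSingle v (Multiplicative.ofAdd (-1) ^ m) := by
    ext1 w
    change val3 w.1 c = _
    rw [hcm, map_pow]
    by_cases hw : w = v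
    · subst hw
      rw [Pi.mulSingle_eq_same, val3_of_eq_span (n := ϖ) rfl hs]
    · rw [Pi.mulSingle_eq_of_ne hw, val3_of_not_mem (n := ϖ) rfl, one_pow]
      intro h
      apply hw
      rw [← Ideal.span_singleton_le_iff_mem, ← hs] at h
      exact (Subtype.ext (HeightOneSpectrum.ext (v.1.isMaximal.eq_of_le w.1.isPrime.ne_top h))).symm
  have hmem : Pi.mulSingle v (Multiplicative.ofAdd (-1) ^ m) ∈ H := hV ▸ ⟨I, hI, c, hf, rfl⟩
  obtain ⟨j, hj⟩ := exists_eq_pow_of_zmod_three hm (x v)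
  have := pow_mem hmem j
  rwa [← MonoidHom.mulSingle_apply, ← map_pow, ← hj] at this

end PureCubic

namespace PureCubic

open IsDedekindDomain FractionalIdeal

variable {F K : Type*} [Field F] [Field K] [NumberField F] [NumberField K] [Algebra F K]
  [IsCyclotomicExtension {3} ℚ F] (S : PureCubic F K)

lemma mul_self_mul_self_eq_one (x : Multiplicative (ZMod 3)) : x ^ 3 = 1 := by
  revert x; decide

lemma V_eq_one {c b : Fˣ} (h : S.fP c = S.fP b ^ 3) (d : ℕ) : V d c = 1 := by
  have h1 : S.fP (c / b ^ 3) = 1 := by rw [map_div, h, map_pow, div_self']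
  obtain ⟨u, hu⟩ := mem_ker_toPrincipalIdeal.1 (MonoidHom.mem_ker.2 h1)
  set x := c / b ^ 3 with hx
  have hu1 : ((u : 𝓞 K) : K) = algebraMap F K x := congrArg Units.val hu
  have hu2 : ((u⁻¹ : (𝓞 K)ˣ) : 𝓞 K) = algebraMap F K (x⁻¹ : Fˣ) := by
    have := congrArg (fun z : Kˣ => ((z⁻¹ : Kˣ) : K)) hu
    rw [← map_inv] at this
    rw [map_units_inv]
    simpa using this
  have i1 : IsIntegral ℤ (x : F) := by
    rw [← isIntegral_algebraMap_iff (algebraMap F K).injective, ← hu1]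
    exact RingOfIntegers.isIntegral_coe _
  have i2 : IsIntegral ℤ ((x⁻¹ : Fˣ) : F) := by
    rw [← isIntegral_algebraMap_iff (algebraMap F K).injective, ← hu2]
    exact RingOfIntegers.isIntegral_coe _
  let w : (𝓞 F)ˣ := ⟨⟨x, i1⟩, ⟨_, i2⟩, RingOfIntegers.ext x.mul_inv, RingOfIntegers.ext x.inv_mul⟩
  have hc : c = x * b ^ 3 := by rw [hx, div_mul_cancel]
  funext v
  change val3 v.1 c = 1
  rw [hc, map_mul, map_pow, mul_self_mul_self_eq_one, mul_one]
  exact val3_unit v.1 w rfl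

omit [IsCyclotomicExtension {3} ℚ F] [NumberField F] in
lemma le_one_of_cube_le {I : FractionalIdeal (𝓞 K)⁰ K} (h : I ^ 3 ≤ 1) : I ≤ 1 := by
  intro x hx
  have h3 : x ^ 3 ∈ I ^ 3 := by
    rw [pow_succ, pow_two, pow_succ, pow_two]
    exact mul_mem_mul (mul_mem_mul hx hx) hx
  obtain ⟨y, hy⟩ := (mem_one_iff _).1 (h h3)
  have hi : IsIntegral (𝓞 K) x := IsIntegral.of_pow (by norm_num : 0 < 3) (hy ▸ isIntegral_algebraMap)
  exact (mem_one_iff _).2 (IsIntegrallyClosed.isIntegral_iff.1 hi)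

lemma mem_range_fP {I : (FractionalIdeal (𝓞 K)⁰ K)ˣ} (hI : I ∈ S.DJ.ker) {c : Fˣ}
    (hc : S.fP c = I ^ 3) (hV : V S.d c = 1) : I ∈ S.fP.range := by
  have : IsPrincipalIdealRing (𝓞 F) := IsCyclotomicExtension.Rat.three_pid F
  obtain ⟨b, n, hb, hn, hcb, hcf⟩ := exists_cube_mul_cubefree (R := 𝓞 F) (c : F) c.ne_zero
  have hn' : (n : F) ≠ 0 := RingOfIntegers.coe_ne_zero_iff.2 hn
  have hcu : c = Units.mk0 b hb ^ 3 * Units.mk0 (n : F) hn' := Units.ext hcb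
  set J := I / S.fP (Units.mk0 b hb) with hJ
  have hJker : S.sJ J = J := by
    rw [hJ, map_div, S.sJ_fP, S.mem_ker_DJ.1 hI]
  have hJ3 : J ^ 3 = S.fP (Units.mk0 (n : F) hn') := by
    rw [hJ, div_pow, ← hc, hcu, map_mul, map_pow, mul_div_cancel_left]
  have hJ3' : (J : FractionalIdeal (𝓞 K)⁰ K) ^ 3 = (Ideal.span {algebraMap (𝓞 F) (𝓞 K) n} : Ideal (𝓞 K)) := by
    rw [← Units.val_pow_eq_pow_val, hJ3, S.coe_fP_mk]
  obtain ⟨I₀, hI₀⟩ := le_one_iff_exists_coeIdeal.1 (le_one_of_cube_le (hJ3'.trans_le coeIdeal_le_one))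
  have hI3 : I₀ ^ 3 = Ideal.span {algebraMap (𝓞 F) (𝓞 K) n} := by
    rw [← hI₀, ← coeIdeal_pow] at hJ3'
    exact coeIdeal_injective hJ3'
  have hinv : ∀ x ∈ I₀, S.sO x ∈ I₀ := by
    intro x hx
    have h1 : ((S.sO x : 𝓞 K) : K) ∈ S.phi J := S.mem_phi.2 ⟨x, by rw [← hI₀]; exact mem_coeIdeal_of_mem _ hx, rfl⟩
    rw [← S.coe_sJ, hJker, ← hI₀, mem_coeIdeal] at h1
    obtain ⟨y, hy, hyx⟩ := h1
    rwa [← RingOfIntegers.ext hyx]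
  have hnu : IsUnit n := by
    by_contra hnu
    obtain ⟨ϖ, hirr, hdvd⟩ := WfDvdMonoid.exists_irreducible_factor hnu hn
    have hϖ : Prime ϖ := hirr.prime
    have hnr : ¬ (ϖ ∣ (S.d : 𝓞 F) ∨ (ϖ ∣ 3 ∧ S.d ^ 2 % 9 ≠ 1)) := by
      intro hr
      let v : HeightOneSpectrum (𝓞 F) := ⟨Ideal.span {ϖ}, (Ideal.span_singleton_prime hϖ.ne_zero).2 hϖ,
        by simpa using hϖ.ne_zero⟩
      have hv : v ∈ ramSet F S.d := by
        simpa [ramSet, v, Ideal.mem_span_singleton] using hr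
      have h1 : val3 v c = 1 := congrFun hV ⟨v, hv⟩
      rw [hcu, map_mul, map_pow, mul_self_mul_self_eq_one, one_mul] at h1
      refine not_mem_of_val3 (n := n) rfl h1 ?_ (Ideal.mem_span_singleton.2 hdvd)
      change ¬ Ideal.span {ϖ} ^ 3 ∣ _
      rw [Ideal.span_singleton_pow, Ideal.dvd_span_singleton, Ideal.mem_span_singleton]
      exact hcf ϖ hϖ
    push Not at hnr
    obtain ⟨θ, hθ⟩ := S.exists_coprime_of_not_ram hϖ hnr.1 hnr.2
    exact hcf ϖ hϖ (S.prime_cube_dvd_of_dvd hinv hϖ hI3 hdvd hθ)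
  have hJ1 : J = 1 := by
    apply eq_one_of_cube
    ext1
    rw [Units.val_pow_eq_pow_val, hJ3', Ideal.span_singleton_eq_top.2 (hnu.map _)]
    simp
  exact ⟨_, (div_eq_one.1 hJ1).symm⟩

theorem relIndex_eq_pow_card_ramSet (hd0 : S.d ≠ 0) (hcf : ∀ p : ℕ, p.Prime → ¬ p ^ 3 ∣ S.d) :
    (S.DU.ker.map (toPrincipalIdeal (𝓞 K) K)).relIndex S.DJ.ker = 3 ^ (ramSet F S.d).ncard := by
  have : IsPrincipalIdealRing (𝓞 F) := IsCyclotomicExtension.Rat.three_pid F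
  have := (finite_ramSet (F := F) hd0).to_subtype
  rw [← S.range_fP, relIndex_range_eq_card S.fP S.DJ.ker (V S.d)]
  · rw [Nat.card_fun, Nat.card_eq_fintype_card (α := Multiplicative (ZMod 3)), Fintype.card_multiplicative,
      ZMod.card, Nat.card_coe_set_eq]
  · intro I hI
    obtain ⟨c, hc⟩ := S.NJ_mem_range I
    exact ⟨c, hc.trans (S.NJ_of_mem_ker hI)⟩
  · exact fun c b h => S.V_eq_one h _
  · exact fun I hI c hc hV => S.mem_range_fP hI hc hV
  · exact S.exists_V_eq hd0 hcf

end PureCubic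

section count

open IsDedekindDomain Ideal

variable (F : Type*) [Field F] [NumberField F] [IsCyclotomicExtension {3} ℚ F]

lemma ncard_primesOver_eq {p : ℕ} (hp : p.Prime) :
    (primesOver (span {(p : ℤ)}) (𝓞 F)).ncard = if p % 3 = 1 then 2 else 1 := by
  have : Fact p.Prime := ⟨hp⟩
  by_cases hp3 : p = 3
  · subst hp3
    simpa using IsCyclotomicExtension.Rat.ncard_primesOver_of_prime 3 F
  have : IsGalois ℚ F := IsCyclotomicExtension.isGalois {3} ℚ F
  have hd : ¬ p ∣ 3 := fun h => hp3 ((Nat.prime_dvd_prime_iff_eq hp Nat.prime_three).1 h)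
  have hn3 : p % 3 ≠ 0 := fun h =>
    hp3 (((Nat.prime_dvd_prime_iff_eq Nat.prime_three hp).1 (Nat.dvd_of_mod_eq_zero h)).symm)
  have hne : (span {(p : ℤ)} : Ideal ℤ) ≠ ⊥ := by simpa using hp.ne_zero
  have h := ncard_primesOver_mul_ramificationIdxIn_mul_inertiaDegIn (span {(p : ℤ)}) (𝓞 F) Gal(F/ℚ)
  rw [IsCyclotomicExtension.Rat.ramificationIdxIn_eq_of_not_dvd (m := 3) p F hd,
    IsCyclotomicExtension.Rat.inertiaDegIn_eq_of_not_dvd (m := 3) p F hd, one_mul,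
    IsGalois.card_aut_eq_finrank, IsCyclotomicExtension.Rat.finrank 3 F] at h
  have h2 : Nat.totient 3 = 2 := by decide
  rw [h2] at h
  rcases (by omega : p % 3 = 1 ∨ p % 3 = 2) with h1 | h1
  · have : (p : ZMod 3) = 1 := by
      rw [← Nat.cast_one, ZMod.natCast_eq_natCast_iff]
      exact h1
    rw [this, orderOf_one, mul_one] at h
    rw [if_pos h1, h]
  · have : (p : ZMod 3) = 2 := by
      have := (ZMod.natCast_eq_natCast_iff p 2 3).2 h1
      simpa using this
    have ho : orderOf (2 : ZMod 3) = 2 := orderOf_eq_prime (by decide) (by decide)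
    rw [this, ho] at h
    rw [if_neg (by omega)]
    omega

/-- The rational primes below the ramified primes. -/
def ramPrimes (d : ℕ) : Finset ℕ := d.primeFactors ∪ if d ^ 2 % 9 = 1 then ∅ else {3}

lemma mem_ramPrimes {d : ℕ} (hd : d ≠ 0) {p : ℕ} :
    p ∈ ramPrimes d ↔ (p.Prime ∧ p ∣ d) ∨ (p = 3 ∧ d ^ 2 % 9 ≠ 1) := by
  rw [ramPrimes, Finset.mem_union, Nat.mem_primeFactors_of_ne_zero hd]
  split_ifs with h <;> simp [h]

lemma prime_of_mem_ramPrimes {d : ℕ} (hd : d ≠ 0) {p : ℕ} (h : p ∈ ramPrimes d) : p.Prime := by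
  rcases (mem_ramPrimes hd).1 h with h | h
  · exact h.1
  · exact h.1 ▸ Nat.prime_three

variable {F} in
omit [NumberField F] [IsCyclotomicExtension {3} ℚ F] in
lemma mem_primesOver_iff {p : ℕ} (hp : p.Prime) {Q : Ideal (𝓞 F)} :
    Q ∈ primesOver (span {(p : ℤ)}) (𝓞 F) ↔ Q.IsPrime ∧ (p : 𝓞 F) ∈ Q := by
  constructor
  · rintro ⟨h1, h2⟩
    refine ⟨h1, ?_⟩
    have : (p : ℤ) ∈ Q.under ℤ := h2.over ▸ mem_span_singleton_self _
    simpa [mem_comap] using this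
  · rintro ⟨h1, h2⟩
    refine ⟨h1, ⟨?_⟩⟩
    have hm : (span {(p : ℤ)} : Ideal ℤ).IsMaximal :=
      PrincipalIdealRing.isMaximal_of_irreducible (Nat.prime_iff_prime_int.1 hp).irreducible
    refine hm.eq_of_le (comap_ne_top _ h1.ne_top) ?_
    rw [span_singleton_le_iff_mem]
    simpa [mem_comap] using h2

theorem ncard_ramSet {d : ℕ} (hd : d ≠ 0) :
    (ramSet F d).ncard = ∑ p ∈ ramPrimes d, if p % 3 = 1 then 2 else 1 := by
  classical
  have hfin : ∀ p ∈ ramPrimes d, (primesOver (span {(p : ℤ)}) (𝓞 F)).Finite := by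
    intro p hp
    apply Set.finite_of_ncard_ne_zero
    rw [ncard_primesOver_eq F (prime_of_mem_ramPrimes hd hp)]
    split_ifs <;> norm_num
  let s : ℕ → Finset (Ideal (𝓞 F)) := fun p => if h : p ∈ ramPrimes d then (hfin p h).toFinset else ∅
  have hs : ∀ p ∈ ramPrimes d, ∀ Q, Q ∈ s p ↔ Q.IsPrime ∧ (p : 𝓞 F) ∈ Q := by
    intro p hp Q
    simp only [s, dif_pos hp, Set.Finite.mem_toFinset]
    exact mem_primesOver_iff (prime_of_mem_ramPrimes hd hp)
  have himg : HeightOneSpectrum.asIdeal '' ramSet F d = ((ramPrimes d).biUnion s : Finset (Ideal (𝓞 F))) := by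
    ext Q
    rw [Finset.mem_coe, Finset.mem_biUnion]
    constructor
    · rintro ⟨v, hv, rfl⟩
      rcases hv with hv | hv
      · have hdd : d = d.primeFactorsList.prod := (Nat.prod_primeFactorsList hd).symm
        have key : ∀ l : List ℕ, ((l.prod : ℕ) : 𝓞 F) ∈ v.asIdeal → ∃ p ∈ l, (p : 𝓞 F) ∈ v.asIdeal := by
          intro l
          induction l with
          | nil => exact fun h => absurd ((eq_top_iff_one _).2 (by simpa using h)) v.isPrime.ne_top
          | cons a l ih =>
            intro h
            rw [List.prod_cons, Nat.cast_mul] at h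
            rcases v.isPrime.mem_or_mem h with h | h
            · exact ⟨a, by simp, h⟩
            · obtain ⟨p, hp, hpv⟩ := ih h
              exact ⟨p, by simp [hp], hpv⟩
        rw [hdd] at hv
        obtain ⟨p, hp, hda⟩ := key _ hv
        have hpm : p ∈ ramPrimes d := (mem_ramPrimes hd).2
          (Or.inl ⟨Nat.prime_of_mem_primeFactorsList hp, Nat.dvd_of_mem_primeFactorsList hp⟩)
        exact ⟨p, hpm, (hs p hpm _).2 ⟨v.isPrime, hda⟩⟩
      · have hpm : 3 ∈ ramPrimes d := (mem_ramPrimes hd).2 (Or.inr ⟨rfl, hv.2⟩)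
        exact ⟨3, hpm, (hs 3 hpm _).2 ⟨v.isPrime, by simpa using hv.1⟩⟩
    · rintro ⟨p, hp, hQ⟩
      obtain ⟨h1, h2⟩ := (hs p hp Q).1 hQ
      have hne : Q ≠ ⊥ := by
        rintro rfl
        exact (prime_of_mem_ramPrimes hd hp).ne_zero (by simpa using h2)
      refine ⟨⟨Q, h1, hne⟩, ?_, rfl⟩
      rcases (mem_ramPrimes hd).1 hp with ⟨_, m, hm⟩ | ⟨rfl, h9⟩
      · left
        change (d : 𝓞 F) ∈ Q
        rw [hm, Nat.cast_mul]
        exact Ideal.mul_mem_right _ _ h2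
      · exact Or.inr ⟨by simpa using h2, h9⟩
  have hinj : Function.Injective (HeightOneSpectrum.asIdeal (R := 𝓞 F)) := fun _ _ => HeightOneSpectrum.ext
  rw [← Set.ncard_image_of_injective _ hinj, himg, Set.ncard_coe_finset, Finset.card_biUnion]
  · refine Finset.sum_congr rfl fun p hp => ?_
    rw [← ncard_primesOver_eq F (prime_of_mem_ramPrimes hd hp), Set.ncard_eq_toFinset_card _ (hfin p hp)]
    simp only [s, dif_pos hp]
  · intro p hp q hq hpq
    refine Finset.disjoint_left.2 ?_
    intro Q h1 h2
    obtain ⟨hQ, h1⟩ := (hs p hp Q).1 h1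
    obtain ⟨-, h2⟩ := (hs q hq Q).1 h2
    obtain ⟨u, v, huv⟩ := Nat.isCoprime_iff_coprime.2 ((Nat.coprime_primes (prime_of_mem_ramPrimes hd hp)
      (prime_of_mem_ramPrimes hd hq)).2 hpq)
    apply hQ.ne_top
    rw [eq_top_iff_one]
    have : (1 : 𝓞 F) = (u : 𝓞 F) * p + v * q := by exact_mod_cast (congrArg (Int.cast (R := 𝓞 F)) huv).symm
    rw [this]
    exact add_mem (Ideal.mul_mem_left _ _ h1) (Ideal.mul_mem_left _ _ h2)

end count

namespace PureCubic

variable {F K : Type*} [Field F] [Field K] [NumberField K] [Algebra F K] (S : PureCubic F K)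

/-- The group of ideal classes fixed by `σ`. -/
def fixedClasses : Subgroup (ClassGroup (𝓞 K)) :=
  ((toPrincipalIdeal (𝓞 K) K).range.comap S.DJ).map (ClassGroup.mk K)

omit S in
lemma ker_classGroup_mk : (ClassGroup.mk (R := 𝓞 K) K).ker = (toPrincipalIdeal (𝓞 K) K).range := by
  ext I
  rw [MonoidHom.mem_ker, ← (ClassGroup.equiv K).injective.eq_iff, map_one, ClassGroup.equiv_mk,
    QuotientGroup.mk'_apply, QuotientGroup.eq_one_iff]
  simp

lemma card_fixedClasses : Nat.card S.fixedClasses =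
    (toPrincipalIdeal (𝓞 K) K).range.relIndex ((toPrincipalIdeal (𝓞 K) K).range.comap S.DJ) := by
  rw [← ker_classGroup_mk, Subgroup.relIndex_ker]
  rw [ker_classGroup_mk]
  rfl

lemma DJ_range_le : (toPrincipalIdeal (𝓞 K) K).range ≤ (toPrincipalIdeal (𝓞 K) K).range.comap S.DJ := by
  rintro _ ⟨x, rfl⟩
  exact ⟨S.DU x, S.DJ_principal x⟩

lemma mk_mem_fixedClasses (I : (FractionalIdeal (𝓞 K)⁰ K)ˣ) :
    ClassGroup.mk K I ∈ S.fixedClasses ↔ ClassGroup.mk K (S.sJ I) = ClassGroup.mk K I := by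
  rw [fixedClasses, ← Subgroup.mem_comap, Subgroup.comap_map_eq_self
    (ker_classGroup_mk.trans_le S.DJ_range_le), Subgroup.mem_comap, ← ker_classGroup_mk,
    MonoidHom.mem_ker, DJ_apply, map_div, div_eq_one]

lemma mk0_mem_fixedClasses {I J : (Ideal (𝓞 K))⁰}
    (hJ : (J : Ideal (𝓞 K)) = (I : Ideal (𝓞 K)).map (S.sO : 𝓞 K →+* 𝓞 K)) :
    ClassGroup.mk0 I ∈ S.fixedClasses ↔ ClassGroup.mk0 J = ClassGroup.mk0 I := by
  rw [← ClassGroup.mk_mk0 K, ← ClassGroup.mk_mk0 K, mk_mem_fixedClasses]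
  suffices h : S.sJ (FractionalIdeal.mk0 K I) = FractionalIdeal.mk0 K J by rw [h]
  ext1
  rw [coe_sJ, FractionalIdeal.coe_mk0, FractionalIdeal.coe_mk0, phi_coeIdeal, hJ]

variable [NumberField F] [IsCyclotomicExtension {3} ℚ F]

lemma pow_three_of_mem_fixedClasses {c : ClassGroup (𝓞 K)} (hc : c ∈ S.fixedClasses) :
    c ^ 3 = 1 := by
  have : IsPrincipalIdealRing (𝓞 F) := IsCyclotomicExtension.Rat.three_pid F
  obtain ⟨I, hI, rfl⟩ := hc
  have hI' := (S.mk_mem_fixedClasses I).1 ⟨I, hI, rfl⟩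
  have hI'' : ClassGroup.mk K (S.sJ (S.sJ I)) = ClassGroup.mk K (S.sJ I) := by
    refine (S.mk_mem_fixedClasses (S.sJ I)).1 ?_
    rw [hI']
    exact ⟨I, hI, rfl⟩
  have hN : ClassGroup.mk K (S.NJ I) = 1 := by
    rw [← MonoidHom.mem_ker, ker_classGroup_mk]
    obtain ⟨x, hx⟩ := S.NJ_mem_range I
    exact ⟨_, hx⟩
  rw [NJ_apply, map_mul, map_mul, hI'', hI'] at hN
  rw [pow_succ, pow_two, hN]

open Classical in
lemma nine_mul_card_fixedClasses (hd0 : S.d ≠ 0) (hcf : ∀ p : ℕ, p.Prime → ¬ p ^ 3 ∣ S.d) :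
    9 * Nat.card S.fixedClasses = (if IsCubicNorm (S.d : F) S.ω then 3 else 1) *
      3 ^ ∑ p ∈ ramPrimes S.d, if p % 3 = 1 then 2 else 1 := by
  rw [card_fixedClasses, index_formula, relIndex_eq_pow_card_ramSet S hd0 hcf, ncard_ramSet F hd0]

end PureCubic

/-- A group of exponent three has rank one exactly when it has order three. -/
lemma rank_eq_one_iff_card_of_pow_three {A : Type*} [CommGroup A] [Finite A]
    (h : ∀ a : A, a ^ 3 = 1) : Group.rank A = 1 ↔ Nat.card A = 3 := by
  constructor
  · intro hr
    obtain ⟨s, hs, hs'⟩ := Group.rank_spec A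
    rw [hr, Finset.card_eq_one] at hs
    obtain ⟨g, rfl⟩ := hs
    rw [Finset.coe_singleton, ← Subgroup.zpowers_eq_closure] at hs'
    have hc : Nat.card A = orderOf g := by
      rw [← Nat.card_zpowers, hs', Subgroup.card_top]
    rcases (Nat.dvd_prime Nat.prime_three).1 (orderOf_dvd_of_pow_eq_one (h g)) with h1 | h3
    · exfalso
      rw [h1] at hc
      have : Subsingleton A := (Nat.card_eq_one_iff_unique.1 hc).1
      have h0 := Group.rank_le (G := A) (S := ∅) (Subsingleton.elim _ _)
      rw [hr] at h0
      simp at h0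
    · rw [hc, h3]
  · intro hc
    have : Fact (Nat.Prime 3) := ⟨Nat.prime_three⟩
    have hcyc : IsCyclic A := isCyclic_of_prime_card hc
    obtain ⟨g, hg⟩ := hcyc.exists_generator
    refine le_antisymm ?_ ?_
    · have := Group.rank_le (G := A) (S := {g}) (by
        rw [Finset.coe_singleton, ← Subgroup.zpowers_eq_closure, Subgroup.eq_top_iff']
        exact hg)
      simpa using this
    · rw [Nat.one_le_iff_ne_zero]
      intro hr
      obtain ⟨s, hs, hs'⟩ := Group.rank_spec A
      rw [hr, Finset.card_eq_zero] at hs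
      subst hs
      rw [Finset.coe_empty, Subgroup.closure_empty] at hs'
      have := Subgroup.card_top (G := A)
      rw [← hs', Subgroup.card_bot, hc] at this
      omega

section Concrete

variable {d : ℕ}

lemma isPrimitiveRoot_zetaK : IsPrimitiveRoot (zetaK d) 3 :=
  IsPrimitiveRoot.of_map_of_injective (f := (Kc d).val) zeta3_isPrimitiveRoot
    (Kc d).val.injective

lemma isPrimitiveRoot_zetaK0 : IsPrimitiveRoot (zetaK0 d) 3 :=
  IsPrimitiveRoot.of_map_of_injective (f := (k0S d).val) isPrimitiveRoot_zetaK
    (k0S d).val.injective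

lemma isCyclotomicExtension_adjoin_zetaK : IsCyclotomicExtension {3} ℚ ℚ⟮zetaK d⟯ :=
  IsPrimitiveRoot.intermediateField_adjoin_isCyclotomicExtension (ζ := zetaK d) (n := 3)
    ℚ isPrimitiveRoot_zetaK

instance isCyclotomicExtension_k0S : IsCyclotomicExtension {3} ℚ (k0S d) := by
  convert isCyclotomicExtension_adjoin_zetaK <;> rfl

lemma cbrtK_pow_three : cbrtK d ^ 3 = (d : Kc d) :=
  Subtype.ext (by push_cast; exact cbrt_pow_three d)

lemma adjoin_cbrtK : (k0S d)⟮cbrtK d⟯ = ⊤ := by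
  have h : Kc d ≤ IntermediateField.lift (((k0S d)⟮cbrtK d⟯).restrictScalars ℚ) := by
    refine IntermediateField.adjoin_le_iff.2 ?_
    rintro x (rfl | rfl)
    · exact (IntermediateField.mem_lift (cbrtK d)).2
        (IntermediateField.mem_adjoin_simple_self _ (cbrtK d))
    · exact (IntermediateField.mem_lift (zetaK d)).2
        (((k0S d)⟮cbrtK d⟯).algebraMap_mem (zetaK0 d))
  rw [eq_top_iff]
  intro x _
  exact (IntermediateField.mem_lift x).1 (h x.2)

lemma exists_eq_cbrtK (x : Kc d) : ∃ a b c : k0S d, x = algebraMap (k0S d) (Kc d) a +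
    algebraMap (k0S d) (Kc d) b * cbrtK d + algebraMap (k0S d) (Kc d) c * cbrtK d ^ 2 := by
  have hm : (Polynomial.X ^ 3 - Polynomial.C (d : k0S d)).Monic :=
    Polynomial.monic_X_pow_sub_C _ (by norm_num)
  have hroot : Polynomial.aeval (cbrtK d) (Polynomial.X ^ 3 - Polynomial.C (d : k0S d)) = 0 := by
    simp [cbrtK_pow_three]
  have h_int : IsIntegral (k0S d) (cbrtK d) := ⟨_, hm, hroot⟩
  have hx : x ∈ (k0S d)⟮cbrtK d⟯.toSubalgebra := by
    rw [adjoin_cbrtK]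
    trivial
  rw [IntermediateField.adjoin_simple_toSubalgebra_of_isAlgebraic h_int.isAlgebraic,
    Algebra.adjoin_singleton_eq_range_aeval] at hx
  obtain ⟨p, rfl⟩ := hx
  have hdeg : (p %ₘ (Polynomial.X ^ 3 - Polynomial.C (d : k0S d))).natDegree < 3 := by
    have := Polynomial.natDegree_modByMonic_lt p hm (by
      intro h
      have := congrArg Polynomial.natDegree h
      rw [Polynomial.natDegree_X_pow_sub_C] at this
      simp at this)
    rwa [Polynomial.natDegree_X_pow_sub_C] at this
  set r := p %ₘ (Polynomial.X ^ 3 - Polynomial.C (d : k0S d)) with hr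
  refine ⟨r.coeff 0, r.coeff 1, r.coeff 2, ?_⟩
  · change Polynomial.aeval (cbrtK d) p = _
    rw [← Polynomial.aeval_modByMonic_eq_self_of_root hroot,
      Polynomial.aeval_eq_sum_range' hdeg]
    simp only [Finset.sum_range_succ, Finset.range_zero, Finset.sum_empty, zero_add, pow_zero,
      pow_one, Algebra.smul_def, mul_one]

variable (σ : Kc d ≃ₐ[ℚ] Kc d) (hσfix : ∀ x : Kc d, x ∈ k0S d → σ x = x) (hσne : σ ≠ 1)

include hσfix hσne

lemma map_cbrtK_ne : σ (cbrtK d) ≠ cbrtK d := by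
  intro h
  refine hσne (AlgEquiv.ext fun x => ?_)
  obtain ⟨a, b, c, rfl⟩ := exists_eq_cbrtK x
  simp only [map_add, map_mul, map_pow, h, AlgEquiv.one_apply,
    show ∀ a : k0S d, σ (algebraMap (k0S d) (Kc d) a) = algebraMap (k0S d) (Kc d) a from
      fun a => hσfix _ a.2]

lemma cbrtK_ne_zero : cbrtK d ≠ 0 := by
  intro h
  apply map_cbrtK_ne σ hσfix hσne
  rw [h, map_zero]

lemma exists_map_cbrtK : ∃ ω : k0S d, IsPrimitiveRoot ω 3 ∧
    σ (cbrtK d) = algebraMap (k0S d) (Kc d) ω * cbrtK d := by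
  have h0 := cbrtK_ne_zero σ hσfix hσne
  have h1 : (σ (cbrtK d) / cbrtK d) ^ 3 = 1 := by
    rw [div_pow, ← map_pow, cbrtK_pow_three, map_natCast, ← cbrtK_pow_three,
      div_self (pow_ne_zero 3 h0)]
  obtain ⟨i, -, hi⟩ := isPrimitiveRoot_zetaK.eq_pow_of_pow_eq_one h1
  have hσi : σ (cbrtK d) = algebraMap (k0S d) (Kc d) (zetaK0 d ^ i) * cbrtK d := by
    rw [map_pow]
    change _ = zetaK d ^ i * _
    rw [hi, div_mul_cancel₀ _ h0]
  refine ⟨zetaK0 d ^ i, ?_, hσi⟩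
  have hp : (zetaK0 d ^ i) ^ 3 = 1 := by
    rw [← pow_mul, mul_comm, pow_mul, isPrimitiveRoot_zetaK0.pow_eq_one, one_pow]
  have hone : zetaK0 d ^ i ≠ 1 := by
    intro h
    apply map_cbrtK_ne σ hσfix hσne
    rw [hσi, h, map_one, one_mul]
  have := orderOf_eq_prime hp hone
  rw [← this]
  exact IsPrimitiveRoot.orderOf _

lemma pow_three_ne (x : k0S d) : x ^ 3 ≠ d := by
  intro h
  have h0 := cbrtK_ne_zero σ hσfix hσne
  have hx : (x : Kc d) ^ 3 = cbrtK d ^ 3 := by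
    rw [cbrtK_pow_three]
    exact congrArg Subtype.val h
  have hx0 : (x : Kc d) ≠ 0 := by
    intro h'
    rw [h', zero_pow (by norm_num)] at hx
    exact pow_ne_zero 3 h0 hx.symm
  have h1 : (cbrtK d / x) ^ 3 = 1 := by
    rw [div_pow, hx, div_self (pow_ne_zero 3 h0)]
  obtain ⟨i, -, hi⟩ := isPrimitiveRoot_zetaK.eq_pow_of_pow_eq_one h1
  apply map_cbrtK_ne σ hσfix hσne
  apply hσfix
  rw [← div_mul_cancel₀ (cbrtK d) hx0, ← hi]
  exact mul_mem (pow_mem (zetaK0 d).2 i) x.2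

/-- The extension `k / k₀` as a pure cubic Kummer extension. -/
def pureCubic : PureCubic (k0S d) (Kc d) where
  σ := AlgEquiv.ofRingEquiv (f := (σ : Kc d ≃+* Kc d)) fun x => hσfix _ x.2
  ω := (exists_map_cbrtK σ hσfix hσne).choose
  α := cbrtK d
  d := d
  hω := (exists_map_cbrtK σ hσfix hσne).choose_spec.1
  hα := cbrtK_pow_three
  hσ := (exists_map_cbrtK σ hσfix hσne).choose_spec.2
  hgen := exists_eq_cbrtK
  hd := pow_three_ne σ hσfix hσne

lemma ambiguousSet_eq : ambiguousSet d σ = (pureCubic σ hσfix hσne).fixedClasses := by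
  ext c
  constructor
  · intro hc
    obtain ⟨I, rfl⟩ := ClassGroup.mk0_surjective c
    have hne : (I : Ideal (𝓞 (Kc d))).map (RingOfIntegers.mapRingHom (σ : Kc d →+* Kc d)) ≠ ⊥ := by
      rw [Ne, Ideal.map_eq_bot_iff_of_injective (f := RingOfIntegers.mapRingHom (σ : Kc d →+* Kc d))
        (pureCubic σ hσfix hσne).sO.injective]
      exact nonZeroDivisors.coe_ne_zero I
    exact ((pureCubic σ hσfix hσne).mk0_mem_fixedClasses (I := I)
      (J := ⟨_, mem_nonZeroDivisors_of_ne_zero hne⟩) rfl).2 (hc I rfl _ rfl)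
  · rintro hc I rfl J hJ
    exact ((pureCubic σ hσfix hσne).mk0_mem_fixedClasses (I := I) (J := J) hJ).1 hc

lemma ambiguousClassGroup_eq :
    ambiguousClassGroup d σ = (pureCubic σ hσfix hσne).fixedClasses := by
  rw [ambiguousClassGroup, ambiguousSet_eq σ hσfix hσne, Subgroup.closure_eq, inf_eq_right]
  intro c hc
  have h := (pureCubic σ hσfix hσne).pow_three_of_mem_fixedClasses hc
  rcases (Nat.dvd_prime Nat.prime_three).1 (orderOf_dvd_of_pow_eq_one h) with h1 | h1
  · exact ⟨0, by rw [orderOf_eq_one_iff.1 h1, one_pow]⟩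
  · exact ⟨1, by rw [pow_one, h]⟩

lemma rank_ambiguousClassGroup_eq_one_iff : Group.rank (ambiguousClassGroup d σ) = 1 ↔
    Nat.card (ambiguousClassGroup d σ) = 3 := by
  apply rank_eq_one_iff_card_of_pow_three
  rintro ⟨a, ha⟩
  rw [ambiguousClassGroup_eq σ hσfix hσne] at ha
  exact Subtype.ext ((pureCubic σ hσfix hσne).pow_three_of_mem_fixedClasses ha)

open Classical in
lemma nine_mul_card_ambiguousClassGroup (hd : d ≠ 0) (hcf : IsCubeFree d) :
    9 * Nat.card (ambiguousClassGroup d σ) =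
      (if ∀ p : ℕ, p.Prime → p ∣ d → p = 3 ∨ p % 9 = 1 ∨ p % 9 = 8 then 3 else 1) *
        3 ^ ∑ p ∈ ramPrimes d, if p % 3 = 1 then 2 else 1 := by
  rw [ambiguousClassGroup_eq σ hσfix hσne,
    (pureCubic σ hσfix hσne).nine_mul_card_fixedClasses hd hcf]
  have : IsCubicNorm ((pureCubic σ hσfix hσne).d : k0S d) (pureCubic σ hσfix hσne).ω ↔
      ∀ p : ℕ, p.Prime → p ∣ d → p = 3 ∨ p % 9 = 1 ∨ p % 9 = 8 :=
    ⟨fun h p hp hpd => primes_of_isCubicNorm (pureCubic σ hσfix hσne).hω hd hcf h hp hpd,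
      fun h => isCubicNorm_of_primes (pureCubic σ hσfix hσne).omega_rel hd
        (pureCubic σ hσfix hσne).hd h⟩
  simp only [this]
  rfl

end Concrete

section Arithmetic

lemma exponent_of_isCubeFree {d p e m : ℕ} (hcf : IsCubeFree d) (hp : p.Prime) (hd : d = p ^ e * m)
    (he : e ≠ 0) : e = 1 ∨ e = 2 := by
  have : e < 3 := by
    by_contra! h
    exact hcf p hp (hd ▸ dvd_mul_of_dvd_left (pow_dvd_pow p h) m)
  omega

lemma eq_pow_of_unique_prime {d p : ℕ} (hd : 1 < d) (hcf : IsCubeFree d) (hp : p.Prime)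
    (h : ∀ q : ℕ, q.Prime → q ∣ d → q = p) : ∃ e, (e = 1 ∨ e = 2) ∧ d = p ^ e := by
  have hde := Nat.eq_prime_pow_of_unique_prime_dvd (by omega) (fun {q} => h q)
  refine ⟨_, exponent_of_isCubeFree (m := 1) hcf hp (by rw [mul_one]; exact hde) ?_, hde⟩
  intro h0
  rw [h0, pow_zero] at hde
  omega

lemma eq_pow_mul_pow_of_two_primes {d p q : ℕ} (hd : 1 < d) (hcf : IsCubeFree d) (hp : p.Prime)
    (hq : q.Prime) (hpd : p ∣ d) (hqd : q ∣ d) (hpq : p ≠ q)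
    (h : ∀ r : ℕ, r.Prime → r ∣ d → r = p ∨ r = q) :
    ∃ e f, (e = 1 ∨ e = 2) ∧ (f = 1 ∨ f = 2) ∧ d = p ^ e * q ^ f := by
  obtain ⟨e, m, hm, hde⟩ := Nat.exists_eq_pow_mul_and_not_dvd (n := d) (by omega) p hp.ne_one
  have hm0 : m ≠ 0 := by
    rintro rfl
    exact hm (dvd_zero p)
  have hmq : m = q ^ m.primeFactorsList.length :=
    Nat.eq_prime_pow_of_unique_prime_dvd hm0 fun {r} hr hrm => by
      rcases h r hr (hde ▸ dvd_mul_of_dvd_right hrm _) with rfl | rfl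
      · exact absurd hrm hm
      · rfl
  refine ⟨e, _, exponent_of_isCubeFree hcf hp hde ?_, exponent_of_isCubeFree (e := m.primeFactorsList.length) (m := p ^ e) hcf hq
    (by rw [← hmq, mul_comm]; exact hde) ?_, by rw [← hmq]; exact hde⟩
  · rintro rfl
    rw [pow_zero, one_mul] at hde
    exact hm (hde ▸ hpd)
  · intro h0
    rw [h0, pow_zero] at hmq
    rw [hmq, mul_one] at hde
    exact hpq ((Nat.prime_dvd_prime_iff_eq hq hp).1 (hq.dvd_of_dvd_pow (hde ▸ hqd))).symm

/-- The radicands for which the ambiguous class group has order three. -/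
def IsRankOneRadicand (d : ℕ) : Prop :=
  (∃ p e₁ : ℕ, p.Prime ∧ p % 9 = 1 ∧ (e₁ = 1 ∨ e₁ = 2) ∧ d = p ^ e₁) ∨
  (∃ p e₁ : ℕ, p.Prime ∧ (p % 9 = 4 ∨ p % 9 = 7) ∧ (e₁ = 1 ∨ e₁ = 2) ∧ d = p ^ e₁) ∨
  (∃ p e e₁ : ℕ, p.Prime ∧ (p % 9 = 4 ∨ p % 9 = 7) ∧ (e = 1 ∨ e = 2) ∧
    (e₁ = 1 ∨ e₁ = 2) ∧ d = 3 ^ e * p ^ e₁) ∨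
  (∃ p q e₁ f₁ : ℕ, p.Prime ∧ q.Prime ∧ (p % 9 = 4 ∨ p % 9 = 7) ∧
    (q % 9 = 2 ∨ q % 9 = 5) ∧ (e₁ = 1 ∨ e₁ = 2) ∧ (f₁ = 1 ∨ f₁ = 2) ∧
    d = p ^ e₁ * q ^ f₁ ∧ (d % 9 = 1 ∨ d % 9 = 8))

lemma sq_mod_nine (d : ℕ) : d ^ 2 % 9 = 1 ↔ d % 9 = 1 ∨ d % 9 = 8 := by
  rw [Nat.pow_mod]
  have := Nat.mod_lt d (show 9 > 0 by norm_num)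
  interval_cases d % 9 <;> simp

lemma residues_of_mul_pow {p q e f : ℕ} (hp : p % 3 = 1) (hq : q % 3 = 2) (he : e = 1 ∨ e = 2)
    (hf : f = 1 ∨ f = 2) (h : (p ^ e * q ^ f) % 9 = 1 ∨ (p ^ e * q ^ f) % 9 = 8) :
    (p % 9 = 1 ∧ q % 9 = 8) ∨ ((p % 9 = 4 ∨ p % 9 = 7) ∧ (q % 9 = 2 ∨ q % 9 = 5)) := by
  rw [Nat.mul_mod, Nat.pow_mod p, Nat.pow_mod q] at h
  have hp' : p % 9 = 1 ∨ p % 9 = 4 ∨ p % 9 = 7 := by omega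
  have hq' : q % 9 = 2 ∨ q % 9 = 5 ∨ q % 9 = 8 := by omega
  rcases hp' with hp' | hp' | hp' <;> rcases hq' with hq' | hq' | hq' <;>
    rcases he with rfl | rfl <;> rcases hf with rfl | rfl <;> simp_all

variable {d : ℕ}

lemma isRankOneRadicand_of_sum_eq_two (hd : 1 < d) (hcf : IsCubeFree d) {p : ℕ} (hp : p.Prime)
    (hpd : p ∣ d) (hp3 : p % 3 = 1)
    (hN : ∀ q : ℕ, q.Prime → q ∣ d → q = 3 ∨ q % 9 = 1 ∨ q % 9 = 8)
    (h : ∑ q ∈ (ramPrimes d).erase p, (if q % 3 = 1 then 2 else 1) = 0) : IsRankOneRadicand d := by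
  rw [Finset.sum_eq_zero_iff] at h
  have hu : ∀ q : ℕ, q.Prime → q ∣ d → q = p := by
    intro q hq hqd
    by_contra hne
    have := h q (Finset.mem_erase.2 ⟨hne, (mem_ramPrimes (by omega)).2 (Or.inl ⟨hq, hqd⟩)⟩)
    split_ifs at this
  obtain ⟨e, he, hde⟩ := eq_pow_of_unique_prime hd hcf hp hu
  have := hN p hp hpd
  exact Or.inl ⟨p, e, hp, by omega, he, hde⟩

lemma isRankOneRadicand_of_sum_eq_three (hd : 1 < d) (hcf : IsCubeFree d) {p : ℕ} (hp : p.Prime)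
    (hpd : p ∣ d) (hp3 : p % 3 = 1)
    (hN : ¬ ∀ q : ℕ, q.Prime → q ∣ d → q = 3 ∨ q % 9 = 1 ∨ q % 9 = 8)
    (h : ∑ q ∈ (ramPrimes d).erase p, (if q % 3 = 1 then 2 else 1) = 1) : IsRankOneRadicand d := by
  obtain ⟨q, hq, -⟩ : ∃ q ∈ (ramPrimes d).erase p, (if q % 3 = 1 then 2 else 1) ≠ 0 := by
    apply Finset.exists_ne_zero_of_sum_ne_zero
    omega
  rw [← Finset.add_sum_erase _ _ hq] at h
  have hq3 : q % 3 ≠ 1 := by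
    intro h1
    rw [if_pos h1] at h
    omega
  rw [if_neg hq3, Nat.add_eq_left, Finset.sum_eq_zero_iff] at h
  have hu : ∀ r ∈ ramPrimes d, r = p ∨ r = q := by
    intro r hr
    by_contra! hne
    have := h r (Finset.mem_erase.2 ⟨hne.2, Finset.mem_erase.2 ⟨hne.1, hr⟩⟩)
    split_ifs at this
  have hu' : ∀ r : ℕ, r.Prime → r ∣ d → r = p ∨ r = q := fun r hr hrd =>
    hu r ((mem_ramPrimes (by omega)).2 (Or.inl ⟨hr, hrd⟩))
  obtain ⟨hqp, hqm⟩ := Finset.mem_erase.1 hq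
  have hqprime := prime_of_mem_ramPrimes (by omega) hqm
  by_cases hq' : q = 3
  · subst hq'
    have hp9 : p % 9 = 4 ∨ p % 9 = 7 := by
      by_contra! hne
      apply hN
      intro r hr hrd
      rcases hu' r hr hrd with rfl | rfl <;> omega
    by_cases h3 : 3 ∣ d
    · obtain ⟨e, f, he, hf, hde⟩ := eq_pow_mul_pow_of_two_primes hd hcf hqprime hp h3 hpd hqp
        fun r hr hrd => (hu' r hr hrd).symm
      exact Or.inr (Or.inr (Or.inl ⟨p, e, f, hp, hp9, he, hf, hde⟩))
    · obtain ⟨e, he, hde⟩ := eq_pow_of_unique_prime hd hcf hp fun r hr hrd => by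
        rcases hu' r hr hrd with rfl | rfl
        · rfl
        · exact absurd hrd h3
      exact Or.inr (Or.inl ⟨p, e, hp, hp9, he, hde⟩)
  · have hqd : q ∣ d := by
      rcases (mem_ramPrimes (by omega)).1 hqm with h1 | h1
      · exact h1.2
      · exact absurd h1.1 hq'
    have hd9 : d % 9 = 1 ∨ d % 9 = 8 := by
      rw [← sq_mod_nine]
      by_contra hne
      rcases hu 3 ((mem_ramPrimes (by omega)).2 (Or.inr ⟨rfl, hne⟩)) with rfl | rfl
      · norm_num at hp3
      · exact hq' rfl
    have hq2 : q % 3 = 2 := by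
      have : ¬ 3 ∣ q := fun h3 => hq' ((Nat.prime_dvd_prime_iff_eq Nat.prime_three hqprime).1 h3).symm
      omega
    obtain ⟨e, f, he, hf, hde⟩ := eq_pow_mul_pow_of_two_primes hd hcf hp hqprime hpd hqd
      (Ne.symm hqp) hu'
    rcases residues_of_mul_pow hp3 hq2 he hf (hde ▸ hd9) with ⟨h1, h2⟩ | ⟨h1, h2⟩
    · exfalso
      apply hN
      intro r hr hrd
      rcases hu' r hr hrd with rfl | rfl <;> omega
    · exact Or.inr (Or.inr (Or.inr ⟨p, q, e, f, hp, hqprime, h1, h2, he, hf, hde, hd9⟩))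

lemma sum_ramPrimes_of_eq_pair (hd : d ≠ 0) {p q : ℕ} (hp : p % 3 = 1) (hq : q % 3 ≠ 1)
    (h : ∀ r, ((r.Prime ∧ r ∣ d) ∨ (r = 3 ∧ d ^ 2 % 9 ≠ 1)) ↔ r = p ∨ r = q) :
    ∑ r ∈ ramPrimes d, (if r % 3 = 1 then 2 else 1) = 3 := by
  have hr : ramPrimes d = {p, q} := by
    ext r
    rw [mem_ramPrimes hd, h, Finset.mem_insert, Finset.mem_singleton]
  rw [hr, Finset.sum_pair (by rintro rfl; exact hq hp), if_pos hp, if_neg hq]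

lemma prime_and_dvd_pow_iff {p e r : ℕ} (hp : p.Prime) (he : e = 1 ∨ e = 2) :
    r.Prime ∧ r ∣ p ^ e ↔ r = p := by
  constructor
  · rintro ⟨hr, hrd⟩
    exact (Nat.prime_dvd_prime_iff_eq hr hp).1 (hr.dvd_of_dvd_pow hrd)
  · rintro rfl
    exact ⟨hp, dvd_pow_self _ (by omega)⟩

lemma prime_and_dvd_mul_pow_iff {p q e f r : ℕ} (hp : p.Prime) (hq : q.Prime) (he : e = 1 ∨ e = 2)
    (hf : f = 1 ∨ f = 2) : r.Prime ∧ r ∣ p ^ e * q ^ f ↔ r = p ∨ r = q := by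
  rw [← prime_and_dvd_pow_iff hp he, ← prime_and_dvd_pow_iff hq hf, ← and_or_left]
  exact and_congr_right fun hr => hr.dvd_mul

lemma IsRankOneRadicand.norm_and_sum (h : IsRankOneRadicand d) :
    ((∀ q : ℕ, q.Prime → q ∣ d → q = 3 ∨ q % 9 = 1 ∨ q % 9 = 8) ∧
      ∑ q ∈ ramPrimes d, (if q % 3 = 1 then 2 else 1) = 2) ∨
    ((¬ ∀ q : ℕ, q.Prime → q ∣ d → q = 3 ∨ q % 9 = 1 ∨ q % 9 = 8) ∧
      ∑ q ∈ ramPrimes d, (if q % 3 = 1 then 2 else 1) = 3) := by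
  have key : ∀ p : ℕ, p.Prime → p ∣ d → (p % 9 = 4 ∨ p % 9 = 7) →
      ¬ ∀ q : ℕ, q.Prime → q ∣ d → q = 3 ∨ q % 9 = 1 ∨ q % 9 = 8 := by
    intro p hp hpd hp9 hN
    have := hN p hp hpd
    omega
  rcases h with ⟨p, e, hp, hp9, he, rfl⟩ | ⟨p, e, hp, hp9, he, rfl⟩ |
    ⟨p, e, f, hp, hp9, he, hf, rfl⟩ | ⟨p, q, e, f, hp, hq, hp9, hq9, he, hf, rfl, hd9⟩
  · refine Or.inl ⟨fun q hq hqd => ?_, ?_⟩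
    · obtain rfl := (prime_and_dvd_pow_iff hp he).1 ⟨hq, hqd⟩
      exact Or.inr (Or.inl hp9)
    · have hr : ramPrimes (p ^ e) = {p} := by
        ext r
        rw [mem_ramPrimes (pow_ne_zero e hp.ne_zero), prime_and_dvd_pow_iff hp he,
          Finset.mem_singleton, or_iff_left]
        rintro ⟨-, h⟩
        apply h
        rw [← pow_mul, Nat.pow_mod, hp9, one_pow, Nat.one_mod]
      rw [hr, Finset.sum_singleton, if_pos (by omega)]
  · refine Or.inr ⟨key p hp (dvd_pow_self _ (by omega)) hp9,
      sum_ramPrimes_of_eq_pair (p := p) (q := 3) (pow_ne_zero e hp.ne_zero) (by omega)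
        (by norm_num) fun r => ?_⟩
    rw [prime_and_dvd_pow_iff hp he, and_iff_left]
    rw [← pow_mul, Nat.pow_mod]
    rcases hp9 with hp9 | hp9 <;> rcases he with rfl | rfl <;> rw [hp9] <;> norm_num
  · refine Or.inr ⟨key p hp (dvd_mul_of_dvd_right (dvd_pow_self _ (by omega)) _) hp9,
      sum_ramPrimes_of_eq_pair (p := p) (q := 3) (mul_ne_zero (by positivity)
        (pow_ne_zero f hp.ne_zero)) (by omega) (by norm_num) fun r => ?_⟩
    rw [prime_and_dvd_mul_pow_iff Nat.prime_three hp he hf]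
    tauto
  · refine Or.inr ⟨key p hp (dvd_mul_of_dvd_left (dvd_pow_self _ (by omega)) _) hp9,
      sum_ramPrimes_of_eq_pair (p := p) (q := q) (mul_ne_zero (pow_ne_zero e hp.ne_zero)
        (pow_ne_zero f hq.ne_zero)) (by omega) (by omega) fun r => ?_⟩
    rw [prime_and_dvd_mul_pow_iff hp hq he hf, (sq_mod_nine _).2 hd9]
    simp

open Classical in
lemma eq_three_iff_isRankOneRadicand (hd : 1 < d) (hcf : IsCubeFree d)
    (hsplit : ∃ p : ℕ, p.Prime ∧ p ∣ d ∧ p % 3 = 1) {n : ℕ}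
    (hn : 9 * n = (if ∀ p : ℕ, p.Prime → p ∣ d → p = 3 ∨ p % 9 = 1 ∨ p % 9 = 8 then 3 else 1) *
        3 ^ ∑ p ∈ ramPrimes d, if p % 3 = 1 then 2 else 1) :
    n = 3 ↔ IsRankOneRadicand d := by
  constructor
  · rintro rfl
    obtain ⟨p, hp, hpd, hp3⟩ := hsplit
    rw [← Finset.add_sum_erase _ _ ((mem_ramPrimes (by omega)).2 (Or.inl ⟨hp, hpd⟩)), if_pos hp3] at hn
    have hinj : ∀ a b : ℕ, 3 ^ a = 3 ^ b → a = b := 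
      fun a b => (Nat.pow_right_inj (by norm_num)).1
    split_ifs at hn with hN
    · refine isRankOneRadicand_of_sum_eq_two hd hcf hp hpd hp3 hN (hinj _ _ ?_)
      rw [pow_add] at hn
      omega
    · refine isRankOneRadicand_of_sum_eq_three hd hcf hp hpd hp3 hN (hinj _ _ ?_)
      rw [pow_add] at hn
      omega
  · intro h
    rcases h.norm_and_sum with ⟨hN, hs⟩ | ⟨hN, hs⟩
    · rw [if_pos hN, hs] at hn
      omega
    · rw [if_neg hN, hs] at hn
      omega

end Arithmetic

end Development

/-- **Theorem 2.5**: for a cube-free integer `d > 1` divisible by at least one prime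
`≡ 1 (mod 3)`, the ambiguous `3`-class group of `k/k₀` has rank `1` exactly for the listed
forms of `d`; moreover in these cases it is cyclic of order `3`. -/
theorem rank_one_conductor_with_split_prime
    (d : ℕ) (hd : 1 < d) (hdcf : IsCubeFree d)
    (hsplit : ∃ p : ℕ, p.Prime ∧ p ∣ d ∧ p % 3 = 1)
    (σ : ↥(Kc d) ≃ₐ[ℚ] ↥(Kc d)) (hσfix : ∀ x : ↥(Kc d), x ∈ k0S d → σ x = x)
    (hσne : σ ≠ 1) :
    (Group.rank ↥(ambiguousClassGroup d σ) = 1 ↔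
      ((∃ p e₁ : ℕ, p.Prime ∧ p % 9 = 1 ∧ (e₁ = 1 ∨ e₁ = 2) ∧ d = p ^ e₁) ∨
      (∃ p e₁ : ℕ, p.Prime ∧ (p % 9 = 4 ∨ p % 9 = 7) ∧ (e₁ = 1 ∨ e₁ = 2) ∧ d = p ^ e₁) ∨
      (∃ p e e₁ : ℕ, p.Prime ∧ (p % 9 = 4 ∨ p % 9 = 7) ∧ (e = 1 ∨ e = 2) ∧
        (e₁ = 1 ∨ e₁ = 2) ∧ d = 3 ^ e * p ^ e₁) ∨
      (∃ p q e₁ f₁ : ℕ, p.Prime ∧ q.Prime ∧ (p % 9 = 4 ∨ p % 9 = 7) ∧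
        (q % 9 = 2 ∨ q % 9 = 5) ∧ (e₁ = 1 ∨ e₁ = 2) ∧ (f₁ = 1 ∨ f₁ = 2) ∧
        d = p ^ e₁ * q ^ f₁ ∧ (d % 9 = 1 ∨ d % 9 = 8)))) ∧
    (((∃ p e₁ : ℕ, p.Prime ∧ p % 9 = 1 ∧ (e₁ = 1 ∨ e₁ = 2) ∧ d = p ^ e₁) ∨
      (∃ p e₁ : ℕ, p.Prime ∧ (p % 9 = 4 ∨ p % 9 = 7) ∧ (e₁ = 1 ∨ e₁ = 2) ∧ d = p ^ e₁) ∨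
      (∃ p e e₁ : ℕ, p.Prime ∧ (p % 9 = 4 ∨ p % 9 = 7) ∧ (e = 1 ∨ e = 2) ∧
        (e₁ = 1 ∨ e₁ = 2) ∧ d = 3 ^ e * p ^ e₁) ∨
      (∃ p q e₁ f₁ : ℕ, p.Prime ∧ q.Prime ∧ (p % 9 = 4 ∨ p % 9 = 7) ∧
        (q % 9 = 2 ∨ q % 9 = 5) ∧ (e₁ = 1 ∨ e₁ = 2) ∧ (f₁ = 1 ∨ f₁ = 2) ∧
        d = p ^ e₁ * q ^ f₁ ∧ (d % 9 = 1 ∨ d % 9 = 8))) →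
      Nat.card ↥(ambiguousClassGroup d σ) = 3 ∧ IsCyclic ↥(ambiguousClassGroup d σ)) := by
  have hrank := rank_ambiguousClassGroup_eq_one_iff σ hσfix hσne
  have hcard := eq_three_iff_isRankOneRadicand hd hdcf hsplit
    (nine_mul_card_ambiguousClassGroup σ hσfix hσne (by omega) hdcf)
  refine ⟨hrank.trans hcard, fun h => ?_⟩
  have h3 := hcard.2 h
  exact ⟨h3, isCyclic_of_prime_card h3⟩

end
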